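/- arXiv:2503.06851 — 2 statements merged into one kernel-verified Lean document; each statement's English description precedes it below -/
import Mathlib

section
/- Let T : ℝ^d × 𝒳 → 𝒳 be a continuous action of ℝ^d on a compact metric space (𝒳, 𝐝) whose upper metric mean dimension umdim_M(𝒳,T,𝐝) is finite. Let λ be a Borel probability measure on M^T(𝒳) and let μ = ∫_{M^T(𝒳)} ν dλ(ν) be its barycenter. Then urdim(𝒳,T,𝐝,μ) ≤ ∫_{M^T(𝒳)} urdim(𝒳,T,𝐝,ν) dλ(ν). -/
open MeasureTheory Filter Set
open scoped ENNReal Topology NNReal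

noncomputable section

/-- Shannon entropy (base 2) of a finitely-valued random variable. -/
def shannonEntropy {Ω S : Type*} [MeasurableSpace Ω] [Fintype S]
    (P : Measure Ω) (f : Ω → S) : ℝ :=
  -∑ i : S, ((P (f ⁻¹' {i})).toReal * Real.logb 2 ((P (f ⁻¹' {i})).toReal))

/-- Mutual information (base 2) of two random variables, defined as the supremum over all
finite measurable partitions (encoded as measurable maps into `Fin n`) of
`H(α∘X) + H(β∘Y) - H(α∘X, β∘Y)`. -/
def mutualInfo {Ω A B : Type*} [MeasurableSpace Ω] [MeasurableSpace A] [MeasurableSpace B]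
    (P : Measure Ω) (X : Ω → A) (Y : Ω → B) : ℝ≥0∞ :=
  ⨆ (n : ℕ) (m : ℕ) (α : A → Fin n) (_ : Measurable α) (β : B → Fin m) (_ : Measurable β),
    ENNReal.ofReal (shannonEntropy P (fun ω => α (X ω)) + shannonEntropy P (fun ω => β (Y ω))
      - shannonEntropy P (fun ω => (α (X ω), β (Y ω))))

/-- The box `[0,L)^d ⊆ ℝ^d`. -/
def unitBox (d : ℕ) (L : ℝ) : Set (Fin d → ℝ) := Set.univ.pi fun _ => Set.Ico (0 : ℝ) L

/-- Lebesgue measure on `ℝ^d` restricted to the box `[0,L)^d`. -/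
def boxMeasure (d : ℕ) (L : ℝ) : Measure (Fin d → ℝ) := volume.restrict (unitBox d L)

/-- The space `L¹([0,L)^d, X)` of measurable maps modulo a.e. equality. -/
abbrev L1Maps (d : ℕ) (L : ℝ) (X : Type*) [TopologicalSpace X] :=
  (Fin d → ℝ) →ₘ[boxMeasure d L] X

/-- The `L¹` distance `D(f,g) = ∫_{[0,L)^d} 𝐝(f(u), g(u)) dm(u)`. -/
def L1dist {d : ℕ} {L : ℝ} {X : Type*} [MetricSpace X] (f g : L1Maps d L X) : ℝ :=
  ∫ u, dist (f u) (g u) ∂(boxMeasure d L)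

/-- The Borel σ-algebra of the metric `L1dist` on `L¹([0,L)^d, X)`,
generated by the open balls of the metric. -/
instance L1Maps.measurableSpace {d : ℕ} {L : ℝ} {X : Type*} [MetricSpace X] :
    MeasurableSpace (L1Maps d L X) :=
  MeasurableSpace.generateFrom {s | ∃ (f : L1Maps d L X) (r : ℝ), s = {g | L1dist f g < r}}

/-- The expected mean distortion `E[(1/L^d) ∫_{[0,L)^d} 𝐝(T^u X, Y_u) dm(u)]`. -/
def distortion {X : Type*} [MetricSpace X] (d : ℕ) (T : (Fin d → ℝ) → X → X) (L : ℝ)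
    {Ω : Type*} [MeasurableSpace Ω] (P : Measure Ω) (Xv : Ω → X) (Yv : Ω → L1Maps d L X) : ℝ :=
  ∫ ω, (L ^ d)⁻¹ * ∫ u, dist (T u (Xv ω)) (Yv ω u) ∂(boxMeasure d L) ∂P

/-- `R_L(𝐝, μ, ε)`: the infimum of `I(X;Y)` over all pairs of random variables on a common
probability space with `Law X = μ`, `Y` taking values in `L¹([0,L)^d, X)` and expected mean
distortion `< ε`. -/
def RL {X : Type*} [MetricSpace X] [MeasurableSpace X] (d : ℕ)
    (T : (Fin d → ℝ) → X → X) (μ : Measure X) (L ε : ℝ) : ℝ≥0∞ :=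
  ⨅ (Ω : Type) (_ : MeasurableSpace Ω) (P : Measure Ω) (_ : IsProbabilityMeasure P)
    (Xv : Ω → X) (Yv : Ω → L1Maps d L X) (_ : Measurable Xv) (_ : Measurable Yv)
    (_ : Measure.map Xv P = μ) (_ : distortion d T L P Xv Yv < ε),
    mutualInfo P Xv Yv

/-- The rate distortion function `R(𝐝, μ, ε) = lim_{L→∞} R_L(𝐝, μ, ε)/L^d`, which exists and
equals `inf_{L>0} R_L(𝐝, μ, ε)/L^d`. -/
def RD {X : Type*} [MetricSpace X] [MeasurableSpace X] (d : ℕ)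
    (T : (Fin d → ℝ) → X → X) (μ : Measure X) (ε : ℝ) : ℝ≥0∞ :=
  ⨅ (L : ℝ) (_ : 0 < L), RL d T μ L ε / ENNReal.ofReal (L ^ d)

/-- Upper rate distortion dimension. -/
def urdim {X : Type*} [MetricSpace X] [MeasurableSpace X] (d : ℕ)
    (T : (Fin d → ℝ) → X → X) (μ : Measure X) : ℝ≥0∞ :=
  Filter.limsup (fun ε : ℝ => RD d T μ ε / ENNReal.ofReal (Real.logb 2 (1 / ε))) (𝓝[>] (0 : ℝ))

/-- Lower rate distortion dimension. -/
def lrdim {X : Type*} [MetricSpace X] [MeasurableSpace X] (d : ℕ)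
    (T : (Fin d → ℝ) → X → X) (μ : Measure X) : ℝ≥0∞ :=
  Filter.liminf (fun ε : ℝ => RD d T μ ε / ENNReal.ofReal (Real.logb 2 (1 / ε))) (𝓝[>] (0 : ℝ))

/-- `μ` is invariant under the `ℝ^d`-action `T`. -/
def MeasInvariant {X : Type*} [MeasurableSpace X] (d : ℕ)
    (T : (Fin d → ℝ) → X → X) (μ : Measure X) : Prop :=
  ∀ u : Fin d → ℝ, Measure.map (T u) μ = μ

/-- `T` is a continuous action of the additive group `ℝ^d`. -/
def IsContAction {X : Type*} [TopologicalSpace X] (d : ℕ) (T : (Fin d → ℝ) → X → X) : Prop :=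
  Continuous (fun p : (Fin d → ℝ) × X => T p.1 p.2) ∧ (∀ x, T 0 x = x) ∧
    ∀ u v x, T (u + v) x = T u (T v x)

/-- The metric `𝐝_L(x,y) = sup_{u ∈ [0,L)^d} 𝐝(T^u x, T^u y)`. -/
def dSup {X : Type*} [MetricSpace X] (d : ℕ) (T : (Fin d → ℝ) → X → X) (L : ℝ) (x y : X) : ℝ :=
  ⨆ u : unitBox d L, dist (T u.1 x) (T u.1 y)

/-- The `ε`-covering number of `X` for the (pre)metric `ρ`: the minimal number of open sets
of `ρ`-diameter `< ε` covering `X`. -/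
def covNum (X : Type*) [TopologicalSpace X] (ρ : X → X → ℝ) (ε : ℝ) : ℕ :=
  sInf {n : ℕ | ∃ F : Finset (Set X), F.card = n ∧
    (∀ U ∈ F, IsOpen U ∧ (⨆ x ∈ U, ⨆ y ∈ U, ENNReal.ofReal (ρ x y)) < ENNReal.ofReal ε) ∧
    ⋃₀ (F : Set (Set X)) = Set.univ}

/-- The entropy at scale `ε`: `S(X,T,𝐝,ε) = lim_{L→∞} log₂ #(X, 𝐝_L, ε) / L^d`
(the limit exists, hence equals the limsup used here). -/
def entScale {X : Type*} [MetricSpace X] (d : ℕ) (T : (Fin d → ℝ) → X → X) (ε : ℝ) : ℝ≥0∞ :=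
  Filter.limsup
    (fun L : ℝ => ENNReal.ofReal (Real.logb 2 (covNum X (dSup d T L) ε) / L ^ d)) Filter.atTop

/-- The upper metric mean dimension. -/
def umdim {X : Type*} [MetricSpace X] (d : ℕ) (T : (Fin d → ℝ) → X → X) : ℝ≥0∞ :=
  Filter.limsup (fun ε : ℝ => entScale d T ε / ENNReal.ofReal (Real.logb 2 (1 / ε))) (𝓝[>] (0 : ℝ))

/-- The σ-algebra on the space of Borel probability measures on `X` (for a compact metric `X`
this is the Borel σ-algebra of the weak* topology). -/
instance ProbabilityMeasure.measurableSpace' {α : Type*} [MeasurableSpace α] :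
    MeasurableSpace (ProbabilityMeasure α) :=
  inferInstanceAs (MeasurableSpace {μ : Measure α // IsProbabilityMeasure μ})

/-- The space `M^T(X)` of `T`-invariant Borel probability measures on `X`. -/
abbrev InvM (X : Type*) [MeasurableSpace X] [MetricSpace X] (d : ℕ)
    (T : (Fin d → ℝ) → X → X) :=
  {ν : ProbabilityMeasure X // MeasInvariant d T (ν : Measure X)}

end

namespace RDConv

lemma prod_marg {V B R : Type*} [CommSemiring R] [Fintype V] [DecidableEq V] [Fintype B]
    (p : V → B → R) (hp : ∀ v, ∑ b, p v b = 1) (g : V → B → R) :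
    ∑ w : V → B, (∏ v, p v (w v)) * ∑ v, g v (w v) = ∑ v, ∑ b, p v b * g v b := by
  simp_rw [Finset.mul_sum]
  rw [Finset.sum_comm]
  refine Finset.sum_congr rfl fun v0 _ => ?_
  have key := Finset.prod_univ_sum (fun _ : V => (Finset.univ : Finset B))
    (fun v b => p v b * (if v = v0 then g v0 b else 1))
  rw [Fintype.piFinset_univ] at key
  have h1 : ∀ w : V → B, (∏ v, p v (w v)) * g v0 (w v0)
      = ∏ v, (p v (w v) * (if v = v0 then g v0 (w v) else 1)) := by
    intro w
    rw [Finset.prod_mul_distrib]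
    congr 1
    rw [Finset.prod_ite_eq' Finset.univ v0 (fun v => g v0 (w v))]
    simp
  simp_rw [h1]
  rw [← key, ← Finset.mul_prod_erase Finset.univ _ (Finset.mem_univ v0)]
  rw [Finset.prod_eq_one]
  · simp
  · intro v hv
    have : v ≠ v0 := Finset.ne_of_mem_erase hv
    simp [this, hp v]

lemma prod_sum_one {V B R : Type*} [CommSemiring R] [Fintype V] [DecidableEq V] [Fintype B]
    (p : V → B → R) (hp : ∀ v, ∑ b, p v b = 1) :
    ∑ w : V → B, (∏ v, p v (w v)) = 1 := by
  have key := Finset.prod_univ_sum (fun _ : V => (Finset.univ : Finset B)) p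
  rw [Fintype.piFinset_univ] at key
  rw [← key]
  exact Finset.prod_eq_one fun v _ => hp v

/-- tangent inequality for relative entropy -/
lemma tangent {q ρ c : ℝ} (hq : 0 ≤ q) (hρ : 0 < ρ) (hc : 0 < c) :
    q * Real.log c + q - c * ρ ≤ q * Real.log q - q * Real.log ρ := by
  rcases hq.eq_or_lt with h | h
  · subst h
    have := mul_pos hc hρ
    simp; linarith
  · have h1 := Real.log_le_sub_one_of_pos (show 0 < c * ρ / q by positivity)
    rw [Real.log_div (by positivity) h.ne', Real.log_mul hc.ne' hρ.ne'] at h1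
    have h2 := mul_le_mul_of_nonneg_left h1 hq
    have h3 : q * (c * ρ / q - 1) = c * ρ - q := by field_simp
    rw [h3] at h2
    nlinarith

lemma kl_nonneg {B : Type*} [Fintype B] (p r : B → ℝ) (hp : ∀ b, 0 ≤ p b) (hps : ∑ b, p b = 1)
    (hr : ∀ b, 0 < r b) (hrs : ∑ b, r b = 1) :
    0 ≤ ∑ b, (p b * Real.log (p b) - p b * Real.log (r b)) := by
  have : ∑ b, (p b - r b) ≤ ∑ b, (p b * Real.log (p b) - p b * Real.log (r b)) := by
    refine Finset.sum_le_sum fun b _ => ?_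
    have := tangent (hp b) (hr b) one_pos
    simpa using this
  rw [Finset.sum_sub_distrib, hps, hrs] at this
  simpa using this

lemma kl_tensor {V B : Type*} [Fintype V] [DecidableEq V] [Fintype B]
    (p : V → B → ℝ) (hps : ∀ v, ∑ b, p v b = 1)
    (r : B → ℝ) (hr : ∀ b, 0 < r b) (θ : ℝ) (hθ : 0 < θ) :
    ∑ w : V → B, ((∏ v, p v (w v)) * Real.log (∏ v, p v (w v))
      - (∏ v, p v (w v)) * Real.log (θ * ∏ v, r (w v)))
    = - Real.log θ + ∑ v, ∑ b, (p v b * Real.log (p v b) - p v b * Real.log (r b)) := by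
  have h1 : ∀ w : V → B, ((∏ v, p v (w v)) * Real.log (∏ v, p v (w v))
      - (∏ v, p v (w v)) * Real.log (θ * ∏ v, r (w v)))
      = (∏ v, p v (w v)) * (- Real.log θ) +
        (∏ v, p v (w v)) * ∑ v, (Real.log (p v (w v)) - Real.log (r (w v))) := by
    intro w
    by_cases h : ∏ v, p v (w v) = 0
    · simp [h]
    · have h' : ∀ v ∈ Finset.univ, p v (w v) ≠ 0 := Finset.prod_ne_zero_iff.mp h
      rw [Real.log_mul hθ.ne' (Finset.prod_pos fun v _ => hr _).ne', Real.log_prod h',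
        Real.log_prod (fun v _ => (hr (w v)).ne'), Finset.sum_sub_distrib]
      ring
  simp_rw [h1]
  rw [Finset.sum_add_distrib, ← Finset.sum_mul, prod_sum_one p hps,
    prod_marg p hps (fun v b => Real.log (p v b) - Real.log (r b))]
  simp [mul_sub]

/-- The entropy expression for mutual information of finite-valued variables. -/
lemma ent_identity {Ω : Type*} [MeasurableSpace Ω] (P : Measure Ω) [IsProbabilityMeasure P]
    {n m : ℕ} (f : Ω → Fin n) (g : Ω → Fin m) (hf : Measurable f) (hg : Measurable g)
    (p : Fin n → Fin m → ℝ) (hp : ∀ i j, p i j = (P (f ⁻¹' {i} ∩ g ⁻¹' {j})).toReal) :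
    shannonEntropy P f + shannonEntropy P g - shannonEntropy P (fun ω => (f ω, g ω))
      = (∑ i, ∑ j, p i j * (Real.log (p i j) - Real.log (∑ j', p i j')
          - Real.log (∑ i', p i' j))) / Real.log 2 := by
  have h1 : ∀ i, (P (f ⁻¹' {i})).toReal = ∑ j, p i j := by
    intro i
    simp_rw [hp]
    rw [← ENNReal.toReal_sum (fun _ _ => measure_ne_top _ _), ← tsum_fintype (L := .unconditional _),
      ← measure_iUnion]
    · congr 2; ext ω; simp
    · intro j j' hj
      refine Set.disjoint_left.mpr ?_
      rintro ω ⟨_, h⟩ ⟨_, h'⟩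
      exact hj (h.symm.trans h')
    · intro j
      exact (hf (measurableSet_singleton i)).inter (hg (measurableSet_singleton j))
  have h2 : ∀ j, (P (g ⁻¹' {j})).toReal = ∑ i, p i j := by
    intro j
    simp_rw [hp]
    rw [← ENNReal.toReal_sum (fun _ _ => measure_ne_top _ _), ← tsum_fintype (L := .unconditional _),
      ← measure_iUnion]
    · congr 2; ext ω; simp
    · intro i i' hi
      refine Set.disjoint_left.mpr ?_
      rintro ω ⟨h, _⟩ ⟨h', _⟩
      exact hi (h.symm.trans h')
    · intro i
      exact (hf (measurableSet_singleton i)).inter (hg (measurableSet_singleton j))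
  have h3 : ∀ i j, (P ((fun ω => (f ω, g ω)) ⁻¹' {(i, j)})).toReal = p i j := by
    intro i j
    rw [hp]; congr 2; ext ω; simp
  unfold shannonEntropy
  simp_rw [Fintype.sum_prod_type, h1, h2, h3, Real.logb]
  have e1 : ∑ i, (∑ j, p i j) * (Real.log (∑ j, p i j) / Real.log 2)
      = ∑ i, ∑ j, p i j * (Real.log (∑ j', p i j') / Real.log 2) := by
    simp_rw [Finset.sum_mul]
  have e2 : ∑ j, (∑ i, p i j) * (Real.log (∑ i, p i j) / Real.log 2)
      = ∑ i, ∑ j, p i j * (Real.log (∑ i', p i' j) / Real.log 2) := by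
    simp_rw [Finset.sum_mul]
    rw [Finset.sum_comm]
  rw [e1, e2]
  simp_rw [Finset.sum_div]
  rw [← sub_eq_zero]
  simp only [← Finset.sum_neg_distrib, ← Finset.sum_add_distrib, ← Finset.sum_sub_distrib]
  refine Finset.sum_eq_zero fun i _ => Finset.sum_eq_zero fun j _ => ?_
  ring

lemma qlogq_bound {q : ℝ} (h0 : 0 ≤ q) (h1 : q ≤ 1) : |q * Real.log q| ≤ 1 := by
  have ha : q * Real.log q ≤ 0 := mul_nonpos_of_nonneg_of_nonpos h0 (Real.log_nonpos h0 h1)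
  have hb := tangent h0 one_pos one_pos
  simp at hb
  rw [abs_le]; constructor <;> linarith

lemma integrable_qlogq {A : Type*} [MeasurableSpace A] (ν : Measure A) [IsFiniteMeasure ν]
    (q : A → ℝ) (hqm : Measurable q) (h0 : ∀ x, 0 ≤ q x) (h1 : ∀ x, q x ≤ 1) (l : ℝ) :
    Integrable (fun x => q x * Real.log (q x) - q x * l) ν := by
  refine Integrable.sub ?_ ?_
  · refine Integrable.of_bound (C := 1) ?_ ?_
    · exact (hqm.mul (Real.measurable_log.comp hqm)).aestronglyMeasurable
    · exact ae_of_all _ fun x => qlogq_bound (h0 x) (h1 x)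
  · refine Integrable.mul_const ?_ l
    refine Integrable.of_bound (C := 1) hqm.aestronglyMeasurable (ae_of_all _ fun x => ?_)
    rw [Real.norm_eq_abs, abs_of_nonneg (h0 x)]; exact h1 x

lemma info_bound {A S : Type*} [MeasurableSpace A] [Fintype S] {n m : ℕ}
    (α : A → Fin n) (hα : Measurable α) (b : S → Fin m)
    (μ : Measure A) [IsProbabilityMeasure μ] (ms : S → Measure A)
    (hle : ∀ s, ms s ≤ μ) (q : S → A → ℝ) (hqm : ∀ s, Measurable (q s))
    (h0 : ∀ s x, 0 ≤ q s x) (h1 : ∀ s x, q s x ≤ 1) (ρ : S → ℝ) (hρ : ∀ s, 0 < ρ s)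
    (hρs : ∑ s, ρ s ≤ 1) (p : Fin n → Fin m → ℝ)
    (hp : ∀ i j, p i j = ∑ s, if b s = j then ∫ x in α ⁻¹' {i}, q s x ∂(ms s) else 0)
    (hmarg : ∀ i, ∑ j, p i j = (μ (α ⁻¹' {i})).toReal) :
    ∑ i, ∑ j, p i j * (Real.log (p i j) - Real.log (∑ j', p i j') - Real.log (∑ i', p i' j))
      ≤ ∑ s, ∫ x, (q s x * Real.log (q s x) - q s x * Real.log (ρ s)) ∂(ms s) := by
  have hfin : ∀ s, IsFiniteMeasure (ms s) := fun s => isFiniteMeasure_of_le μ (hle s)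
  set π : S → Fin n → ℝ := fun s i => ∫ x in α ⁻¹' {i}, q s x ∂(ms s) with hπ
  have hπ0 : ∀ s i, 0 ≤ π s i := fun s i => integral_nonneg (h0 s)
  have hp' : ∀ i j, p i j = ∑ s, if b s = j then π s i else 0 := hp
  have hp0 : ∀ i j, 0 ≤ p i j := by
    intro i j; rw [hp']; refine Finset.sum_nonneg fun s _ => ?_
    split_ifs; exacts [hπ0 s i, le_rfl]
  have hπp : ∀ s i, π s i ≤ p i (b s) := by
    intro s i
    rw [hp']
    have := Finset.single_le_sum (f := fun s' => if b s' = b s then π s' i else 0)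
      (fun s' _ => by split_ifs; exacts [hπ0 s' i, le_rfl]) (Finset.mem_univ s)
    simpa using this
  set c : Fin n → Fin m → ℝ := fun i j => p i j / ((∑ j', p i j') * (∑ i', p i' j)) with hc
  have hm : ∀ i, MeasurableSet (α ⁻¹' {i}) := fun i => hα (measurableSet_singleton i)
  have hIntg : ∀ s, Integrable (fun x => q s x * Real.log (q s x) - q s x * Real.log (ρ s)) (ms s) :=
    fun s => integrable_qlogq (ms s) (q s) (hqm s) (h0 s) (h1 s) _
  have hqint : ∀ s, Integrable (q s) (ms s) := fun s => by
    refine Integrable.of_bound (C := 1) (hqm s).aestronglyMeasurable (ae_of_all _ fun x => ?_)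
    rw [Real.norm_eq_abs, abs_of_nonneg (h0 s x)]; exact h1 s x
  -- piecewise
  have hpiece : ∀ s i, π s i * Real.log (c i (b s)) + π s i
      - c i (b s) * (ρ s * (μ (α ⁻¹' {i})).toReal)
      ≤ ∫ x in α ⁻¹' {i}, (q s x * Real.log (q s x) - q s x * Real.log (ρ s)) ∂(ms s) := by
    intro s i
    have hmle : (ms s (α ⁻¹' {i})).toReal ≤ (μ (α ⁻¹' {i})).toReal :=
      ENNReal.toReal_mono (measure_ne_top _ _) (hle s _)
    have gen : ∀ c' : ℝ, 0 < c' → π s i * Real.log c' + π s i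
      - c' * (ρ s * (ms s (α ⁻¹' {i})).toReal)
      ≤ ∫ x in α ⁻¹' {i}, (q s x * Real.log (q s x) - q s x * Real.log (ρ s)) ∂(ms s) := by
      intro c' hc'
      have : ∫ x in α ⁻¹' {i}, (q s x * Real.log c' + q s x - c' * ρ s) ∂(ms s)
          = π s i * Real.log c' + π s i - c' * (ρ s * (ms s (α ⁻¹' {i})).toReal) := by
        rw [integral_sub, integral_add, integral_mul_const, integral_const]
        · simp [Measure.real, hπ]; ring
        · exact ((hqint s).mul_const _).integrableOn
        · exact (hqint s).integrableOn
        · exact ((hqint s).mul_const _).integrableOn.add (hqint s).integrableOn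
        · exact integrable_const _
      rw [← this]
      refine integral_mono ?_ (hIntg s).integrableOn ?_
      · exact (((hqint s).mul_const _).integrableOn.add (hqint s).integrableOn).sub
          (integrable_const _)
      · intro x; exact tangent (h0 s x) (hρ s) hc'
    rcases (hp0 i (b s)).eq_or_lt with h | h
    · have hz : π s i = 0 := le_antisymm (h ▸ hπp s i) (hπ0 s i)
      have hcz : c i (b s) = 0 := by simp [hc, ← h]
      rw [hz, hcz]
      simp only [zero_mul, add_zero, sub_zero]
      have hae := (integral_eq_zero_iff_of_nonneg (f := q s) (fun x => h0 s x)
        (hqint s).integrableOn).mp hz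
      rw [integral_congr_ae (g := fun _ => (0 : ℝ))]
      · simp
      · filter_upwards [hae] with x hx
        simp at hx; simp [hx]
    · have hA : 0 < ∑ j', p i j' := lt_of_lt_of_le h
        (Finset.single_le_sum (fun j _ => hp0 i j) (Finset.mem_univ (b s)))
      have hB : 0 < ∑ i', p i' (b s) := lt_of_lt_of_le h
        (Finset.single_le_sum (f := fun i' => p i' (b s)) (fun i _ => hp0 i _) (Finset.mem_univ i))
      have hcpos : 0 < c i (b s) := by simp only [hc]; positivity
      refine le_trans ?_ (gen _ hcpos)
      have := mul_le_mul_of_nonneg_left (mul_le_mul_of_nonneg_left hmle (hρ s).le) hcpos.le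
      linarith
  have hsplit : ∀ s, ∫ x, (q s x * Real.log (q s x) - q s x * Real.log (ρ s)) ∂(ms s)
      = ∑ i, ∫ x in α ⁻¹' {i}, (q s x * Real.log (q s x) - q s x * Real.log (ρ s)) ∂(ms s) := by
    intro s
    rw [← integral_iUnion_fintype hm]
    · have : (⋃ i, α ⁻¹' {i}) = Set.univ := by ext x; simp
      rw [this, setIntegral_univ]
    · intro i i' hi
      refine Set.disjoint_left.mpr ?_
      intro x h h'
      exact hi (h.symm.trans h')
    · exact fun i => (hIntg s).integrableOn
  simp_rw [hsplit]
  refine le_trans ?_ (Finset.sum_le_sum fun s _ => Finset.sum_le_sum fun i _ => hpiece s i)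
  simp_rw [Finset.sum_sub_distrib, Finset.sum_add_distrib]
  -- first term
  have t1 : ∑ s, ∑ i, π s i * Real.log (c i (b s)) = ∑ i, ∑ j, p i j * Real.log (c i j) := by
    rw [Finset.sum_comm]
    refine Finset.sum_congr rfl fun i _ => ?_
    simp_rw [hp', Finset.sum_mul]
    rw [Finset.sum_comm]
    refine Finset.sum_congr rfl fun s _ => ?_
    simp [ite_mul, Finset.sum_ite_eq]
  have t1' : ∑ i, ∑ j, p i j * Real.log (c i j) = ∑ i, ∑ j, p i j *
      (Real.log (p i j) - Real.log (∑ j', p i j') - Real.log (∑ i', p i' j)) := by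
    refine Finset.sum_congr rfl fun i _ => Finset.sum_congr rfl fun j _ => ?_
    rcases (hp0 i j).eq_or_lt with h | h
    · simp [← h]
    · have hA : 0 < ∑ j', p i j' := lt_of_lt_of_le h
        (Finset.single_le_sum (fun j _ => hp0 i j) (Finset.mem_univ j))
      have hB : 0 < ∑ i', p i' j := lt_of_lt_of_le h
        (Finset.single_le_sum (f := fun i' => p i' j) (fun i _ => hp0 i _) (Finset.mem_univ i))
      simp only [hc]
      rw [Real.log_div h.ne' (by positivity), Real.log_mul hA.ne' hB.ne']
      ring
  have t2 : ∑ s, ∑ i, π s i = 1 := by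
    have e1 : ∑ s, ∑ i, π s i = ∑ i, ∑ j, p i j := by
      rw [Finset.sum_comm]
      refine Finset.sum_congr rfl fun i _ => ?_
      simp_rw [hp']
      rw [Finset.sum_comm]
      simp
    rw [e1]
    simp_rw [hmarg]
    rw [← ENNReal.toReal_sum (fun _ _ => measure_ne_top _ _), ← tsum_fintype (L := .unconditional _),
      ← measure_iUnion]
    · have : (⋃ i, α ⁻¹' {i}) = Set.univ := by ext x; simp
      rw [this]; simp
    · intro i i' hi
      refine Set.disjoint_left.mpr ?_
      intro x h h'
      exact hi (h.symm.trans h')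
    · exact hm
  have t3 : ∑ s, ∑ i, c i (b s) * (ρ s * (μ (α ⁻¹' {i})).toReal) ≤ 1 := by
    refine le_trans (Finset.sum_le_sum fun s _ => ?_) hρs
    have : ∀ i, c i (b s) * (ρ s * (μ (α ⁻¹' {i})).toReal) ≤ ρ s * (p i (b s) / ∑ i', p i' (b s)) := by
      intro i
      rw [← hmarg]
      simp only [hc]
      by_cases hA : ∑ j', p i j' = 0
      · simp only [hA]; simp
        exact mul_nonneg (hρ s).le (div_nonneg (hp0 _ _) (Finset.sum_nonneg fun i _ => hp0 _ _))
      · apply le_of_eq; by_cases hB : ∑ i', p i' (b s) = 0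
        · simp [hB]
        · field_simp
    refine le_trans (Finset.sum_le_sum fun i _ => this i) ?_
    rw [← Finset.mul_sum, ← Finset.sum_div]
    exact mul_le_of_le_one_right (hρ s).le (div_self_le_one _)
  rw [t1, t1', t2]
  linarith

end RDConv

namespace RDConv

lemma RL_le_of_mix {X : Type*} [MetricSpace X] [CompactSpace X] [MeasurableSpace X] [BorelSpace X]
    (d : ℕ) (T : (Fin d → ℝ) → X → X) (μ : Measure X) [IsProbabilityMeasure μ] (N ε : ℝ)
    {S : Type} [Fintype S] [MeasurableSpace S] [DiscreteMeasurableSpace S]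
    (ms : S → Measure X) (hle : ∀ s, ms s ≤ μ) (q : S → X → ℝ) (hqm : ∀ s, Measurable (q s))
    (h0 : ∀ s x, 0 ≤ q s x) (h1 : ∀ s x, q s x ≤ 1) (ρ : S → ℝ) (hρ : ∀ s, 0 < ρ s)
    (hρs : ∑ s, ρ s ≤ 1) (y : S → L1Maps d N X)
    (hsum : ∑ s, (ms s).withDensity (fun x => ENNReal.ofReal (q s x)) = μ)
    (hdist : ∑ s, ∫⁻ x, ENNReal.ofReal (q s x) * ENNReal.ofReal
        ((N ^ d)⁻¹ * ∫ u, dist (T u x) (y s u) ∂(boxMeasure d N)) ∂(ms s) < ENNReal.ofReal ε)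
    (hN : 0 < N) :
    RL d T μ N ε ≤ ENNReal.ofReal
      ((∑ s, ∫ x, (q s x * Real.log (q s x) - q s x * Real.log (ρ s)) ∂(ms s)) / Real.log 2) := by
  have hfin : ∀ s, IsFiniteMeasure (ms s) := fun s => isFiniteMeasure_of_le μ (hle s)
  have : Nonempty X := nonempty_of_isProbabilityMeasure μ
  obtain ⟨f, hf⟩ := exists_measurableEmbedding_real X
  obtain ⟨g, hg, hgf⟩ := hf.exists_measurable_extend measurable_id (fun _ => inferInstance)
  have hgf' : ∀ x, g (f x) = x := fun x => congrFun hgf x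
  set φ : S → X → ℝ × S := fun s x => (f x, s) with hφ
  have hφm : ∀ s, Measurable (φ s) := fun s => hf.measurable.prodMk measurable_const
  set P : Measure (ℝ × S) :=
    ∑ s, ((ms s).withDensity (fun x => ENNReal.ofReal (q s x))).map (φ s) with hP
  have hPapp : ∀ E : Set (ℝ × S), MeasurableSet E →
      P E = ∑ s, (ms s).withDensity (fun x => ENNReal.ofReal (q s x)) (φ s ⁻¹' E) := by
    intro E hE
    rw [hP, Measure.finsetSum_apply]
    exact Finset.sum_congr rfl fun s _ => Measure.map_apply (hφm s) hE
  have hPX : ∀ A : Set X, MeasurableSet A → P ((fun ω : ℝ × S => g ω.1) ⁻¹' A) = μ A := by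
    intro A hA
    rw [hPapp ((fun ω : ℝ × S => g ω.1) ⁻¹' A) ((hg.comp measurable_fst) hA)]
    conv_rhs => rw [← hsum, Measure.finsetSum_apply]
    refine Finset.sum_congr rfl fun s _ => ?_
    congr 1; ext x; simp [hφ, hgf']
  have : IsProbabilityMeasure P := ⟨by simpa using hPX Set.univ MeasurableSet.univ⟩
  have hYm : Measurable (fun ω : ℝ × S => y ω.2) :=
    (Measurable.of_discrete (f := y)).comp measurable_snd
  have hXm : Measurable (fun ω : ℝ × S => g ω.1) := hg.comp measurable_fst
  unfold RL
  refine iInf_le_of_le (ℝ × S) (iInf_le_of_le inferInstance (iInf_le_of_le P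
    (iInf_le_of_le inferInstance (iInf_le_of_le (fun ω => g ω.1) (iInf_le_of_le (fun ω => y ω.2)
    (iInf_le_of_le hXm (iInf_le_of_le hYm (iInf_le_of_le ?_ (iInf_le_of_le ?_ ?_)))))))))
  · ext A hA
    rw [Measure.map_apply hXm hA, hPX A hA]
  · unfold distortion
    refine lt_of_le_of_lt (Real.le_norm_self _) ?_
    refine lt_of_le_of_lt (norm_integral_le_lintegral_norm _) ?_
    refine ENNReal.toReal_lt_of_lt_ofReal (lt_of_le_of_lt ?_ hdist)
    rw [hP, lintegral_finsetSum_measure]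
    refine Finset.sum_le_sum fun s _ => ?_
    refine (lintegral_map_le _ _).trans ?_
    refine (lintegral_withDensity_le_lintegral_mul _
      (ENNReal.measurable_ofReal.comp (hqm s)) _).trans ?_
    refine lintegral_mono fun x => ?_
    simp only [Pi.mul_apply, hφ, hgf']
    rw [Real.norm_of_nonneg]
    · rfl
    · exact mul_nonneg (by positivity) (integral_nonneg fun u => dist_nonneg)
  · unfold mutualInfo
    refine iSup_le fun n => iSup_le fun m => iSup_le fun α => iSup_le fun hα => iSup_le fun β =>
      iSup_le fun hβ => ENNReal.ofReal_le_ofReal ?_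
    set p : Fin n → Fin m → ℝ := fun i j => (P ((fun ω : ℝ × S => α (g ω.1)) ⁻¹' {i} ∩
      (fun ω : ℝ × S => β (y ω.2)) ⁻¹' {j})).toReal with hp
    rw [ent_identity P (fun ω => α (g ω.1)) (fun ω => β (y ω.2)) (hα.comp hXm) (hβ.comp hYm) p
      (fun _ _ => rfl)]
    refine div_le_div_of_nonneg_right ?_ (Real.log_pos one_lt_two).le
    have hαX : Measurable (fun ω : ℝ × S => α (g ω.1)) := hα.comp hXm
    have hβY : Measurable (fun ω : ℝ × S => β (y ω.2)) := hβ.comp hYm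
    have hpe : ∀ i j, p i j = ∑ s, if β (y s) = j then ∫ x in α ⁻¹' {i}, q s x ∂(ms s) else 0 := by
      intro i j
      simp only [hp]
      rw [hPapp _ ((hαX (measurableSet_singleton i)).inter
        (hβY (measurableSet_singleton j))), ENNReal.toReal_sum]
      · refine Finset.sum_congr rfl fun s _ => ?_
        split_ifs with h
        · have : φ s ⁻¹' ((fun ω : ℝ × S => α (g ω.1)) ⁻¹' {i} ∩
              (fun ω : ℝ × S => β (y ω.2)) ⁻¹' {j}) = α ⁻¹' {i} := by
            ext x; simp [hφ, hgf', h]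
          rw [this, withDensity_apply _ (hα (measurableSet_singleton i)),
            integral_eq_lintegral_of_nonneg_ae (ae_of_all _ (h0 s)) (hqm s).aestronglyMeasurable]
        · have : φ s ⁻¹' ((fun ω : ℝ × S => α (g ω.1)) ⁻¹' {i} ∩
              (fun ω : ℝ × S => β (y ω.2)) ⁻¹' {j}) = ∅ := by
            ext x; simp [hφ, h]
          rw [this]; simp
      · intro s _
        have : (ms s).withDensity (fun x => ENNReal.ofReal (q s x)) ≤ μ := by
          rw [← hsum]
          exact Measure.le_iff.mpr fun A hA => by
            rw [Measure.finsetSum_apply]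
            exact Finset.single_le_sum (f := fun s => (ms s).withDensity
              (fun x => ENNReal.ofReal (q s x)) A) (fun _ _ => zero_le) (Finset.mem_univ s)
        exact ((this _).trans_lt (measure_lt_top _ _)).ne
    refine info_bound α hα (fun s => β (y s)) μ ms hle q hqm h0 h1 ρ hρ hρs p hpe ?_
    intro i
    rw [← hPX _ (hα (measurableSet_singleton i))]
    simp only [hp]
    rw [← ENNReal.toReal_sum (fun _ _ => measure_ne_top _ _), ← tsum_fintype (L := .unconditional _),
      ← measure_iUnion]
    · congr 2; ext ω; simp
    · intro j j' hj
      refine Set.disjoint_left.mpr ?_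
      rintro ω ⟨_, h⟩ ⟨_, h'⟩
      exact hj (h.symm.trans h')
    · intro j
      exact ((hα.comp hXm) (measurableSet_singleton i)).inter
        ((hβ.comp hYm) (measurableSet_singleton j))

end RDConv

namespace RDConv

set_option linter.unusedSectionVars false

/-- A finite coding scheme on the box of side `p / q`. -/
structure Code (X : Type*) [MeasurableSpace X] where
  p : ℕ
  q : ℕ
  hp : 0 < p
  hq : 0 < q
  n : ℕ
  κ : X → Fin n → ℝ
  κ_meas : ∀ b, Measurable fun x => κ x b
  κ_nonneg : ∀ x b, 0 ≤ κ x b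
  κ_sum : ∀ x, ∑ b, κ x b = 1
  r : Fin n → ℝ
  r_pos : ∀ b, 0 < r b
  r_sum : ∑ b, r b = 1
  pts : Fin n → X

noncomputable def Code.L {X : Type*} [MeasurableSpace X] (c : Code X) : ℝ := (c.p : ℝ) / c.q

lemma Code.L_pos {X : Type*} [MeasurableSpace X] (c : Code X) : 0 < c.L :=
  div_pos (Nat.cast_pos.mpr c.hp) (Nat.cast_pos.mpr c.hq)

noncomputable def Code.cost {X : Type*} [MeasurableSpace X] (c : Code X) (x : X) : ℝ :=
  (∑ b, (c.κ x b * Real.log (c.κ x b) - c.κ x b * Real.log (c.r b))) / Real.log 2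

noncomputable def rho {X : Type*} [MetricSpace X] (d : ℕ) (T : (Fin d → ℝ) → X → X) (L : ℝ)
    (x y : X) : ℝ≥0∞ :=
  ENNReal.ofReal ((L ^ d)⁻¹) * ∫⁻ u, ENNReal.ofReal (dist (T u x) (T u y)) ∂(boxMeasure d L)

noncomputable def Code.dst {X : Type*} [MeasurableSpace X] [MetricSpace X] (d : ℕ)
    (T : (Fin d → ℝ) → X → X) (c : Code X) (x : X) : ℝ≥0∞ :=
  ∑ b, ENNReal.ofReal (c.κ x b) * rho d T c.L x (c.pts b)

lemma Code.cost_nonneg {X : Type*} [MeasurableSpace X] (c : Code X) (x : X) : 0 ≤ c.cost x :=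
  div_nonneg (kl_nonneg _ _ (c.κ_nonneg x) (c.κ_sum x) c.r_pos c.r_sum)
    (Real.log_pos one_lt_two).le

lemma Code.cost_meas {X : Type*} [MeasurableSpace X] (c : Code X) : Measurable c.cost := by
  refine Measurable.div_const ?_ _
  refine Finset.measurable_sum _ fun b _ => ?_
  exact ((c.κ_meas b).mul (Real.measurable_log.comp (c.κ_meas b))).sub ((c.κ_meas b).mul_const _)

lemma Code.κ_le_one {X : Type*} [MeasurableSpace X] (c : Code X) (x : X) (b : Fin c.n) :
    c.κ x b ≤ 1 := by
  rw [← c.κ_sum x]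
  exact Finset.single_le_sum (fun b _ => c.κ_nonneg x b) (Finset.mem_univ b)

lemma T_meas {X : Type*} [MetricSpace X] [CompactSpace X] [MeasurableSpace X] [BorelSpace X]
    {d : ℕ} {T : (Fin d → ℝ) → X → X} (hT : IsContAction d T) (u : Fin d → ℝ) :
    Measurable (T u) := by
  have : Continuous (T u) := hT.1.comp (Continuous.prodMk_right u)
  exact this.measurable

lemma rho_meas {X : Type*} [MetricSpace X] [CompactSpace X] [MeasurableSpace X] [BorelSpace X]
    {d : ℕ} {T : (Fin d → ℝ) → X → X} (hT : IsContAction d T) (L : ℝ) (y : X) :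
    Measurable (fun x => rho d T L x y) := by
  unfold rho
  refine Measurable.const_mul ?_ _
  have : SFinite (boxMeasure d L) := by unfold boxMeasure; infer_instance
  refine Measurable.lintegral_prod_right' (f := fun z : X × (Fin d → ℝ) =>
    ENNReal.ofReal (dist (T z.2 z.1) (T z.2 y))) ?_
  refine ENNReal.measurable_ofReal.comp (Continuous.measurable ?_)
  refine Continuous.dist (hT.1.comp continuous_swap) ?_
  exact hT.1.comp (continuous_snd.prodMk continuous_const)

lemma Code.dst_meas {X : Type*} [MetricSpace X] [CompactSpace X] [MeasurableSpace X] [BorelSpace X]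
    {d : ℕ} {T : (Fin d → ℝ) → X → X} (hT : IsContAction d T) (c : Code X) :
    Measurable (c.dst d T) := by
  refine Finset.measurable_sum _ fun b _ => ?_
  exact (ENNReal.measurable_ofReal.comp (c.κ_meas b)).mul (rho_meas hT _ _)

/-- lattice vectors -/
def lat {d t : ℕ} (L : ℝ) (v : Fin d → Fin t) : Fin d → ℝ := fun i => L * ((v i : ℕ) : ℝ)

lemma tile_lint {d t : ℕ} {L : ℝ} (hL : 0 < L) (g : (Fin d → ℝ) → ℝ≥0∞) :
    ∫⁻ u, g u ∂(boxMeasure d (t * L))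
      ≤ ∑ v : Fin d → Fin t, ∫⁻ u, g (u + lat L v) ∂(boxMeasure d L) := by
  unfold boxMeasure
  have hsub : unitBox d (t * L) ⊆
      ⋃ v : Fin d → Fin t, {u | u - lat L v ∈ unitBox d L} := by
    intro u hu
    simp only [unitBox, Set.mem_pi, Set.mem_univ, true_implies, Set.mem_Ico] at hu
    have hlt : ∀ i, ⌊u i / L⌋₊ < t := fun i => by
      rw [Nat.floor_lt (div_nonneg (hu i).1 hL.le), div_lt_iff₀ hL]
      exact (hu i).2
    refine Set.mem_iUnion.mpr ⟨fun i => ⟨⌊u i / L⌋₊, hlt i⟩, ?_⟩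
    simp only [unitBox, Set.mem_ofPred_eq, Set.mem_pi, Set.mem_univ, true_implies, Set.mem_Ico,
      Pi.sub_apply, lat]
    intro i
    have h1 := Nat.floor_le (div_nonneg (hu i).1 hL.le)
    have h2 := Nat.lt_floor_add_one (u i / L)
    rw [le_div_iff₀ hL] at h1
    rw [div_lt_iff₀ hL] at h2
    constructor <;> nlinarith
  refine (lintegral_mono_set hsub).trans ?_
  refine (lintegral_iUnion_le _ _).trans ?_
  rw [tsum_fintype]
  refine Finset.sum_le_sum fun v _ => le_of_eq ?_
  have h := (measurePreserving_add_right (volume : Measure (Fin d → ℝ)) (lat L v)).setLIntegral_comp_preimage_emb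
    (measurableEmbedding_addRight (lat L v)) g {u | u - lat L v ∈ unitBox d L}
  rw [← h]
  congr 2
  ext u; simp

noncomputable def idx {d : ℕ} (t : ℕ) [NeZero t] (L : ℝ) (u : Fin d → ℝ) : Fin d → Fin t :=
  fun i => Fin.ofNat t ⌊u i / L⌋₊

lemma idx_meas {d t : ℕ} [NeZero t] (L : ℝ) : Measurable (idx (d := d) t L) := by
  refine measurable_pi_lambda _ fun i => ?_
  have h : Measurable (fun u : Fin d → ℝ => u i / L) :=
    (measurable_pi_apply (X := fun _ : Fin d => ℝ) i).div_const L
  exact (Measurable.of_discrete (f := Fin.ofNat t)).comp (Nat.measurable_floor.comp h)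

lemma idx_eq {d t : ℕ} [NeZero t] {L : ℝ} (hL : 0 < L) (v : Fin d → Fin t) (u : Fin d → ℝ)
    (hu : u ∈ unitBox d L) : idx t L (u + lat L v) = v := by
  funext i
  simp only [unitBox, Set.mem_pi, Set.mem_univ, true_implies, Set.mem_Ico] at hu
  have : ⌊(u + lat L v) i / L⌋₊ = (v i : ℕ) := by
    rw [Nat.floor_eq_iff]
    · simp only [Pi.add_apply, lat]
      rw [le_div_iff₀ hL, div_lt_iff₀ hL]
      constructor <;> nlinarith [(hu i).1, (hu i).2]
    · refine div_nonneg ?_ hL.le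
      simp only [Pi.add_apply, lat]
      have := (hu i).1
      positivity
  simp only [idx, this]
  exact Fin.ofNat_val_eq_self _

section tile
variable {X : Type*} [MetricSpace X] [CompactSpace X] [MeasurableSpace X] [BorelSpace X]
  {d : ℕ} {T : (Fin d → ℝ) → X → X}

lemma ytile_meas (hT : IsContAction d T) (t : ℕ) [NeZero t] (L : ℝ)
    (z : (Fin d → Fin t) → X) :
    Measurable (fun u => T (u - lat L (idx t L u)) (z (idx t L u))) := by
  refine hT.1.measurable.comp (Measurable.prodMk ?_ ?_)
  · exact measurable_id.sub ((Measurable.of_discrete (f := lat L)).comp (idx_meas L))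
  · exact (Measurable.of_discrete (f := z)).comp (idx_meas L)

lemma ytile_dist (hT : IsContAction d T) (t : ℕ) [NeZero t] {L N : ℝ} (hL : 0 < L)
    (hN : N = t * L) (z : (Fin d → Fin t) → X) (x : X) (y : L1Maps d N X)
    (hy : y =ᵐ[boxMeasure d N] (fun u => T (u - lat L (idx t L u)) (z (idx t L u)))) :
    ENNReal.ofReal ((N ^ d)⁻¹ * ∫ u, dist (T u x) (y u) ∂(boxMeasure d N))
      ≤ ENNReal.ofReal (((t : ℝ) ^ d)⁻¹) * ∑ v, rho d T L (T (lat L v) x) (z v) := by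
  subst hN
  have ht : (0 : ℝ) < t := Nat.cast_pos.mpr (Nat.pos_of_ne_zero (NeZero.ne t))
  have h1 : ENNReal.ofReal (∫ u, dist (T u x) (y u) ∂(boxMeasure d (t * L)))
      ≤ ∑ v, ∫⁻ u, ENNReal.ofReal (dist (T u (T (lat L v) x)) (T u (z v))) ∂(boxMeasure d L) := by
    have e1 : ∫ u, dist (T u x) (y u) ∂(boxMeasure d (t * L)) = ∫ u, dist (T u x)
        (T (u - lat L (idx t L u)) (z (idx t L u))) ∂(boxMeasure d (t * L)) := by
      refine integral_congr_ae ?_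
      filter_upwards [hy] with u hu
      rw [hu]
    rw [e1]
    refine (ENNReal.ofReal_le_ofReal ((Real.le_norm_self _).trans
      (norm_integral_le_lintegral_norm _))).trans ?_
    refine ENNReal.ofReal_toReal_le.trans ?_
    refine (tile_lint hL _).trans ?_
    refine Finset.sum_le_sum fun v _ => ?_
    refine le_of_eq (setLIntegral_congr_fun ?_ ?_)
    · exact MeasurableSet.univ_pi fun _ => measurableSet_Ico
    · intro u hu
      simp only
      rw [idx_eq hL v u hu, Real.norm_of_nonneg dist_nonneg, add_sub_cancel_right, hT.2.2]
  rw [mul_pow, mul_inv, ENNReal.ofReal_mul (by positivity), ENNReal.ofReal_mul (by positivity),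
    mul_assoc]
  gcongr
  unfold rho
  rw [← Finset.mul_sum]
  gcongr

/-- The main coding bound: mixture of tiled codes. -/
lemma RL_le (hT : IsContAction d T) (μ : Measure X) [IsProbabilityMeasure μ]
    {K : Type} [Fintype K] [Nonempty K] (c : K → Code X) (m : K → Measure X)
    (hinv : ∀ k u, (m k).map (T u) = m k) (hsum : ∑ k, m k = μ) (N : ℝ) (hN0 : 0 < N)
    (t : K → ℕ) (hN : ∀ k, N = t k * (c k).L) (ε : ℝ)
    (hdist : ∑ k, ∫⁻ x, (c k).dst d T x ∂(m k) < ENNReal.ofReal ε) :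
    RL d T μ N ε ≤ ENNReal.ofReal (Real.logb 2 (Fintype.card K))
      + ∑ k, (t k : ℝ≥0∞) ^ d * ∫⁻ x, ENNReal.ofReal ((c k).cost x) ∂(m k) := by
  have htpos : ∀ k, 0 < t k := fun k => by
    rcases Nat.eq_zero_or_pos (t k) with h | h
    · have := hN k; rw [h] at this; simp at this; linarith
    · exact h
  have hne : ∀ k, NeZero (t k) := fun k => ⟨(htpos k).ne'⟩
  have hmle : ∀ k, m k ≤ μ := by
    intro k
    rw [← hsum]
    exact Measure.le_iff.mpr fun A hA => by
      rw [Measure.finsetSum_apply]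
      exact Finset.single_le_sum (f := fun k => m k A) (fun _ _ => zero_le) (Finset.mem_univ k)
  have hfin : ∀ k, IsFiniteMeasure (m k) := fun k => isFiniteMeasure_of_le μ (hmle k)
  let S : Type := Σ k : K, ((Fin d → Fin (t k)) → Fin (c k).n)
  let : MeasurableSpace S := ⊤
  have : DiscreteMeasurableSpace S := ⟨fun _ => trivial⟩
  let : Fintype S := inferInstanceAs (Fintype (Σ k : K, ((Fin d → Fin (t k)) → Fin (c k).n)))
  let ms : S → Measure X := fun s => m s.1
  let q : S → X → ℝ := fun s x => ∏ v, (c s.1).κ (T (lat (c s.1).L v) x) (s.2 v)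
  let θ : ℝ := (Fintype.card K : ℝ)⁻¹
  have hcard : (0 : ℝ) < Fintype.card K := Nat.cast_pos.mpr Fintype.card_pos
  have hθ : 0 < θ := inv_pos.mpr hcard
  let ρ : S → ℝ := fun s => θ * ∏ v, (c s.1).r (s.2 v)
  let y : S → L1Maps d N X := fun s => AEEqFun.mk
    (fun u => T (u - lat (c s.1).L (idx (t s.1) (c s.1).L u))
      ((c s.1).pts (s.2 (idx (t s.1) (c s.1).L u))))
    (ytile_meas hT (t s.1) (c s.1).L (fun v => (c s.1).pts (s.2 v))).aestronglyMeasurable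
  have hms : ∀ k w, ms ⟨k, w⟩ = m k := fun _ _ => rfl
  have hTm : ∀ u, Measurable (T u) := T_meas hT
  have hqm : ∀ s, Measurable (q s) := fun s =>
    Finset.measurable_prod _ fun v _ => ((c s.1).κ_meas (s.2 v)).comp (hTm _)
  have h0 : ∀ s x, 0 ≤ q s x := fun s x => Finset.prod_nonneg fun v _ => (c s.1).κ_nonneg _ _
  have h1 : ∀ s x, q s x ≤ 1 := fun s x =>
    Finset.prod_le_one (fun v _ => (c s.1).κ_nonneg _ _) (fun v _ => (c s.1).κ_le_one _ _)
  have hρ : ∀ s, 0 < ρ s := fun s => mul_pos hθ (Finset.prod_pos fun v _ => (c s.1).r_pos _)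
  have hρs : ∑ s, ρ s ≤ 1 := by
    apply le_of_eq
    change ∑ s : (Σ k : K, ((Fin d → Fin (t k)) → Fin (c k).n)), ρ s = 1
    rw [Fintype.sum_sigma]
    have : ∀ k, ∑ w, ρ ⟨k, w⟩ = θ := by
      intro k
      simp only [ρ]
      rw [← Finset.mul_sum, prod_sum_one (fun _ b => (c k).r b) (fun _ => (c k).r_sum), mul_one]
    simp_rw [this]
    simp [θ, hcard.ne']
  have hq1 : ∀ k x, ∑ w, q ⟨k, w⟩ x = 1 := fun k x =>
    prod_sum_one (fun v b => (c k).κ (T (lat (c k).L v) x) b) (fun v => (c k).κ_sum _)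
  have hinvl : ∀ k u (f : X → ℝ≥0∞), Measurable f → ∫⁻ x, f (T u x) ∂(m k) = ∫⁻ x, f x ∂(m k) := by
    intro k u f hf
    conv_rhs => rw [← hinv k u]
    rw [lintegral_map hf (hTm u)]
  have hmain := RL_le_of_mix d T μ N ε ms (fun s => hmle s.1) q hqm h0 h1 ρ hρ hρs y ?_ ?_ hN0
  · refine hmain.trans ?_
    have hcost : (∑ s, ∫ x, (q s x * Real.log (q s x) - q s x * Real.log (ρ s)) ∂(ms s)) / Real.log 2
        = ∑ k, ∫ x, (Real.logb 2 (Fintype.card K) + ∑ v : Fin d → Fin (t k),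
            (c k).cost (T (lat (c k).L v) x)) ∂(m k) := by
      change (∑ s : (Σ k : K, ((Fin d → Fin (t k)) → Fin (c k).n)), _) / _ = _
      rw [Fintype.sum_sigma, Finset.sum_div]
      refine Finset.sum_congr rfl fun k _ => ?_
      simp_rw [hms]
      rw [← integral_finsetSum, ← integral_div]
      · refine integral_congr_ae (ae_of_all _ fun x => ?_)
        simp only [q, ρ]
        rw [kl_tensor (fun v b => (c k).κ (T (lat (c k).L v) x) b) (fun v => (c k).κ_sum _)
          (c k).r (c k).r_pos θ hθ]
        simp only [θ, Code.cost, Real.logb, Real.log_inv, neg_neg]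
        rw [add_div, Finset.sum_div]
      · intro w _
        exact integrable_qlogq (m k) (q ⟨k, w⟩) (hqm _) (h0 _) (h1 _) _
    rw [hcost]
    refine (ENNReal.ofReal_sum_of_nonneg ?_).le.trans ?_
    · intro k _
      refine integral_nonneg fun x => ?_
      refine add_nonneg (Real.logb_nonneg one_lt_two ?_) (Finset.sum_nonneg fun v _ =>
        (c k).cost_nonneg _)
      exact_mod_cast Fintype.card_pos (α := K)
    have hone : ∑ k, m k Set.univ = 1 := by
      rw [← measure_univ (μ := μ), ← hsum, Measure.finsetSum_apply]
    have : ENNReal.ofReal (Real.logb 2 (Fintype.card K))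
        = ∑ k, ENNReal.ofReal (Real.logb 2 (Fintype.card K)) * m k Set.univ := by
      rw [← Finset.mul_sum, hone, mul_one]
    rw [this, ← Finset.sum_add_distrib]
    refine Finset.sum_le_sum fun k _ => ?_
    refine (ENNReal.ofReal_le_ofReal ((Real.le_norm_self _).trans
      (norm_integral_le_lintegral_norm _))).trans ?_
    refine ENNReal.ofReal_toReal_le.trans ?_
    have e : ∀ x, ENNReal.ofReal ‖Real.logb 2 (Fintype.card K) + ∑ v : Fin d → Fin (t k),
            (c k).cost (T (lat (c k).L v) x)‖ = ENNReal.ofReal (Real.logb 2 (Fintype.card K))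
            + ∑ v : Fin d → Fin (t k), ENNReal.ofReal ((c k).cost (T (lat (c k).L v) x)) := by
      intro x
      have hl : 0 ≤ Real.logb 2 (Fintype.card K) := by
        refine Real.logb_nonneg one_lt_two ?_
        exact_mod_cast Fintype.card_pos (α := K)
      have hs : 0 ≤ ∑ v : Fin d → Fin (t k), (c k).cost (T (lat (c k).L v) x) :=
        Finset.sum_nonneg fun v _ => (c k).cost_nonneg _
      rw [Real.norm_of_nonneg (add_nonneg hl hs), ENNReal.ofReal_add hl hs,
        ENNReal.ofReal_sum_of_nonneg (fun v _ => (c k).cost_nonneg _)]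
    simp_rw [e]
    rw [lintegral_add_left measurable_const, lintegral_const, lintegral_finsetSum]
    · gcongr
      have : ∀ v : Fin d → Fin (t k), ∫⁻ x, ENNReal.ofReal ((c k).cost (T (lat (c k).L v) x)) ∂(m k)
          = ∫⁻ x, ENNReal.ofReal ((c k).cost x) ∂(m k) := fun v =>
        hinvl k _ (fun x => ENNReal.ofReal ((c k).cost x))
          (ENNReal.measurable_ofReal.comp (c k).cost_meas)
      simp_rw [this]
      simp
    · intro v _
      exact ENNReal.measurable_ofReal.comp ((c k).cost_meas.comp (hTm _))
  · change ∑ s : (Σ k : K, ((Fin d → Fin (t k)) → Fin (c k).n)), _ = μ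
    rw [Fintype.sum_sigma, ← hsum]
    refine Finset.sum_congr rfl fun k _ => ?_
    ext A hA
    rw [Measure.finsetSum_apply]
    simp_rw [withDensity_apply _ hA, hms]
    rw [← lintegral_finsetSum]
    · have : ∀ x, ∑ w, ENNReal.ofReal (q ⟨k, w⟩ x) = 1 := by
        intro x
        rw [← ENNReal.ofReal_sum_of_nonneg (fun w _ => h0 _ _), hq1]; simp
      simp_rw [this]; simp
    · intro w _
      exact ENNReal.measurable_ofReal.comp (hqm _)
  · refine lt_of_le_of_lt ?_ hdist
    change ∑ s : (Σ k : K, ((Fin d → Fin (t k)) → Fin (c k).n)), _ ≤ _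
    rw [Fintype.sum_sigma]
    refine Finset.sum_le_sum fun k _ => ?_
    have hrm : ∀ v (b : Fin (c k).n), Measurable fun x => rho d T (c k).L
        (T (lat (c k).L (v : Fin d → Fin (t k))) x) ((c k).pts b) := fun v b =>
      (rho_meas hT _ _).comp (hTm _)
    calc _ ≤ ∑ w : (Fin d → Fin (t k)) → Fin (c k).n, ∫⁻ x, ENNReal.ofReal (q ⟨k, w⟩ x) *
          (ENNReal.ofReal (((t k : ℝ) ^ d)⁻¹) * ∑ v, rho d T (c k).L (T (lat (c k).L v) x)
            ((c k).pts (w v))) ∂(m k) := by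
          refine Finset.sum_le_sum fun w _ => lintegral_mono fun x => ?_
          gcongr
          exact ytile_dist hT (t k) (c k).L_pos (hN k) (fun v => (c k).pts (w v)) x _
            (AEEqFun.coeFn_mk _ _)
      _ = ENNReal.ofReal (((t k : ℝ) ^ d)⁻¹) * ∑ v : Fin d → Fin (t k),
            ∫⁻ x, (c k).dst d T (T (lat (c k).L v) x) ∂(m k) := by
          rw [← lintegral_finsetSum, ← lintegral_finsetSum, ← lintegral_const_mul]
          · refine lintegral_congr fun x => ?_
            have e1 : ∀ w : (Fin d → Fin (t k)) → Fin (c k).n, ENNReal.ofReal (q ⟨k, w⟩ x)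
                = ∏ v, ENNReal.ofReal ((c k).κ (T (lat (c k).L v) x) (w v)) := fun w =>
              ENNReal.ofReal_prod_of_nonneg (fun v _ => (c k).κ_nonneg _ _)
            simp_rw [e1, mul_left_comm]
            rw [← Finset.mul_sum]
            congr 1
            rw [prod_marg (fun v b => ENNReal.ofReal ((c k).κ (T (lat (c k).L v) x) b))
              (fun v => by
                rw [← ENNReal.ofReal_sum_of_nonneg (fun b _ => (c k).κ_nonneg _ _), (c k).κ_sum]
                simp)
              (fun v b => rho d T (c k).L (T (lat (c k).L v) x) ((c k).pts b))]
            rfl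
          · exact Finset.measurable_sum _ fun v _ => ((c k).dst_meas hT).comp (hTm _)
          · exact fun v _ => ((c k).dst_meas hT).comp (hTm _)
          · intro w _
            exact (ENNReal.measurable_ofReal.comp (hqm _)).mul
              (Measurable.const_mul (Finset.measurable_sum _ fun v _ => hrm v _) _)
      _ = ∫⁻ x, (c k).dst d T x ∂(m k) := by
          simp_rw [hinvl k _ _ ((c k).dst_meas hT)]
          rw [Finset.sum_const, Finset.card_univ, nsmul_eq_mul, ← mul_assoc]
          have htk : (0 : ℝ) < t k := Nat.cast_pos.mpr (htpos k)
          have : ENNReal.ofReal (((t k : ℝ) ^ d)⁻¹) * (Fintype.card (Fin d → Fin (t k)) : ℝ≥0∞) = 1 := by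
            rw [← ENNReal.ofReal_natCast, ← ENNReal.ofReal_mul (by positivity)]
            simp [htk.ne']
          rw [this, one_mul]

end tile

end RDConv

namespace RDConv
set_option linter.unusedSectionVars false

section main1
variable {X : Type*} [MetricSpace X] [CompactSpace X] [MeasurableSpace X] [BorelSpace X]
  {d : ℕ} {T : (Fin d → ℝ) → X → X}

noncomputable def Code.rate (d : ℕ) (c : Code X) (ν : Measure X) : ℝ≥0∞ :=
  (∫⁻ x, ENNReal.ofReal (c.cost x) ∂ν) / ENNReal.ofReal (c.L ^ d)

open Classical in
noncomputable def gval (d : ℕ) (T : (Fin d → ℝ) → X → X) (ε : ℝ) (c : Code X) (ν : Measure X) :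
    ℝ≥0∞ :=
  if ∫⁻ x, c.dst d T x ∂ν ≤ ENNReal.ofReal ε then c.rate d ν else ⊤

lemma coe_meas : Measurable (fun ν : InvM X d T => (ν.1 : Measure X)) :=
  (measurable_subtype_coe (p := fun m : Measure X => IsProbabilityMeasure m)).comp
    measurable_subtype_coe

lemma lint_meas (f : X → ℝ≥0∞) (hf : Measurable f) :
    Measurable (fun ν : InvM X d T => ∫⁻ x, f x ∂(ν.1 : Measure X)) :=
  (Measure.measurable_lintegral hf).comp coe_meas

lemma rate_meas (c : Code X) :
    Measurable (fun ν : InvM X d T => c.rate d (ν.1 : Measure X)) :=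
  (lint_meas _ (ENNReal.measurable_ofReal.comp c.cost_meas)).div_const _

lemma gval_meas (hT : IsContAction d T) (ε : ℝ) (c : Code X) :
    Measurable (fun ν : InvM X d T => gval d T ε c (ν.1 : Measure X)) := by
  unfold gval
  refine Measurable.ite ?_ (rate_meas c) measurable_const
  exact measurableSet_le (lint_meas _ (c.dst_meas hT)) measurable_const

lemma fibre {Y : Type*} [MeasurableSpace Y] (lam : Measure Y) {M : ℕ} (J : Y → Fin M)
    (hJ : Measurable J) (f : Fin M → Y → ℝ≥0∞) :
    ∑ k, ∫⁻ ν in J ⁻¹' {k}, f k ν ∂lam = ∫⁻ ν, f (J ν) ν ∂lam := by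
  have hu : (⋃ k, J ⁻¹' {k}) = Set.univ := by ext x; simp
  rw [← setLIntegral_univ, ← hu, lintegral_iUnion, tsum_fintype]
  · refine Finset.sum_congr rfl fun k _ => ?_
    refine setLIntegral_congr_fun (hJ (measurableSet_singleton k)) ?_
    intro ν hν
    have : J ν = k := hν
    simp only [this]
  · exact fun k => hJ (measurableSet_singleton k)
  · intro i i' hi
    refine Set.disjoint_left.mpr ?_
    intro x h h'
    exact hi (h.symm.trans h')

lemma cancel_aux {a : ℝ≥0∞} (h0 : a ≠ 0) (ht : a ≠ ⊤) (I l : ℝ≥0∞) :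
    a * I * (a⁻¹ * l) = I * l := by
  calc a * I * (a⁻¹ * l) = (a * a⁻¹) * (I * l) := by ring
    _ = _ := by rw [ENNReal.mul_inv_cancel h0 ht, one_mul]

lemma RD_le_sel (hd : 0 < d) (hT : IsContAction d T)
    (lam : Measure (InvM X d T)) [IsProbabilityMeasure lam]
    (μ : Measure X) [IsProbabilityMeasure μ]
    (hbar : ∀ A : Set X, MeasurableSet A → μ A = ∫⁻ ν, (ν.1 : Measure X) A ∂lam)
    {M : ℕ} [NeZero M] (c : Fin M → Code X) (J : InvM X d T → Fin M) (hJ : Measurable J)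
    (ε : ℝ) (hε : 0 < ε)
    (hdist : ∀ ν, ∫⁻ x, (c (J ν)).dst d T x ∂(ν.1 : Measure X) ≤ ENNReal.ofReal ε) :
    RD d T μ (2 * ε) ≤ ∫⁻ ν, (c (J ν)).rate d (ν.1 : Measure X) ∂lam := by
  set m : Fin M → Measure X := fun k => (lam.restrict (J ⁻¹' {k})).bind (fun ν => (ν.1 : Measure X))
    with hm
  have hmapp : ∀ k A, MeasurableSet A → m k A = ∫⁻ ν in J ⁻¹' {k}, (ν.1 : Measure X) A ∂lam :=
    fun k A hA => Measure.bind_apply hA coe_meas.aemeasurable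
  have hmint : ∀ k (f : X → ℝ≥0∞), Measurable f → ∫⁻ x, f x ∂(m k)
      = ∫⁻ ν in J ⁻¹' {k}, ∫⁻ x, f x ∂(ν.1 : Measure X) ∂lam :=
    fun k f hf => Measure.lintegral_bind coe_meas.aemeasurable hf.aemeasurable
  have hTm : ∀ u, Measurable (T u) := T_meas hT
  have hinv : ∀ k u, (m k).map (T u) = m k := by
    intro k u
    ext A hA
    rw [Measure.map_apply (hTm u) hA, hmapp k _ (hTm u hA), hmapp k _ hA]
    refine lintegral_congr fun ν => ?_
    conv_rhs => rw [← ν.2 u]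
    rw [Measure.map_apply (hTm u) hA]
  have hsum : ∑ k, m k = μ := by
    ext A hA
    rw [Measure.finsetSum_apply, hbar A hA]
    simp_rw [fun k => hmapp k A hA]
    exact fibre lam J hJ (fun _ ν => (ν.1 : Measure X) A)
  have hdist' : ∑ k, ∫⁻ x, (c k).dst d T x ∂(m k) < ENNReal.ofReal (2 * ε) := by
    simp_rw [fun k => hmint k _ ((c k).dst_meas hT)]
    rw [fibre lam J hJ (fun k ν => ∫⁻ x, (c k).dst d T x ∂(ν.1 : Measure X))]
    refine lt_of_le_of_lt (lintegral_mono hdist) ?_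
    simp only [lintegral_const, measure_univ, mul_one]
    exact (ENNReal.ofReal_lt_ofReal_iff (by linarith)).mpr (by linarith)
  have hdvd : ∀ k, ∃ e, ∏ j, (c j).p = (c k).p * e := fun k =>
    Finset.dvd_prod_of_mem (fun j => (c j).p) (Finset.mem_univ k)
  choose e he using hdvd
  have hprod : 0 < ∏ j, (c j).p := Finset.prod_pos fun j _ => (c j).hp
  have key : ∀ a : ℕ, 0 < a → RD d T μ (2 * ε) ≤ ENNReal.ofReal (Real.logb 2 M / a) +
      ∫⁻ ν, (c (J ν)).rate d (ν.1 : Measure X) ∂lam := by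
    intro a ha
    set N : ℝ := ((a * ∏ j, (c j).p : ℕ) : ℝ) with hNdef
    have hN0 : 0 < N := Nat.cast_pos.mpr (Nat.mul_pos ha hprod)
    have haN : (a : ℝ) ≤ N := Nat.cast_le.mpr (Nat.le_mul_of_pos_right a hprod)
    have ha1 : (1 : ℝ) ≤ a := by exact_mod_cast ha
    set t : Fin M → ℕ := fun k => a * (c k).q * e k with ht
    have hN : ∀ k, N = t k * (c k).L := by
      intro k
      have hq : ((c k).q : ℝ) ≠ 0 := (Nat.cast_pos.mpr (c k).hq).ne'
      simp only [hNdef, ht, Code.L, he k]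
      push_cast
      field_simp
    have h1 := RL_le hT μ c m hinv hsum N hN0 t hN (2 * ε) hdist'
    have h2 : RD d T μ (2 * ε) ≤ RL d T μ N (2 * ε) / ENNReal.ofReal (N ^ d) :=
      iInf₂_le N hN0
    refine h2.trans ((ENNReal.div_le_div_right h1 _).trans ?_)
    rw [ENNReal.add_div, Fintype.card_fin]
    refine add_le_add ?_ ?_
    · rw [← ENNReal.ofReal_div_of_pos (by positivity)]
      refine ENNReal.ofReal_le_ofReal ?_
      refine div_le_div_of_nonneg_left (Real.logb_nonneg one_lt_two ?_) (by linarith) ?_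
      · exact_mod_cast Nat.pos_of_ne_zero (NeZero.ne M)
      · exact haN.trans (le_self_pow₀ (ha1.trans haN) hd.ne')
    · rw [← fibre lam J hJ (fun k ν => (c k).rate d (ν.1 : Measure X)), div_eq_mul_inv,
        Finset.sum_mul]
      refine Finset.sum_le_sum fun k _ => le_of_eq ?_
      rw [hmint k (fun x => ENNReal.ofReal ((c k).cost x))
        (ENNReal.measurable_ofReal.comp (c k).cost_meas)]
      unfold Code.rate
      simp_rw [div_eq_mul_inv]
      rw [lintegral_mul_const _ (lint_meas (fun x => ENNReal.ofReal ((c k).cost x))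
        (ENNReal.measurable_ofReal.comp (c k).cost_meas))]
      have htk : (0 : ℝ) < t k := by
        have := hN k
        by_contra h
        have h' : (t k : ℝ) ≤ 0 := not_lt.mp h
        nlinarith [(c k).L_pos]
      have hLk := (c k).L_pos
      have : (ENNReal.ofReal (N ^ d))⁻¹ = ((t k : ℝ≥0∞) ^ d)⁻¹ * (ENNReal.ofReal ((c k).L ^ d))⁻¹ := by
        rw [hN k, mul_pow, ENNReal.ofReal_mul (by positivity), ENNReal.mul_inv]
        · rw [ENNReal.ofReal_pow htk.le, ENNReal.ofReal_natCast]
        · right; exact ENNReal.ofReal_ne_top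
        · left; exact ENNReal.ofReal_ne_top
      rw [this]
      have hne0 : ((t k : ℝ≥0∞) ^ d) ≠ 0 := pow_ne_zero _ (by
        have : (t k) ≠ 0 := by rintro h; rw [h] at htk; simp at htk
        exact_mod_cast this)
      have hnet : ((t k : ℝ≥0∞) ^ d) ≠ ⊤ := ENNReal.pow_ne_top (ENNReal.natCast_ne_top _)
      exact cancel_aux hne0 hnet _ _
  refine ENNReal.le_of_forall_pos_le_add fun η hη _ => ?_
  obtain ⟨a, ha⟩ := exists_nat_gt (Real.logb 2 M / η)
  have hη' : (0 : ℝ) < η := hη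
  refine (key (a + 1) (Nat.succ_pos a)).trans ?_
  rw [add_comm]
  gcongr
  rw [← ENNReal.ofReal_coe_nnreal]
  refine ENNReal.ofReal_le_ofReal ?_
  rw [div_lt_iff₀ hη'] at ha
  rw [div_le_iff₀ (by positivity)]
  push_cast
  nlinarith

lemma sel_exists {Y : Type*} [MeasurableSpace Y] (g : ℕ → Y → ℝ≥0∞) (hg : ∀ j, Measurable (g j))
    (M : ℕ) : ∃ J : Y → Fin (M + 1), Measurable J ∧ ∀ y, ∀ j : Fin (M + 1), g (J y) y ≤ g j y := by
  classical
  induction M with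
  | zero => exact ⟨fun _ => 0, measurable_const, fun y j => by
      have : j = 0 := Fin.ext (by omega)
      rw [this]⟩
  | succ M ih =>
    obtain ⟨J, hJ, h⟩ := ih
    have hJm : Measurable (fun y => g (J y) y) := by
      have : (fun y => g (J y) y) = fun y => ⨅ j : Fin (M + 1), g j y := by
        funext y
        exact le_antisymm (le_iInf fun j => h y j) (iInf_le _ (J y))
      rw [this]
      exact Measurable.iInf fun j => hg j
    refine ⟨fun y => if g (M + 1) y < g (J y) y then Fin.last (M + 1) else (J y).castSucc, ?_, ?_⟩
    · refine Measurable.ite (measurableSet_lt (hg _) hJm) measurable_const ?_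
      exact (Measurable.of_discrete (f := Fin.castSucc)).comp hJ
    · intro y j
      refine Fin.lastCases ?_ (fun i => ?_) j
      · dsimp only
        split_ifs with h'
        · exact le_rfl
        · simpa using h'
      · dsimp only
        split_ifs with h'
        · simpa using h'.le.trans (h y i)
        · simpa using h y i

lemma RD_le_lintegral (hd : 0 < d) (hT : IsContAction d T)
    (lam : Measure (InvM X d T)) [IsProbabilityMeasure lam]
    (μ : Measure X) [IsProbabilityMeasure μ]
    (hbar : ∀ A : Set X, MeasurableSet A → μ A = ∫⁻ ν, (ν.1 : Measure X) A ∂lam)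
    (c : ℕ → Code X) (ε : ℝ) (hε : 0 < ε) (B : ℝ≥0∞) (hB : B ≠ ⊤)
    (hc0 : ∀ ν : InvM X d T, gval d T ε (c 0) (ν.1 : Measure X) ≤ B) :
    RD d T μ (2 * ε) ≤ ∫⁻ ν, ⨅ j, gval d T ε (c j) (ν.1 : Measure X) ∂lam := by
  set g : ℕ → InvM X d T → ℝ≥0∞ := fun j ν => gval d T ε (c j) (ν.1 : Measure X) with hg
  have hgm : ∀ j, Measurable (g j) := fun j => gval_meas hT ε (c j)
  set h : ℕ → InvM X d T → ℝ≥0∞ := fun M ν => ⨅ j : Fin (M + 1), g j ν with hh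
  have hhm : ∀ M, Measurable (h M) := fun M => Measurable.iInf fun j => hgm j
  have hanti : Antitone h := by
    intro M M' hM ν
    refine le_iInf fun j => ?_
    exact iInf_le_of_le (⟨j, by omega⟩ : Fin (M' + 1)) le_rfl
  have hinf : ∀ ν, ⨅ M, h M ν = ⨅ j, g j ν := by
    intro ν
    refine le_antisymm (le_iInf fun j => ?_) (le_iInf fun M => le_iInf fun j => iInf_le _ _)
    exact iInf_le_of_le j (iInf_le_of_le (Fin.last j) (by simp))
  have hb : ∀ M ν, h M ν ≤ B := fun M ν => iInf_le_of_le 0 (by simpa using hc0 ν)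
  have e : ∫⁻ ν, ⨅ j, g j ν ∂lam = ⨅ M, ∫⁻ ν, h M ν ∂lam := by
    rw [← lintegral_iInf hhm hanti]
    · simp_rw [hinf]
    · refine ((lintegral_mono (hb 0)).trans_lt ?_).ne
      simpa using hB.lt_top
  change _ ≤ ∫⁻ ν, ⨅ j, g j ν ∂lam
  rw [e]
  refine le_iInf fun M => ?_
  obtain ⟨J, hJ, hmin⟩ := sel_exists g hgm M
  have hJh : ∀ ν, g (J ν) ν = h M ν := fun ν =>
    le_antisymm (le_iInf fun j => hmin ν j) (iInf_le _ (J ν))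
  have hok : ∀ ν, ∫⁻ x, (c (J ν)).dst d T x ∂(ν.1 : Measure X) ≤ ENNReal.ofReal ε := by
    intro ν
    by_contra hcon
    have h1 : g (J ν) ν = ⊤ := by simp only [hg, gval]; rw [if_neg hcon]
    exact hB (top_le_iff.mp (h1 ▸ hJh ν ▸ hb M ν))
  refine (RD_le_sel hd hT lam μ hbar (fun j : Fin (M + 1) => c j) J hJ ε hε hok).trans ?_
  refine lintegral_mono fun ν => ?_
  rw [← hJh ν]
  simp only [hg, gval]; rw [if_pos (hok ν)]

end main1

end RDConv

namespace RDConv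
set_option linter.unusedSectionVars false

lemma sel_exists' {Y : Type*} [MeasurableSpace Y] {n : ℕ} (hn : n ≠ 0) (g : Fin n → Y → ℝ≥0∞)
    (hg : ∀ j, Measurable (g j)) :
    ∃ J : Y → Fin n, Measurable J ∧ ∀ y, ∀ j : Fin n, g (J y) y ≤ g j y := by
  classical
  obtain ⟨M, rfl⟩ := Nat.exists_eq_succ_of_ne_zero hn
  obtain ⟨J, hJ, h⟩ := sel_exists (fun j y => if hj : j < M + 1 then g ⟨j, hj⟩ y else 0) (by
    intro j
    by_cases hj : j < M + 1
    · simpa [hj] using hg ⟨j, hj⟩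
    · simp [hj]) M
  refine ⟨J, hJ, fun y j => ?_⟩
  have := h y j
  rw [dif_pos (J y).2, dif_pos j.2] at this
  exact this

section cover
variable {X : Type*} [MetricSpace X] [CompactSpace X] {d : ℕ} {T : (Fin d → ℝ) → X → X}

lemma dist_le_D (x y : X) : dist x y ≤ Metric.diam (Set.univ : Set X) :=
  Metric.dist_le_diam_of_mem isCompact_univ.isBounded (mem_univ x) (mem_univ y)

lemma dist_le_dSup (L : ℝ) (x y : X) (u : Fin d → ℝ) (hu : u ∈ unitBox d L) :
    dist (T u x) (T u y) ≤ dSup d T L x y := by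
  refine le_ciSup (f := fun u : unitBox d L => dist (T u.1 x) (T u.1 y)) ?_ ⟨u, hu⟩
  refine ⟨Metric.diam (Set.univ : Set X), ?_⟩
  rintro _ ⟨u, rfl⟩
  exact dist_le_D _ _

lemma cov_exists (hT : IsContAction d T) (L : ℝ) (ε : ℝ) (hε : 0 < ε) :
    ∃ F : Finset (Set X), F.card = covNum X (dSup d T L) ε ∧
    (∀ U ∈ F, IsOpen U ∧
      (⨆ x ∈ U, ⨆ y ∈ U, ENNReal.ofReal (dSup d T L x y)) < ENNReal.ofReal ε) ∧
    ⋃₀ (F : Set (Set X)) = Set.univ := by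
  classical
  apply Nat.sInf_mem (s := {n : ℕ | ∃ F : Finset (Set X), F.card = n ∧
    (∀ U ∈ F, IsOpen U ∧
      (⨆ x ∈ U, ⨆ y ∈ U, ENNReal.ofReal (dSup d T L x y)) < ENNReal.ofReal ε) ∧
    ⋃₀ (F : Set (Set X)) = Set.univ})
  let K : Set (Fin d → ℝ) := Set.Icc 0 (fun _ => L)
  have hK : IsCompact K := isCompact_Icc
  have : CompactSpace K := isCompact_iff_compactSpace.mp hK
  let Φ : C(X, C(K, X)) := ContinuousMap.curry
    ⟨fun p : X × K => T p.2.1 p.1,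
      hT.1.comp ((continuous_subtype_val.comp continuous_snd).prodMk continuous_fst)⟩
  have hΦ : ∀ x y, dSup d T L x y ≤ dist (Φ x) (Φ y) := by
    intro x y
    refine Real.iSup_le (fun u => ?_) dist_nonneg
    have hu : u.1 ∈ K := by
      have := u.2
      simp only [unitBox, Set.mem_pi, Set.mem_univ, true_implies, Set.mem_Ico] at this
      exact ⟨fun i => (this i).1, fun i => (this i).2.le⟩
    exact ContinuousMap.dist_apply_le_dist (f := Φ x) (g := Φ y) ⟨u.1, hu⟩
  obtain ⟨t, ht⟩ := isCompact_univ.elim_finite_subcover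
    (fun x : X => Φ ⁻¹' Metric.ball (Φ x) (ε / 4))
    (fun x => Metric.isOpen_ball.preimage Φ.continuous)
    (fun x _ => mem_iUnion.mpr ⟨x, by simp [hε]⟩)
  refine ⟨_, t.image (fun x : X => Φ ⁻¹' Metric.ball (Φ x) (ε / 4)), rfl, ?_, ?_⟩
  · intro U hU
    obtain ⟨z, -, rfl⟩ := Finset.mem_image.mp hU
    refine ⟨Metric.isOpen_ball.preimage Φ.continuous, ?_⟩
    refine lt_of_le_of_lt (b := ENNReal.ofReal (ε / 2)) ?_
      ((ENNReal.ofReal_lt_ofReal_iff hε).mpr (by linarith))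
    refine iSup₂_le fun x hx => iSup₂_le fun y hy => ENNReal.ofReal_le_ofReal ?_
    refine (hΦ x y).trans ?_
    have hx' : dist (Φ x) (Φ z) < ε / 4 := hx
    have hy' : dist (Φ y) (Φ z) < ε / 4 := hy
    linarith [dist_triangle_right (Φ x) (Φ y) (Φ z)]
  · refine eq_univ_of_univ_subset (ht.trans ?_)
    intro x hx
    obtain ⟨z, hz, hxz⟩ := mem_iUnion₂.mp hx
    exact mem_sUnion.mpr ⟨_, Finset.mem_coe.mpr (Finset.mem_image_of_mem _ hz), hxz⟩

lemma partition_exists [MeasurableSpace X] [BorelSpace X] [Nonempty X]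
    (hT : IsContAction d T) (L : ℝ) (ε : ℝ) (hε : 0 < ε) :
    ∃ (α : X → Fin (covNum X (dSup d T L) ε)) (pt : Fin (covNum X (dSup d T L) ε) → X),
      Measurable α ∧ ∀ x, ∀ u ∈ unitBox d L, dist (T u x) (T u (pt (α x))) ≤ ε := by
  classical
  obtain ⟨F, hF, hU, hcov⟩ := cov_exists hT L ε hε
  rw [← hF]
  let e := F.equivFin
  let V : Fin F.card → Set X := fun i => (e.symm i).1
  have hV : ∀ x, ∃ i, x ∈ V i := by
    intro x
    have : x ∈ ⋃₀ (F : Set (Set X)) := by rw [hcov]; trivial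
    obtain ⟨U, hUF, hx⟩ := this
    exact ⟨e ⟨U, hUF⟩, by simpa [V] using hx⟩
  have hn : F.card ≠ 0 := by
    intro h
    obtain ⟨i, -⟩ := hV (Classical.arbitrary X)
    exact absurd i.2 (by omega)
  obtain ⟨J, hJ, h⟩ := sel_exists' hn (fun i x => (V i)ᶜ.indicator (fun _ => (1 : ℝ≥0∞)) x)
    (fun i => measurable_const.indicator (hU _ (e.symm i).2).1.measurableSet.compl)
  have hJV : ∀ x, x ∈ V (J x) := by
    intro x
    obtain ⟨i, hi⟩ := hV x
    have h1 := h x i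
    rw [indicator_of_notMem (s := (V i)ᶜ) (by simpa using hi)] at h1
    by_contra hcon
    rw [indicator_of_mem (s := (V (J x))ᶜ) hcon] at h1
    simp at h1
  refine ⟨J, fun i => if hi : (V i).Nonempty then hi.some else Classical.arbitrary X, hJ, ?_⟩
  intro x u hu
  have hne : (V (J x)).Nonempty := ⟨x, hJV x⟩
  dsimp only
  rw [dif_pos hne]
  refine (dist_le_dSup L _ _ u hu).trans ?_
  have h2 : (⨆ x' ∈ V (J x), ⨆ y ∈ V (J x), ENNReal.ofReal (dSup d T L x' y)) < ENNReal.ofReal ε :=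
    (hU _ (e.symm (J x)).2).2
  have h3 : ENNReal.ofReal (dSup d T L x hne.some) < ENNReal.ofReal ε :=
    lt_of_le_of_lt (le_iSup₂_of_le x (hJV x) (le_iSup₂_of_le
      (f := fun y (_ : y ∈ V (J x)) => ENNReal.ofReal (dSup d T L x y))
      hne.some hne.some_mem le_rfl)) h2
  exact ((ENNReal.ofReal_lt_ofReal_iff hε).mp h3).le

end cover

end RDConv

namespace RDConv
set_option linter.unusedSectionVars false

/-- Pairs of a stochastic matrix and a strictly positive probability vector. -/
abbrev Sn (n : ℕ) := {z : (Fin n → Fin n → ℝ) × (Fin n → ℝ) //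
  (∀ a b, 0 ≤ z.1 a b) ∧ (∀ a, ∑ b, z.1 a b = 1) ∧ (∀ b, 0 < z.2 b) ∧ ∑ b, z.2 b = 1}

lemma Sn_nonempty {n : ℕ} (hn : n ≠ 0) : Nonempty (Sn n) := by
  have : (n : ℝ) ≠ 0 := Nat.cast_ne_zero.mpr hn
  exact ⟨⟨(fun _ _ => (n : ℝ)⁻¹, fun _ => (n : ℝ)⁻¹), fun _ _ => by positivity,
    fun _ => by simp [this], fun _ => by positivity, by simp [this]⟩⟩

noncomputable def cst {n : ℕ} (z : Sn n) (a : Fin n) : ℝ :=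
  (∑ b, (z.1.1 a b * Real.log (z.1.1 a b) - z.1.1 a b * Real.log (z.1.2 b))) / Real.log 2

lemma cst_cont {n : ℕ} (a : Fin n) : Continuous (fun z : Sn n => cst z a) := by
  unfold cst
  refine Continuous.div_const ?_ _
  refine continuous_finsetSum _ fun b _ => ?_
  have h1 : Continuous fun z : Sn n => z.1.1 a b := by fun_prop
  have h2 : Continuous fun z : Sn n => z.1.2 b := by fun_prop
  refine (Real.continuous_mul_log.comp h1).sub (h1.mul ?_)
  exact h2.log fun z => (z.2.2.2.1 b).ne'

lemma fin_point {n : ℕ} (hn : n ≠ 0) (π : Fin n → Fin n → ℝ) (h0 : ∀ a b, 0 ≤ π a b)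
    (h1 : ∑ a, ∑ b, π a b = 1) (η : ℝ) (hη : 0 < η) :
    ∃ z : Sn n, (∀ a b, (∑ b', π a b') * z.1.1 a b = π a b) ∧
      ∑ a, (∑ b', π a b') * cst z a ≤
        (∑ a, ∑ b, π a b * (Real.log (π a b) - Real.log (∑ b', π a b')
          - Real.log (∑ a', π a' b))) / Real.log 2 + η := by
  classical
  have hl2 : 0 < Real.log 2 := Real.log_pos one_lt_two
  have hn0 : (0 : ℝ) < n := Nat.cast_pos.mpr (Nat.pos_of_ne_zero hn)
  set v : Fin n → ℝ := fun a => ∑ b', π a b' with hv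
  set w : Fin n → ℝ := fun b => ∑ a', π a' b with hw
  have hv0 : ∀ a, 0 ≤ v a := fun a => Finset.sum_nonneg fun b _ => h0 a b
  have hw0 : ∀ b, 0 ≤ w b := fun b => Finset.sum_nonneg fun a _ => h0 a b
  have hπv : ∀ a b, π a b ≤ v a := fun a b =>
    Finset.single_le_sum (f := fun b => π a b) (fun b _ => h0 a b) (Finset.mem_univ b)
  have hπw : ∀ a b, π a b ≤ w b := fun a b =>
    Finset.single_le_sum (f := fun a => π a b) (fun a _ => h0 a b) (Finset.mem_univ a)
  have hws : ∑ b, w b = 1 := by rw [← h1, Finset.sum_comm]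
  -- choose s in (0,1)
  set s : ℝ := Real.exp (-(η * Real.log 2)) with hs
  have hs0 : 0 < s := Real.exp_pos _
  have hs1 : s < 1 := Real.exp_lt_one_iff.mpr (by nlinarith)
  set Q : Fin n → Fin n → ℝ := fun a b => if v a = 0 then (n : ℝ)⁻¹ else π a b / v a with hQ
  have hvQ : ∀ a b, v a * Q a b = π a b := by
    intro a b
    simp only [hQ]
    split_ifs with h
    · rw [h, zero_mul]
      exact le_antisymm (h0 a b) (h ▸ hπv a b)
    · field_simp
  let z : Sn n := ⟨(Q, fun b => s * w b + (1 - s) * (n : ℝ)⁻¹), by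
    refine ⟨?_, ?_, ?_, ?_⟩
    · intro a b
      simp only [hQ]
      have := h0 a b
      have := hv0 a
      split_ifs <;> positivity
    · intro a
      simp only [hQ]
      split_ifs with h
      · simp [hn0.ne']
      · rw [← Finset.sum_div]; exact div_self h
    · intro b
      have := hw0 b
      have : 0 < (1 - s) * (n : ℝ)⁻¹ := mul_pos (by linarith) (by positivity)
      have : 0 ≤ s * w b := by positivity
      dsimp only
      linarith
    · dsimp only
      rw [Finset.sum_add_distrib, ← Finset.mul_sum, hws]
      simp only [Finset.sum_const, Finset.card_univ, Fintype.card_fin, nsmul_eq_mul]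
      field_simp
      ring⟩
  refine ⟨z, hvQ, ?_⟩
  have key : ∀ a b, v a * (Q a b * Real.log (Q a b) - Q a b * Real.log (z.1.2 b)) ≤
      π a b * (Real.log (π a b) - Real.log (v a) - Real.log (w b)) + π a b * (η * Real.log 2) := by
    intro a b
    rw [show v a * (Q a b * Real.log (Q a b) - Q a b * Real.log (z.1.2 b)) =
      (v a * Q a b) * (Real.log (Q a b) - Real.log (z.1.2 b)) by ring, hvQ]
    rcases (h0 a b).eq_or_lt with h | h
    · rw [← h]; simp
    have hva : 0 < v a := h.trans_le (hπv a b)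
    have hwb : 0 < w b := h.trans_le (hπw a b)
    have e1 : Real.log (Q a b) = Real.log (π a b) - Real.log (v a) := by
      simp only [hQ]
      rw [if_neg hva.ne', Real.log_div h.ne' hva.ne']
    have e2 : Real.log (w b) - η * Real.log 2 ≤ Real.log (z.1.2 b) := by
      have : Real.log (s * w b) = Real.log (w b) - η * Real.log 2 := by
        rw [Real.log_mul hs0.ne' hwb.ne', hs, Real.log_exp]; ring
      rw [← this]
      refine Real.log_le_log (by positivity) ?_
      have : 0 < (1 - s) * (n : ℝ)⁻¹ := mul_pos (by linarith) (by positivity)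
      change s * w b ≤ s * w b + (1 - s) * (n : ℝ)⁻¹
      linarith
    rw [e1, ← mul_add]
    refine mul_le_mul_of_nonneg_left ?_ h.le
    linarith
  have : ∑ a, v a * cst z a = (∑ a, ∑ b,
      v a * (Q a b * Real.log (Q a b) - Q a b * Real.log (z.1.2 b))) / Real.log 2 := by
    rw [Finset.sum_div]
    refine Finset.sum_congr rfl fun a _ => ?_
    rw [← Finset.mul_sum, mul_div_assoc]
    rfl
  change ∑ a, v a * cst z a ≤ _
  rw [this, div_add' _ _ _ hl2.ne']
  refine div_le_div_of_nonneg_right ?_ hl2.le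
  refine (Finset.sum_le_sum fun a _ => Finset.sum_le_sum fun b _ => key a b).trans ?_
  simp_rw [Finset.sum_add_distrib, ← Finset.sum_mul]
  rw [h1, one_mul]

lemma fin_dense {n : ℕ} (hn : n ≠ 0) (π : Fin n → Fin n → ℝ) (h0 : ∀ a b, 0 ≤ π a b)
    (h1 : ∑ a, ∑ b, π a b = 1) (R : Fin n → Fin n → ℝ) (s : ℕ → Sn n) (hs : DenseRange s)
    (I D : ℝ) (hI : (∑ a, ∑ b, π a b * (Real.log (π a b) - Real.log (∑ b', π a b')
          - Real.log (∑ a', π a' b))) / Real.log 2 < I) (hD : ∑ a, ∑ b, π a b * R a b < D) :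
    ∃ i, ∑ a, (∑ b', π a b') * cst (s i) a < I ∧
      ∑ a, ∑ b, (∑ b', π a b') * (s i).1.1 a b * R a b < D := by
  set I0 := (∑ a, ∑ b, π a b * (Real.log (π a b) - Real.log (∑ b', π a b')
          - Real.log (∑ a', π a' b))) / Real.log 2 with hI0
  obtain ⟨z, hz1, hz2⟩ := fin_point hn π h0 h1 ((I - I0) / 2) (by linarith)
  have c1 : Continuous fun z : Sn n => ∑ a, (∑ b', π a b') * cst z a :=
    continuous_finsetSum _ fun a _ => continuous_const.mul (cst_cont a)
  have c2 : Continuous fun z : Sn n => ∑ a, ∑ b, (∑ b', π a b') * z.1.1 a b * R a b := by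
    fun_prop
  have ho : IsOpen {z : Sn n | ∑ a, (∑ b', π a b') * cst z a < I ∧
      ∑ a, ∑ b, (∑ b', π a b') * z.1.1 a b * R a b < D} :=
    (isOpen_lt c1 continuous_const).inter (isOpen_lt c2 continuous_const)
  have hz : z ∈ {z : Sn n | ∑ a, (∑ b', π a b') * cst z a < I ∧
      ∑ a, ∑ b, (∑ b', π a b') * z.1.1 a b * R a b < D} := by
    refine ⟨by linarith, ?_⟩
    simp_rw [hz1]
    exact hD
  obtain ⟨i, hi⟩ := hs.exists_mem_open ho ⟨z, hz⟩
  exact ⟨i, hi⟩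

section codes
variable {X : Type*} [MetricSpace X] [CompactSpace X] [MeasurableSpace X] [BorelSpace X]
  {d : ℕ} {T : (Fin d → ℝ) → X → X}

noncomputable def pCode (p q : ℕ) {n : ℕ} (α : X → Fin n) (hα : Measurable α) (pt : Fin n → X)
    (z : Sn n) : Code X where
  p := p + 1
  q := q + 1
  hp := Nat.succ_pos p
  hq := Nat.succ_pos q
  n := n
  κ := fun x b => z.1.1 (α x) b
  κ_meas := fun b => (Measurable.of_discrete (f := fun a => z.1.1 a b)).comp hα
  κ_nonneg := fun _ b => z.2.1 _ b
  κ_sum := fun _ => z.2.2.1 _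
  r := z.1.2
  r_pos := z.2.2.2.1
  r_sum := z.2.2.2.2
  pts := pt

lemma lint_fin (ν : Measure X) {n : ℕ} (α : X → Fin n) (hα : Measurable α) (g : Fin n → ℝ≥0∞) :
    ∫⁻ x, g (α x) ∂ν = ∑ a, g a * ν (α ⁻¹' {a}) := by
  rw [← lintegral_map (f := g) Measurable.of_discrete hα, lintegral_fintype]
  refine Finset.sum_congr rfl fun a _ => ?_
  rw [Measure.map_apply hα (measurableSet_singleton a)]

/-- real-valued integrated orbit distance -/
noncomputable def oD (d : ℕ) (T : (Fin d → ℝ) → X → X) (L : ℝ) (x y : X) : ℝ :=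
  ∫ u, dist (T u x) (T u y) ∂(boxMeasure d L)

lemma box_vol (d : ℕ) {L : ℝ} (hL : 0 ≤ L) : boxMeasure d L Set.univ = ENNReal.ofReal (L ^ d) := by
  unfold boxMeasure unitBox
  rw [Measure.restrict_apply_univ, Real.volume_pi_Ico]
  simp [ENNReal.ofReal_pow hL]

instance box_fin (d : ℕ) (L : ℝ) : IsFiniteMeasure (boxMeasure d L) := by
  refine ⟨?_⟩
  unfold boxMeasure unitBox
  rw [Measure.restrict_apply_univ, Real.volume_pi_Ico]
  exact ENNReal.prod_lt_top fun _ _ => ENNReal.ofReal_lt_top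

lemma T_cont_left (hT : IsContAction d T) (x : X) : Continuous fun u => T u x :=
  hT.1.comp (Continuous.prodMk_left x)

lemma oD_int (hT : IsContAction d T) (L : ℝ) (x y : X) :
    Integrable (fun u => dist (T u x) (T u y)) (boxMeasure d L) := by
  refine Integrable.of_bound (C := Metric.diam (Set.univ : Set X))
    ((T_cont_left hT x).dist (T_cont_left hT y)).measurable.aestronglyMeasurable ?_
  refine Filter.Eventually.of_forall fun u => ?_
  rw [Real.norm_of_nonneg dist_nonneg]
  exact dist_le_D _ _

lemma oD_nonneg (L : ℝ) (x y : X) : 0 ≤ oD d T L x y :=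
  integral_nonneg fun _ => dist_nonneg

lemma rho_eq (hT : IsContAction d T) {L : ℝ} (hL : 0 < L) (x y : X) :
    rho d T L x y = ENNReal.ofReal (oD d T L x y / L ^ d) := by
  unfold rho oD
  rw [← ofReal_integral_eq_lintegral_ofReal (oD_int hT L x y)
    (Filter.Eventually.of_forall fun _ => dist_nonneg), ← ENNReal.ofReal_mul (by positivity),
    div_eq_inv_mul]

lemma rho_tri (hT : IsContAction d T) {L : ℝ} (hL : 0 < L) {N ε : ℝ} (hLN : L ≤ N)
    (x x' y : X) (hx : ∀ u ∈ unitBox d N, dist (T u x) (T u x') ≤ ε) (hε : 0 < ε) :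
    rho d T L x y ≤ ENNReal.ofReal ε + rho d T L x' y := by
  rw [rho_eq hT hL, rho_eq hT hL, ← ENNReal.ofReal_add hε.le
    (div_nonneg (oD_nonneg _ _ _) (by positivity))]
  refine ENNReal.ofReal_le_ofReal ?_
  have hLd : 0 < L ^ d := by positivity
  rw [div_le_iff₀ hLd, add_mul, div_mul_cancel₀ _ hLd.ne']
  have hc : ∫ _u, ε ∂(boxMeasure d L) = ε * L ^ d := by
    rw [integral_const, Measure.real, box_vol d hL.le, ENNReal.toReal_ofReal hLd.le, smul_eq_mul,
      mul_comm]
  unfold oD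
  rw [← hc, ← integral_add (integrable_const _) (oD_int hT L x' y)]
  refine integral_mono_ae (oD_int hT L x y) ((integrable_const _).add (oD_int hT L x' y)) ?_
  have hm : MeasurableSet (unitBox d L) := MeasurableSet.univ_pi fun _ => measurableSet_Ico
  refine (ae_restrict_mem hm).mono fun u hu => ?_
  have hu' : u ∈ unitBox d N := by
    simp only [unitBox, Set.mem_pi, Set.mem_univ, true_implies, Set.mem_Ico] at hu ⊢
    exact fun i => ⟨(hu i).1, (hu i).2.trans_le hLN⟩
  have := hx u hu'
  have := dist_triangle (T u x) (T u x') (T u y)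
  linarith

lemma gval_pCode (hT : IsContAction d T) (p q : ℕ) {n : ℕ} (α : X → Fin n) (hα : Measurable α)
    (pt : Fin n → X) (z : Sn n) (N ε : ℝ) (hε : 0 < ε)
    (hLN : ((p + 1 : ℕ) : ℝ) / ((q + 1 : ℕ) : ℝ) ≤ N)
    (hpt : ∀ x, ∀ u ∈ unitBox d N, dist (T u x) (T u (pt (α x))) ≤ ε)
    (ν : Measure X) [IsProbabilityMeasure ν] (v : Fin n → ℝ)
    (hv : ∀ a, v a = (ν (α ⁻¹' {a})).toReal) (I D : ℝ) (hD0 : 0 ≤ D)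
    (hI : ∑ a, v a * cst z a ≤ I)
    (hD : ∑ a, ∑ b, v a * z.1.1 a b *
      oD d T (((p + 1 : ℕ) : ℝ) / ((q + 1 : ℕ) : ℝ)) (pt a) (pt b)
      ≤ D * (((p + 1 : ℕ) : ℝ) / ((q + 1 : ℕ) : ℝ)) ^ d) :
    gval d T (ε + D) (pCode p q α hα pt z) ν ≤
      ENNReal.ofReal (I / (((p + 1 : ℕ) : ℝ) / ((q + 1 : ℕ) : ℝ)) ^ d) := by
  set L : ℝ := ((p + 1 : ℕ) : ℝ) / ((q + 1 : ℕ) : ℝ) with hLdef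
  have hcL : (pCode p q α hα pt z).L = L := rfl
  have hL : 0 < L := hcL ▸ (pCode p q α hα pt z).L_pos
  have hLd : 0 < L ^ d := by positivity
  have hva : ∀ a, ν (α ⁻¹' {a}) = ENNReal.ofReal (v a) := fun a => by
    rw [hv, ENNReal.ofReal_toReal (measure_ne_top _ _)]
  have hv0 : ∀ a, 0 ≤ v a := fun a => by rw [hv]; exact ENNReal.toReal_nonneg
  have hdst : ∫⁻ x, (pCode p q α hα pt z).dst d T x ∂ν ≤ ENNReal.ofReal (ε + D) := by
    have hle : ∀ x, (pCode p q α hα pt z).dst d T x ≤ (fun a => ENNReal.ofReal ε +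
        ENNReal.ofReal (∑ b, z.1.1 a b * (oD d T L (pt a) (pt b) / L ^ d))) (α x) := by
      intro x
      unfold Code.dst
      rw [hcL]
      change ∑ b : Fin n, ENNReal.ofReal (z.1.1 (α x) b) * rho d T L x (pt b) ≤ _
      refine (Finset.sum_le_sum fun b _ => mul_le_mul_right
        (rho_tri hT hL hLN x (pt (α x)) (pt b) (hpt x) hε) _).trans ?_
      simp_rw [mul_add]
      rw [Finset.sum_add_distrib, ← Finset.sum_mul, ← ENNReal.ofReal_sum_of_nonneg
        (fun b _ => z.2.1 _ b), z.2.2.1, ENNReal.ofReal_one, one_mul]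
      gcongr
      rw [ENNReal.ofReal_sum_of_nonneg]
      · refine Finset.sum_le_sum fun b _ => ?_
        rw [rho_eq hT hL, ENNReal.ofReal_mul (z.2.1 _ b)]
      · intro b _
        exact mul_nonneg (z.2.1 _ b) (div_nonneg (oD_nonneg _ _ _) hLd.le)
    refine (lintegral_mono hle).trans ?_
    have hin : ∀ a, 0 ≤ ∑ b, z.1.1 a b * (oD d T L (pt a) (pt b) / L ^ d) := fun a =>
      Finset.sum_nonneg fun b _ => mul_nonneg (z.2.1 _ b) (div_nonneg (oD_nonneg _ _ _) hLd.le)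
    rw [lintegral_add_left measurable_const, lintegral_const, measure_univ, mul_one,
      ENNReal.ofReal_add hε.le hD0]
    gcongr
    rw [lint_fin ν α hα (fun a => ENNReal.ofReal
      (∑ b, z.1.1 a b * (oD d T L (pt a) (pt b) / L ^ d)))]
    simp_rw [hva]
    simp_rw [← ENNReal.ofReal_mul (hin _)]
    rw [← ENNReal.ofReal_sum_of_nonneg (fun a _ => mul_nonneg (hin a) (hv0 a))]
    refine ENNReal.ofReal_le_ofReal ?_
    rw [← div_le_iff₀ hLd] at hD
    refine le_trans (le_of_eq ?_) hD
    rw [Finset.sum_div]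
    refine Finset.sum_congr rfl fun a _ => ?_
    rw [Finset.sum_mul, Finset.sum_div]
    refine Finset.sum_congr rfl fun b _ => ?_
    ring
  unfold gval
  rw [if_pos hdst]
  unfold Code.rate
  rw [hcL, ENNReal.ofReal_div_of_pos hLd]
  refine ENNReal.div_le_div_right ?_ _
  have hc0 : ∀ a, 0 ≤ cst z a := fun a => div_nonneg
    (kl_nonneg _ _ (z.2.1 a) (z.2.2.1 a) z.2.2.2.1 z.2.2.2.2) (Real.log_pos one_lt_two).le
  change ∫⁻ x, (fun a => ENNReal.ofReal (cst z a)) (α x) ∂ν ≤ _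
  rw [lint_fin ν α hα (fun a => ENNReal.ofReal (cst z a))]
  simp_rw [hva, ← ENNReal.ofReal_mul (hc0 _)]
  rw [← ENNReal.ofReal_sum_of_nonneg (fun a _ => mul_nonneg (hc0 a) (hv0 a))]
  refine ENNReal.ofReal_le_ofReal (le_trans (le_of_eq ?_) hI)
  exact Finset.sum_congr rfl fun a _ => mul_comm _ _

end codes

end RDConv

namespace RDConv
set_option linter.unusedSectionVars false

section extract
variable {X : Type*} [MetricSpace X] [CompactSpace X] [MeasurableSpace X] [BorelSpace X]
  {d : ℕ} {T : (Fin d → ℝ) → X → X}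

noncomputable def hh (d : ℕ) (T : (Fin d → ℝ) → X → X) (L : ℝ) (x : X) (y : L1Maps d L X) : ℝ :=
  ∫ u, dist (T u x) (y u) ∂(boxMeasure d L)

lemma hh_aesm (hT : IsContAction d T) (L : ℝ) (x : X) (y : L1Maps d L X) :
    AEStronglyMeasurable (fun u => dist (T u x) (y u)) (boxMeasure d L) :=
  (T_cont_left hT x).aestronglyMeasurable.dist y.aestronglyMeasurable

lemma hh_int (hT : IsContAction d T) (L : ℝ) (x : X) (y : L1Maps d L X) :
    Integrable (fun u => dist (T u x) (y u)) (boxMeasure d L) := by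
  refine Integrable.of_bound (C := Metric.diam (Set.univ : Set X)) (hh_aesm hT L x y) ?_
  refine Filter.Eventually.of_forall fun u => ?_
  rw [Real.norm_of_nonneg dist_nonneg]
  exact dist_le_D _ _

lemma hh_nonneg (L : ℝ) (x : X) (y : L1Maps d L X) : 0 ≤ hh d T L x y :=
  integral_nonneg fun _ => dist_nonneg

lemma int_const_box (c : ℝ) {L : ℝ} (hL : 0 < L) : ∫ _u, c ∂(boxMeasure d L) = c * L ^ d := by
  have hLd : 0 < L ^ d := by positivity
  rw [integral_const, Measure.real, box_vol d hL.le, ENNReal.toReal_ofReal hLd.le, smul_eq_mul,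
      mul_comm]

lemma hh_le (hT : IsContAction d T) {L : ℝ} (hL : 0 < L) (x : X) (y : L1Maps d L X) :
    hh d T L x y ≤ Metric.diam (Set.univ : Set X) * L ^ d := by
  rw [← int_const_box (d := d) _ hL]
  exact integral_mono (hh_int hT L x y) (integrable_const _) fun u => dist_le_D _ _

lemma hh_meas_right (hT : IsContAction d T) (L : ℝ) (x : X) :
    Measurable (fun y : L1Maps d L X => hh d T L x y) := by
  have hsm : AEStronglyMeasurable (fun u => T u x) (boxMeasure d L) :=
    (T_cont_left hT x).aestronglyMeasurable
  have : ∀ y : L1Maps d L X, hh d T L x y = L1dist (AEEqFun.mk (fun u => T u x) hsm) y := by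
    intro y
    unfold hh L1dist
    refine integral_congr_ae ?_
    filter_upwards [AEEqFun.coeFn_mk (fun u => T u x) hsm] with u hu
    rw [hu]
  simp_rw [this]
  refine measurable_of_Iio fun r => ?_
  exact MeasurableSpace.measurableSet_generateFrom ⟨_, r, rfl⟩

lemma hh_cont_left (hT : IsContAction d T) (L : ℝ) (y : L1Maps d L X) :
    Continuous (fun x => hh d T L x y) := by
  unfold hh
  refine continuous_of_dominated (bound := fun _ => Metric.diam (Set.univ : Set X))
    (fun x => hh_aesm hT L x y) ?_ (integrable_const _) ?_
  · refine fun x => Filter.Eventually.of_forall fun u => ?_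
    rw [Real.norm_of_nonneg dist_nonneg]
    exact dist_le_D _ _
  · refine Filter.Eventually.of_forall fun u => ?_
    have : Continuous (T u) := hT.1.comp (Continuous.prodMk_right u)
    exact this.dist continuous_const

lemma hh_meas (hT : IsContAction d T) (L : ℝ) :
    Measurable (fun z : X × L1Maps d L X => hh d T L z.1 z.2) :=
  measurable_uncurry_of_continuous_of_measurable (u := fun x y => hh d T L x y)
    (fun y => hh_cont_left hT L y) (fun x => hh_meas_right hT L x)

lemma hh_tri (hT : IsContAction d T) {L : ℝ} (hL : 0 < L) {N ε : ℝ} (hLN : L ≤ N)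
    (x x' : X) (y : L1Maps d L X) (hx : ∀ u ∈ unitBox d N, dist (T u x) (T u x') ≤ ε) :
    hh d T L x' y ≤ ε * L ^ d + hh d T L x y := by
  unfold hh
  rw [← int_const_box (d := d) _ hL, ← integral_add (integrable_const _) (hh_int hT L x y)]
  refine integral_mono_ae (hh_int hT L x' y) ((integrable_const _).add (hh_int hT L x y)) ?_
  have hm : MeasurableSet (unitBox d L) := MeasurableSet.univ_pi fun _ => measurableSet_Ico
  refine (ae_restrict_mem hm).mono fun u hu => ?_
  have hu' : u ∈ unitBox d N := by
    simp only [unitBox, Set.mem_pi, Set.mem_univ, true_implies, Set.mem_Ico] at hu ⊢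
    exact fun i => ⟨(hu i).1, (hu i).2.trans_le hLN⟩
  have := hx u hu'
  have := dist_triangle_left (T u x') (y u) (T u x)
  linarith

lemma oD_tri (hT : IsContAction d T) (L : ℝ) (x x' : X) (y : L1Maps d L X) :
    oD d T L x x' ≤ hh d T L x y + hh d T L x' y := by
  unfold hh oD
  rw [← integral_add (hh_int hT L x y) (hh_int hT L x' y)]
  exact integral_mono (oD_int hT L x x') ((hh_int hT L x y).add (hh_int hT L x' y))
    fun u => dist_triangle_right _ _ _

lemma oD_mono (hT : IsContAction d T) {L L' : ℝ} (h : L' ≤ L) (x y : X) :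
    oD d T L' x y ≤ oD d T L x y := by
  unfold oD boxMeasure
  refine setIntegral_mono_set (oD_int hT L x y) (Filter.Eventually.of_forall fun _ => dist_nonneg) ?_
  refine LE.le.eventuallyLE ?_
  intro u hu
  simp only [unitBox, Set.mem_pi, Set.mem_univ, true_implies, Set.mem_Ico] at hu ⊢
  exact fun i => ⟨(hu i).1, (hu i).2.trans_le h⟩

lemma extract (hT : IsContAction d T) {L : ℝ} (hL : 0 < L) {N ε : ℝ} (hLN : L ≤ N)
    {n : ℕ} (hn : n ≠ 0) (α : X → Fin n) (hα : Measurable α)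
    (pt : Fin n → X) (hpt : ∀ x, ∀ u ∈ unitBox d N, dist (T u x) (T u (pt (α x))) ≤ ε)
    {Ω : Type*} [MeasurableSpace Ω] (P : Measure Ω) [IsProbabilityMeasure P]
    (Xv : Ω → X) (Yv : Ω → L1Maps d L X) (hX : Measurable Xv) (hY : Measurable Yv)
    (hdis : distortion d T L P Xv Yv < ε) :
    ∃ π : Fin n → Fin n → ℝ, (∀ a b, 0 ≤ π a b) ∧ ∑ a, ∑ b, π a b = 1 ∧
      (∀ a, ∑ b, π a b = ((Measure.map Xv P) (α ⁻¹' {a})).toReal) ∧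
      ENNReal.ofReal ((∑ a, ∑ b, π a b * (Real.log (π a b) - Real.log (∑ b', π a b')
          - Real.log (∑ a', π a' b))) / Real.log 2) ≤ mutualInfo P Xv Yv ∧
      ∑ a, ∑ b, π a b * oD d T L (pt a) (pt b) < 4 * ε * L ^ d := by
  have hLd : 0 < L ^ d := by positivity
  obtain ⟨f, hf, hmin⟩ := sel_exists' hn
    (fun b (y : L1Maps d L X) => ENNReal.ofReal (hh d T L (pt b) y))
    (fun b => ENNReal.measurable_ofReal.comp (hh_meas_right hT L (pt b)))
  have hmin' : ∀ y b, hh d T L (pt (f y)) y ≤ hh d T L (pt b) y := fun y b =>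
    (ENNReal.ofReal_le_ofReal_iff (hh_nonneg _ _ _)).mp (hmin y b)
  set A : Ω → Fin n := fun ω => α (Xv ω) with hA
  set F : Ω → Fin n := fun ω => f (Yv ω) with hF
  have hAm : Measurable A := hα.comp hX
  have hFm : Measurable F := hf.comp hY
  set π : Fin n → Fin n → ℝ := fun a b => (P (A ⁻¹' {a} ∩ F ⁻¹' {b})).toReal with hπ
  have hIntg : ∀ g : Fin n → Fin n → ℝ, ∫ ω, g (A ω) (F ω) ∂P = ∑ a, ∑ b, π a b * g a b := by
    intro g
    have hm : Measurable fun ω => (A ω, F ω) := hAm.prodMk hFm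
    have e := integral_map (μ := P) hm.aemeasurable
      (f := fun z : Fin n × Fin n => g z.1 z.2) (Measurable.of_discrete).aestronglyMeasurable
    rw [← e, integral_fintype (Integrable.of_finite)]
    rw [Fintype.sum_prod_type]
    refine Finset.sum_congr rfl fun a _ => Finset.sum_congr rfl fun b _ => ?_
    rw [smul_eq_mul, Measure.real, Measure.map_apply hm (measurableSet_singleton _)]
    congr 3
    ext ω
    simp [Prod.ext_iff]
  have hsum : ∑ a, ∑ b, π a b = 1 := by
    have := hIntg (fun _ _ => 1)
    simpa using this.symm
  refine ⟨π, fun a b => ENNReal.toReal_nonneg, hsum, ?_, ?_, ?_⟩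
  · intro a
    rw [Measure.map_apply hX (hα (measurableSet_singleton a))]
    simp only [hπ]
    rw [← ENNReal.toReal_sum (fun _ _ => measure_ne_top _ _),
      ← tsum_fintype (L := .unconditional _), ← measure_iUnion]
    · congr 2; ext ω; simp [hA]
    · intro j j' hj
      refine Set.disjoint_left.mpr ?_
      intro ω h h'
      exact hj (h.2.symm.trans h'.2)
    · intro b
      exact (hAm (measurableSet_singleton a)).inter (hFm (measurableSet_singleton b))
  · rw [← ent_identity P A F hAm hFm π (fun _ _ => rfl)]
    unfold mutualInfo
    refine le_iSup_of_le n (le_iSup_of_le n ?_)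
    exact le_iSup_of_le α (le_iSup_of_le hα (le_iSup_of_le f (le_iSup_of_le hf le_rfl)))
  · rw [← hIntg (fun a b => oD d T L (pt a) (pt b))]
    have hI : Integrable (fun ω => hh d T L (Xv ω) (Yv ω)) P := by
      refine Integrable.of_bound (C := Metric.diam (Set.univ : Set X) * L ^ d)
        ((hh_meas hT L).comp (hX.prodMk hY)).aestronglyMeasurable ?_
      refine Filter.Eventually.of_forall fun ω => ?_
      rw [Real.norm_of_nonneg (hh_nonneg _ _ _)]
      exact hh_le hT hL _ _
    have hd : ∫ ω, hh d T L (Xv ω) (Yv ω) ∂P < ε * L ^ d := by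
      have : distortion d T L P Xv Yv = (L ^ d)⁻¹ * ∫ ω, hh d T L (Xv ω) (Yv ω) ∂P := by
        unfold distortion
        rw [integral_const_mul]
        rfl
      rw [this, ← div_eq_inv_mul, div_lt_iff₀ hLd] at hdis
      exact hdis
    have hle : ∀ ω, oD d T L (pt (A ω)) (pt (F ω)) ≤
        2 * (ε * L ^ d) + 2 * hh d T L (Xv ω) (Yv ω) := by
      intro ω
      have h1 := oD_tri hT L (pt (A ω)) (pt (F ω)) (Yv ω)
      have h2 := hmin' (Yv ω) (A ω)
      have h3 := hh_tri hT hL hLN (Xv ω) (pt (A ω)) (Yv ω) (hpt (Xv ω))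
      change hh d T L (pt (F ω)) (Yv ω) ≤ _ at h2
      linarith
    have hIo : Integrable (fun ω => oD d T L (pt (A ω)) (pt (F ω))) P := by
      refine Integrable.mono' ((integrable_const (2 * (ε * L ^ d))).add (hI.const_mul 2)) ?_
        (Filter.Eventually.of_forall fun ω => ?_)
      · exact ((Measurable.of_discrete (f := fun z : Fin n × Fin n =>
          oD d T L (pt z.1) (pt z.2))).comp (hAm.prodMk hFm)).aestronglyMeasurable
      · rw [Real.norm_of_nonneg (oD_nonneg _ _ _)]
        exact hle ω
    calc ∫ ω, oD d T L (pt (A ω)) (pt (F ω)) ∂P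
        ≤ ∫ ω, (2 * (ε * L ^ d) + 2 * hh d T L (Xv ω) (Yv ω)) ∂P :=
          integral_mono hIo ((integrable_const _).add (hI.const_mul 2)) hle
      _ = 2 * (ε * L ^ d) + 2 * ∫ ω, hh d T L (Xv ω) (Yv ω) ∂P := by
          rw [integral_add (integrable_const _) (hI.const_mul 2), integral_const,
            integral_const_mul]
          simp
      _ < 4 * ε * L ^ d := by linarith

end extract

end RDConv

namespace RDConv
set_option linter.unusedSectionVars false

section family
variable {X : Type*} [MetricSpace X] [CompactSpace X] [MeasurableSpace X] [BorelSpace X]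
  {d : ℕ} {T : (Fin d → ℝ) → X → X}

lemma code0 [Nonempty X] (hT : IsContAction d T) (ε : ℝ) (hε : 0 < ε) :
    ∃ c : Code X, ∀ ν : Measure X, IsProbabilityMeasure ν →
      gval d T (ε + 7 * ε) c ν ≤ entScale d T ε + 1 := by
  classical
  have hN : ∃ p : ℕ, ENNReal.ofReal (Real.logb 2 (covNum X (dSup d T ((p + 1 : ℕ) : ℝ)) ε) /
      ((p + 1 : ℕ) : ℝ) ^ d) ≤ entScale d T ε + 1 := by
    by_cases htop : entScale d T ε = ⊤
    · exact ⟨0, by rw [htop]; simp⟩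
    have hlt : entScale d T ε < entScale d T ε + 1 := ENNReal.lt_add_right htop one_ne_zero
    have hev := eventually_lt_of_limsup_lt hlt
    have h2 := (tendsto_natCast_atTop_atTop (R := ℝ)).eventually hev
    obtain ⟨N, hN1, hN2⟩ := (h2.and (eventually_ge_atTop 1)).exists
    obtain ⟨p, rfl⟩ : ∃ p, N = p + 1 := ⟨N - 1, by omega⟩
    exact ⟨p, hN1.le⟩
  obtain ⟨p, hp⟩ := hN
  obtain ⟨α, pt, hα, hpt⟩ := partition_exists (T := T) hT ((p + 1 : ℕ) : ℝ) ε hε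
  generalize hn' : covNum X (dSup d T ((p + 1 : ℕ) : ℝ)) ε = n at α pt hp
  have hn : n ≠ 0 := by
    intro h
    have := (α (Classical.arbitrary X)).2
    omega
  have hn0 : (n : ℝ) ≠ 0 := Nat.cast_ne_zero.mpr hn
  let z : Sn n := ⟨(fun a b => if a = b then 1 else 0, fun _ => (n : ℝ)⁻¹),
    fun a b => by dsimp only; split_ifs <;> norm_num, fun a => by simp, fun b => by positivity,
    by simp [hn0]⟩
  have hc : ∀ a, cst z a = Real.logb 2 n := by
    intro a
    have : ∀ b, (z.1.1 a b * Real.log (z.1.1 a b) - z.1.1 a b * Real.log (z.1.2 b)) =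
        if a = b then Real.log n else 0 := by
      intro b
      change (if a = b then (1 : ℝ) else 0) * Real.log (if a = b then (1 : ℝ) else 0) -
        (if a = b then (1 : ℝ) else 0) * Real.log ((n : ℝ)⁻¹) = _
      split_ifs <;> simp
    unfold cst
    simp_rw [this]
    simp [Real.logb]
  refine ⟨pCode p 0 α hα pt z, fun ν hν => ?_⟩
  have hL : ((p + 1 : ℕ) : ℝ) / ((0 + 1 : ℕ) : ℝ) = ((p + 1 : ℕ) : ℝ) := by simp
  have hvs : ∑ a, (ν (α ⁻¹' {a})).toReal = 1 := by
    have := lint_fin ν α hα (fun _ => 1)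
    simp only [lintegral_const, measure_univ, mul_one, one_mul] at this
    rw [← ENNReal.toReal_sum (fun _ _ => measure_ne_top _ _), ← this, ENNReal.toReal_one]
  have := gval_pCode hT p 0 α hα pt z ((p + 1 : ℕ) : ℝ) ε hε hL.le hpt ν
    (fun a => (ν (α ⁻¹' {a})).toReal) (fun _ => rfl) (Real.logb 2 n) (7 * ε) (by linarith)
    (by
      simp_rw [hc]
      rw [← Finset.sum_mul, hvs, one_mul])
    (by
      have : ∀ a b, (ν (α ⁻¹' {a})).toReal * z.1.1 a b *
          oD d T (((p + 1 : ℕ) : ℝ) / ((0 + 1 : ℕ) : ℝ)) (pt a) (pt b) = 0 := by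
        intro a b
        change _ * (if a = b then (1 : ℝ) else 0) * _ = 0
        split_ifs with h
        · subst h; simp [oD]
        · simp
      simp_rw [this]
      simp only [Finset.sum_const_zero]
      positivity)
  rw [hL] at this
  exact this.trans hp

lemma rat_approx {L : ℝ} (hL : 0 < L) {A B : ℝ} (hA : A < B * L ^ d) :
    ∃ p q : ℕ, ((p + 1 : ℕ) : ℝ) / ((q + 1 : ℕ) : ℝ) ≤ L ∧
      A < B * (((p + 1 : ℕ) : ℝ) / ((q + 1 : ℕ) : ℝ)) ^ d ∧
      4 * L ^ d < 5 * (((p + 1 : ℕ) : ℝ) / ((q + 1 : ℕ) : ℝ)) ^ d := by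
  have hLd : 0 < L ^ d := by positivity
  have h1 : ∀ᶠ x in 𝓝 L, A < B * x ^ d :=
    (by fun_prop : Continuous fun x : ℝ => B * x ^ d).continuousAt.eventually (lt_mem_nhds hA)
  have h2 : ∀ᶠ x in 𝓝 L, 4 * L ^ d < 5 * x ^ d :=
    (by fun_prop : Continuous fun x : ℝ => 5 * x ^ d).continuousAt.eventually
      (lt_mem_nhds (by linarith))
  obtain ⟨δ, hδ, hball⟩ := Metric.eventually_nhds_iff.mp (h1.and h2)
  obtain ⟨r, hr1, hr2⟩ := exists_rat_btwn (show max (L - δ) 0 < L from max_lt (by linarith) hL)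
  have hr0 : (0 : ℝ) < r := (le_max_right _ _).trans_lt hr1
  have hrδ : L - δ < r := (le_max_left _ _).trans_lt hr1
  have hrq : 0 < r := by exact_mod_cast hr0
  have hnum : 0 < r.num := Rat.num_pos.mpr hrq
  have e : ((r.num.toNat - 1 + 1 : ℕ) : ℝ) / ((r.den - 1 + 1 : ℕ) : ℝ) = r := by
    have a1 : r.num.toNat - 1 + 1 = r.num.toNat := by omega
    have a2 : r.den - 1 + 1 = r.den := by have := r.pos; omega
    rw [a1, a2]
    have a3 : ((r.num.toNat : ℕ) : ℝ) = (r.num : ℝ) := by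
      have : ((r.num.toNat : ℕ) : ℤ) = r.num := Int.toNat_of_nonneg hnum.le
      exact_mod_cast congrArg (Int.cast : ℤ → ℝ) this
    rw [a3]
    exact (Rat.cast_def r).symm
  refine ⟨r.num.toNat - 1, r.den - 1, ?_⟩
  rw [e]
  refine ⟨hr2.le, ?_⟩
  apply hball
  rw [Real.dist_eq, abs_lt]
  constructor <;> linarith

lemma family_exists [Nonempty X] (hT : IsContAction d T) (ε : ℝ) (hε : 0 < ε) :
    ∃ c : ℕ → Code X, (∀ ν : Measure X, IsProbabilityMeasure ν →
      gval d T (ε + 7 * ε) (c 0) ν ≤ entScale d T ε + 1) ∧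
      ∀ ν : Measure X, IsProbabilityMeasure ν →
        ⨅ j, gval d T (ε + 7 * ε) (c j) ν ≤ RD d T ν ε := by
  obtain ⟨c0, hc0⟩ := code0 (X := X) (T := T) hT ε hε
  have hpart : ∀ N : ℕ, ∃ n : ℕ, n ≠ 0 ∧ ∃ (α : X → Fin n) (pt : Fin n → X), Measurable α ∧
      ∀ x, ∀ u ∈ unitBox d (N : ℝ), dist (T u x) (T u (pt (α x))) ≤ ε := by
    intro N
    obtain ⟨α, pt, hα, hpt⟩ := partition_exists (X := X) (T := T) hT (N : ℝ) ε hε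
    refine ⟨_, ?_, α, pt, hα, hpt⟩
    intro h
    have := (α (Classical.arbitrary X)).2
    omega
  choose n hn α pt hα hpt using hpart
  have hdense : ∀ N, ∃ s : ℕ → Sn (n N), DenseRange s := fun N => by
    have := Sn_nonempty (hn N)
    exact TopologicalSpace.exists_dense_seq (Sn (n N))
  choose s hs using hdense
  let e : ℕ × ℕ × ℕ × ℕ ≃ ℕ := Denumerable.eqv _
  let c' : ℕ × ℕ × ℕ × ℕ → Code X := fun k =>
    pCode k.2.1 k.2.2.1 (α k.1) (hα k.1) (pt k.1) (s k.1 k.2.2.2)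
  let c : ℕ → Code X := fun j => Nat.casesOn j c0 (fun i => c' (e.symm i))
  refine ⟨c, fun ν hν => hc0 ν hν, fun ν hν => ?_⟩
  have hinf : ∀ N p q i, ⨅ j, gval d T (ε + 7 * ε) (c j) ν ≤
      gval d T (ε + 7 * ε) (pCode p q (α N) (hα N) (pt N) (s N i)) ν := by
    intro N p q i
    refine (iInf_le _ (e (N, p, q, i) + 1)).trans (le_of_eq ?_)
    change gval d T (ε + 7 * ε) (c' (e.symm (e (N, p, q, i)))) ν = _
    rw [e.symm_apply_apply]
  set G := ⨅ j, gval d T (ε + 7 * ε) (c j) ν with hG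
  unfold RD
  refine le_iInf₂ fun L hL => ?_
  have hLd : 0 < L ^ d := by positivity
  rw [ENNReal.le_div_iff_mul_le (Or.inl (by simpa using hLd)) (Or.inl ENNReal.ofReal_ne_top)]
  unfold RL
  refine le_iInf fun Ω => le_iInf fun mΩ => le_iInf fun P => le_iInf fun hP => le_iInf fun Xv =>
    le_iInf fun Yv => le_iInf fun hX => le_iInf fun hY => le_iInf fun hlaw => le_iInf fun hdis => ?_
  rw [← ENNReal.le_div_iff_mul_le (Or.inl (by simpa using hLd)) (Or.inl ENNReal.ofReal_ne_top)]
  set N := ⌈L⌉₊ with hN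
  have hLN : L ≤ (N : ℝ) := Nat.le_ceil L
  obtain ⟨π, h0, h1, hv, hmi, hdist⟩ := extract hT hL hLN (hn N) (α N) (hα N) (pt N) (hpt N)
    P Xv Yv hX hY hdis
  refine le_trans ?_ (ENNReal.div_le_div_right hmi _)
  set I0 := (∑ a, ∑ b, π a b * (Real.log (π a b) - Real.log (∑ b', π a b')
          - Real.log (∑ a', π a' b))) / Real.log 2 with hI0
  refine ENNReal.le_of_forall_pos_le_add fun η hη _ => ?_
  have hη' : (0 : ℝ) < η := hη
  set B : ℝ := max I0 0 / L ^ d + η with hB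
  have hB0 : 0 < B := by
    have : 0 ≤ max I0 0 / L ^ d := div_nonneg (le_max_right _ _) hLd.le
    linarith
  have hAB : max I0 0 < B * L ^ d := by
    rw [hB, add_mul, div_mul_cancel₀ _ hLd.ne']
    have : 0 < η * L ^ d := mul_pos hη' hLd
    linarith
  obtain ⟨p, q, hL1, hL2, hL3⟩ := rat_approx hL hAB
  set L' : ℝ := ((p + 1 : ℕ) : ℝ) / ((q + 1 : ℕ) : ℝ) with hL'
  have hL'0 : 0 < L' := div_pos (Nat.cast_pos.mpr p.succ_pos) (Nat.cast_pos.mpr q.succ_pos)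
  have hL'd : 0 < L' ^ d := by positivity
  obtain ⟨i, hi1, hi2⟩ := fin_dense (hn N) π h0 h1
    (fun a b => oD d T L' (pt N a) (pt N b)) (s N) (hs N) (B * L' ^ d) (7 * ε * L' ^ d)
    ((le_max_left _ _).trans_lt hL2) (by
      refine lt_of_le_of_lt (Finset.sum_le_sum fun a _ => Finset.sum_le_sum fun b _ =>
        mul_le_mul_of_nonneg_left (oD_mono hT hL1 _ _) (h0 a b)) (hdist.trans ?_)
      nlinarith)
  refine (hinf N p q i).trans ?_
  have := gval_pCode hT p q (α N) (hα N) (pt N) (s N i) N ε hε (hL1.trans hLN) (hpt N) ν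
    (fun a => ∑ b, π a b) (fun a => by rw [hv a, hlaw]) (B * L' ^ d) (7 * ε) (by linarith)
    hi1.le hi2.le
  refine this.trans ?_
  rw [← hL', mul_div_assoc, div_self hL'd.ne', mul_one, hB,
    ENNReal.ofReal_add (div_nonneg (le_max_right _ _) hLd.le) hη'.le, ENNReal.ofReal_coe_nnreal,
    ENNReal.ofReal_div_of_pos hLd]
  refine add_le_add (ENNReal.div_le_div_right ?_ _) le_rfl
  rcases le_total I0 0 with h | h
  · rw [max_eq_right h]; simp
  · rw [max_eq_left h]

end family

end RDConv

namespace RDConv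
set_option linter.unusedSectionVars false

section final
variable {X : Type*} [MetricSpace X] [CompactSpace X] [MeasurableSpace X] [BorelSpace X]
  {d : ℕ} {T : (Fin d → ℝ) → X → X}

lemma RD_anti (ν : Measure X) {ε ε' : ℝ} (h : ε ≤ ε') : RD d T ν ε' ≤ RD d T ν ε := by
  unfold RD RL
  refine iInf₂_mono fun L _ => ENNReal.div_le_div_right ?_ _
  refine iInf_mono fun Ω => iInf_mono fun mΩ => iInf_mono fun P => iInf_mono fun hP =>
    iInf_mono fun Xv => iInf_mono fun Yv => iInf_mono fun hX => iInf_mono fun hY =>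
    iInf_mono fun hlaw => iInf_mono' fun hdis => ⟨hdis.trans_le h, le_rfl⟩

lemma logb_half (m : ℕ) : Real.logb 2 (1 / (1 / 2 : ℝ) ^ m) = m := by
  rw [one_div, one_div, inv_pow, inv_inv, Real.logb_pow, Real.logb_self_eq_one one_lt_two, mul_one]

lemma tendsto_half : Tendsto (fun m : ℕ => (1 / 2 : ℝ) ^ m) atTop (𝓝[>] (0 : ℝ)) := by
  refine tendsto_nhdsWithin_iff.mpr ⟨tendsto_pow_atTop_nhds_zero_of_lt_one (by norm_num)
    (by norm_num), Filter.Eventually.of_forall fun m => ?_⟩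
  change (0 : ℝ) < _
  positivity

lemma ev_half {F : ℝ → ℝ≥0∞} {c : ℝ≥0∞}
    (h : limsup (fun ε : ℝ => F ε / ENNReal.ofReal (Real.logb 2 (1 / ε))) (𝓝[>] (0 : ℝ)) < c) :
    ∀ᶠ m : ℕ in atTop, F ((1 / 2 : ℝ) ^ m) ≤ c * m := by
  have h1 := tendsto_half.eventually (eventually_lt_of_limsup_lt h)
  filter_upwards [h1, eventually_ge_atTop 1] with m hm hm1
  rw [logb_half, ENNReal.ofReal_natCast] at hm
  have hm0 : (m : ℝ≥0∞) ≠ 0 := by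
    have : m ≠ 0 := by omega
    exact_mod_cast this
  exact (ENNReal.div_le_iff hm0 (ENNReal.natCast_ne_top m)).mp hm.le

lemma urdim_le_seq (ν : Measure X) (n0 : ℕ) (b : ℕ → ℝ≥0∞)
    (hb : ∀ k, RD d T ν ((1 / 2 : ℝ) ^ (n0 + k + 1)) / ((n0 + k : ℕ) : ℝ≥0∞) ≤ b k) :
    urdim d T ν ≤ limsup b atTop := by
  refine le_of_forall_gt_imp_ge_of_dense fun c hc => ?_
  obtain ⟨K, hK⟩ := eventually_atTop.mp (eventually_lt_of_limsup_lt hc)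
  refine limsup_le_of_le (h := ?_)
  have hmem : Set.Ioo (0 : ℝ) ((1 / 2 : ℝ) ^ (n0 + K)) ∈ 𝓝[>] (0 : ℝ) :=
    Ioo_mem_nhdsGT (by positivity)
  filter_upwards [hmem] with ε hε
  have hε1 : ε ≤ 1 := hε.2.le.trans (pow_le_one₀ (by norm_num) (by norm_num))
  obtain ⟨n, hn1, hn2⟩ := exists_nat_pow_near_of_lt_one hε.1 hε1
    (show (0 : ℝ) < 1 / 2 by norm_num) (by norm_num)
  have hlt : n0 + K < n + 1 :=
    (pow_lt_pow_iff_right_of_lt_one₀ (by norm_num) (by norm_num)).mp (hn1.trans hε.2)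
  obtain ⟨k, rfl⟩ : ∃ k, n = n0 + k := ⟨n - n0, by omega⟩
  have hkK : K ≤ k := by omega
  refine le_trans ?_ ((hb k).trans (hK k hkK).le)
  refine ENNReal.div_le_div (RD_anti ν hn1.le) ?_
  rw [← ENNReal.ofReal_natCast, ← logb_half]
  refine ENNReal.ofReal_le_ofReal ?_
  refine Real.logb_le_logb_of_le one_lt_two (by positivity) ?_
  exact one_div_le_one_div_of_le hε.1 hn2

lemma seq_le_urdim (ν : Measure X) (n0 : ℕ) (hn0 : 1 ≤ n0) (a : ℕ → ℝ≥0∞)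
    (ha : ∀ k, a k ≤ RD d T ν ((1 / 2 : ℝ) ^ (n0 + k + 5)) / ((n0 + k : ℕ) : ℝ≥0∞)) :
    limsup a atTop ≤ urdim d T ν := by
  refine le_of_forall_gt_imp_ge_of_dense fun c hc => ?_
  by_cases hct : c = ⊤
  · rw [hct]; exact le_top
  have h1 := ev_half hc
  have ht : Tendsto (fun k : ℕ => n0 + k + 5) atTop atTop :=
    tendsto_atTop_mono (fun k => by simp only [id]; omega) tendsto_id
  have h2 := ht.eventually h1
  have hlim : Tendsto (fun k : ℕ => c * ENNReal.ofReal (1 + 5 / ((n0 + k : ℕ) : ℝ))) atTop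
      (𝓝 (c * ENNReal.ofReal (1 + 0))) := by
    refine ENNReal.Tendsto.const_mul ?_ (Or.inr hct)
    refine ENNReal.tendsto_ofReal (tendsto_const_nhds.add ?_)
    have h5 : Tendsto (fun k : ℕ => n0 + k) atTop atTop :=
      tendsto_atTop_mono (fun k => by simp only [id]; omega) tendsto_id
    exact (tendsto_const_div_atTop_nhds_zero_nat (5 : ℝ)).comp h5
  have hle : limsup a atTop ≤
      limsup (fun k : ℕ => c * ENNReal.ofReal (1 + 5 / ((n0 + k : ℕ) : ℝ))) atTop := by
    refine limsup_le_limsup ?_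
    filter_upwards [h2] with k hk
    refine (ha k).trans ((ENNReal.div_le_div_right hk _).trans (le_of_eq ?_))
    have hpos : (0 : ℝ) < ((n0 + k : ℕ) : ℝ) := Nat.cast_pos.mpr (by omega)
    rw [mul_div_assoc]
    congr 1
    rw [← ENNReal.ofReal_natCast, ← ENNReal.ofReal_natCast, ← ENNReal.ofReal_div_of_pos hpos]
    congr 1
    rw [Nat.cast_add (n0 + k) 5]
    field_simp
    norm_num
  refine hle.trans ?_
  rw [hlim.limsup_eq]
  simp

lemma main_thm (hd : 0 < d) (hT : IsContAction d T)
    (hdim : umdim d T ≠ ⊤)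
    (lam : Measure (InvM X d T)) [IsProbabilityMeasure lam]
    (μ : Measure X) [IsProbabilityMeasure μ]
    (hbar : ∀ A : Set X, MeasurableSet A → μ A = ∫⁻ ν, (ν.1 : Measure X) A ∂lam) :
    urdim d T μ ≤ ∫⁻ ν, urdim d T (ν.1 : Measure X) ∂lam := by
  have : Nonempty X := nonempty_of_isProbabilityMeasure μ
  set C : ℝ≥0∞ := umdim d T + 1 with hC
  have hCt : C ≠ ⊤ := by simp [hC, hdim]
  have hev : ∀ᶠ m : ℕ in atTop, entScale d T ((1 / 2 : ℝ) ^ m) ≤ C * m :=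
    ev_half (F := fun ε => entScale d T ε) (ENNReal.lt_add_right hdim one_ne_zero)
  obtain ⟨m0, hm0⟩ := eventually_atTop.mp hev
  set n0 := m0 + 1 with hn0
  have hεpos : ∀ k : ℕ, (0 : ℝ) < (1 / 2 : ℝ) ^ (n0 + k + 5) := fun k => by positivity
  choose c hc0 hcinf using fun k => family_exists (X := X) (T := T) hT _ (hεpos k)
  set ε : ℕ → ℝ := fun k => (1 / 2 : ℝ) ^ (n0 + k + 5) with hεdef
  set G : ℕ → InvM X d T → ℝ≥0∞ := fun k ν =>
    ⨅ j, gval d T (ε k + 7 * ε k) (c k j) (ν.1 : Measure X) with hG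
  have hGm : ∀ k, Measurable (G k) := fun k => Measurable.iInf fun j => gval_meas hT _ _
  have hB : ∀ k (ν : InvM X d T), gval d T (ε k + 7 * ε k) (c k 0) (ν.1 : Measure X) ≤
      C * ((n0 + k + 5 : ℕ) : ℝ≥0∞) + 1 := fun k ν =>
    (hc0 k _ inferInstance).trans (by gcongr; exact hm0 _ (by omega))
  have hBt : ∀ k, C * ((n0 + k + 5 : ℕ) : ℝ≥0∞) + 1 ≠ ⊤ := fun k =>
    ENNReal.add_ne_top.mpr ⟨ENNReal.mul_ne_top hCt (ENNReal.natCast_ne_top _), ENNReal.one_ne_top⟩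
  set a : ℕ → InvM X d T → ℝ≥0∞ := fun k ν => G k ν / ((n0 + k : ℕ) : ℝ≥0∞) with ha
  have ham : ∀ k, Measurable (a k) := fun k => (hGm k).div_const _
  have hn0k : ∀ k, ((n0 + k : ℕ) : ℝ≥0∞) ≠ 0 := fun k => by
    have : n0 + k ≠ 0 := by omega
    exact_mod_cast this
  have hab : ∀ k ν, a k ν ≤ 6 * C + 1 := by
    intro k ν
    refine (ENNReal.div_le_iff (hn0k k) (ENNReal.natCast_ne_top _)).mpr ?_
    refine (iInf_le _ 0).trans ((hB k ν).trans ?_)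
    rw [add_mul (6 * C) 1, one_mul]
    refine add_le_add (α := ℝ≥0∞) ?_ ?_
    · rw [mul_comm 6 C, mul_assoc]
      gcongr
      have : n0 + k + 5 ≤ 6 * (n0 + k) := by omega
      exact_mod_cast this
    · have : 1 ≤ n0 + k := by omega
      exact_mod_cast this
  have h1 : urdim d T μ ≤ limsup (fun k => ∫⁻ ν, a k ν ∂lam) atTop := by
    refine urdim_le_seq μ n0 _ fun k => ?_
    have h2 := RD_le_lintegral hd hT lam μ hbar (c k) (ε k + 7 * ε k)
      (by have := hεpos k; simp only [hεdef]; linarith) _ (hBt k) (hB k)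
    have e2 : 2 * (ε k + 7 * ε k) = (1 / 2 : ℝ) ^ (n0 + k + 1) := by
      simp only [hεdef]
      rw [show n0 + k + 5 = (n0 + k + 1) + 4 by ring, pow_add _ (n0 + k + 1) 4]
      ring
    rw [e2] at h2
    simp only [ha, div_eq_mul_inv]
    rw [lintegral_mul_const _ (hGm k)]
    exact mul_le_mul_left h2 _
  refine h1.trans ?_
  have h3 := limsup_lintegral_le (μ := lam) (f := a) (fun _ => 6 * C + 1) ham
    (fun k => Filter.Eventually.of_forall fun ν => hab k ν) (by
      rw [lintegral_const, measure_univ, mul_one]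
      exact ENNReal.add_ne_top.mpr
        ⟨ENNReal.mul_ne_top (by norm_num) hCt, ENNReal.one_ne_top⟩)
  refine h3.trans (lintegral_mono fun ν => ?_)
  refine seq_le_urdim _ n0 (by omega) _ fun k => ?_
  exact ENNReal.div_le_div_right (hcinf k _ inferInstance) _

end final

end RDConv

/-- Theorem 1.1: convexity of the upper rate distortion dimension under convex combination
(barycenter) of invariant measures, assuming finite upper metric mean dimension. -/
theorem urdim_le_lintegral_of_barycenter
    {X : Type*} [MetricSpace X] [CompactSpace X] [MeasurableSpace X] [BorelSpace X]
    (d : ℕ) (hd : 0 < d) (T : (Fin d → ℝ) → X → X) (hT : IsContAction d T)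
    (hdim : umdim d T ≠ ⊤)
    (lam : Measure (InvM X d T)) [IsProbabilityMeasure lam]
    (μ : Measure X) [IsProbabilityMeasure μ] (hμinv : MeasInvariant d T μ)
    (hbar : ∀ A : Set X, MeasurableSet A → μ A = ∫⁻ ν, (ν.1 : Measure X) A ∂lam) :
    urdim d T μ ≤ ∫⁻ ν, urdim d T (ν.1 : Measure X) ∂lam := by
  exact RDConv.main_thm hd hT hdim lam μ hbar
end

section
/- Let T : ℝ^d × 𝒳 → 𝒳 be a continuous action of ℝ^d on a compact metric space (𝒳, 𝐝). Let λ be a Borel probability measure on M^T(𝒳) and let μ = ∫_{M^T(𝒳)} ν dλ(ν) be its barycenter. Then lrdim(𝒳,T,𝐝,μ) ≥ ∫_{M^T(𝒳)} lrdim(𝒳,T,𝐝,ν) dλ(ν). -/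
open MeasureTheory Filter Set
open scoped ENNReal Topology NNReal

section FiniteInfo

lemma fin_info_le {S I J T : Type*} [Fintype S] [Fintype I] [Fintype J] [Fintype T]
    [DecidableEq T] (w : S → I → ℝ) (κ : I → J → ℝ) (p : J → ℝ) (b : J → T)
    (hw : ∀ s i, 0 ≤ w s i) (hw1 : ∑ s, ∑ i, w s i = 1)
    (hκ : ∀ i j, 0 ≤ κ i j) (hκ1 : ∀ i, ∑ j, κ i j = 1)
    (hp : ∀ j, 0 ≤ p j) (hp1 : ∑ j, p j = 1) (hκp : ∀ i j, 0 < κ i j → 0 < p j)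
    (r : S → T → ℝ) (hr : ∀ s t, r s t = ∑ i, ∑ j, if b j = t then w s i * κ i j else 0)
    (rs : S → ℝ) (hrs : ∀ s, rs s = ∑ i, w s i)
    (rt : T → ℝ) (hrt : ∀ t, rt t = ∑ s, r s t) :
    (-∑ s, rs s * Real.logb 2 (rs s)) + (-∑ t, rt t * Real.logb 2 (rt t))
      - (-∑ s, ∑ t, r s t * Real.logb 2 (r s t))
      ≤ ∑ i, (∑ s, w s i) * ∑ j, κ i j * (Real.logb 2 (κ i j) - Real.logb 2 (p j)) := by
  have hr0 : ∀ s t, 0 ≤ r s t := by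
    intro s t
    rw [hr]
    refine Finset.sum_nonneg fun i _ => Finset.sum_nonneg fun j _ => ?_
    split_ifs
    · exact mul_nonneg (hw _ _) (hκ _ _)
    · exact le_rfl
  have hrs0 : ∀ s, 0 ≤ rs s := fun s => by
    rw [hrs]; exact Finset.sum_nonneg fun i _ => hw _ _
  have hrt0 : ∀ s, 0 ≤ rt s := fun s => by
    rw [hrt]; exact Finset.sum_nonneg fun i _ => hr0 _ _
  have hl2 : 0 < Real.log 2 := Real.log_pos (by norm_num)
  -- rewriting the three entropies as sums over (s,i,j)
  have e3 : ∀ F : S → T → ℝ, ∑ s, ∑ t, r s t * F s t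
      = ∑ s, ∑ i, ∑ j, w s i * κ i j * F s (b j) := by
    intro F
    refine Finset.sum_congr rfl fun s _ => ?_
    simp_rw [hr, Finset.sum_mul]
    rw [Finset.sum_comm]
    refine Finset.sum_congr rfl fun i _ => ?_
    rw [Finset.sum_comm]
    refine Finset.sum_congr rfl fun j _ => ?_
    simp [ite_mul]
  have e2 : ∑ t, rt t * Real.logb 2 (rt t)
      = ∑ s, ∑ i, ∑ j, w s i * κ i j * Real.logb 2 (rt (b j)) := by
    rw [← e3 (fun _ t => Real.logb 2 (rt t)), Finset.sum_comm]
    refine Finset.sum_congr rfl fun t _ => ?_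
    rw [← Finset.sum_mul, ← hrt]
  have e1 : ∑ s, rs s * Real.logb 2 (rs s)
      = ∑ s, ∑ i, ∑ j, w s i * κ i j * Real.logb 2 (rs s) := by
    refine Finset.sum_congr rfl fun s _ => ?_
    simp_rw [← Finset.sum_mul, ← Finset.mul_sum, hκ1, mul_one, ← hrs]
  have e4 : ∑ i, (∑ s, w s i) * ∑ j, κ i j * (Real.logb 2 (κ i j) - Real.logb 2 (p j))
      = ∑ s, ∑ i, ∑ j, w s i * κ i j * (Real.logb 2 (κ i j) - Real.logb 2 (p j)) := by
    rw [Finset.sum_comm]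
    refine Finset.sum_congr rfl fun i _ => ?_
    rw [Finset.sum_mul]
    refine Finset.sum_congr rfl fun s _ => ?_
    rw [Finset.mul_sum]
    refine Finset.sum_congr rfl fun j _ => by ring
  have eW : ∑ s, ∑ i, ∑ j, w s i * κ i j = 1 := by
    simp_rw [← Finset.mul_sum, hκ1, mul_one, hw1]
  set Q : S → I → J → ℝ := fun s i j => w s i * (p j * (r s (b j) / (rs s * rt (b j)))) with hQ
  have hQ0 : ∀ s i j, 0 ≤ Q s i j := fun s i j =>
    mul_nonneg (hw _ _) (mul_nonneg (hp _) (div_nonneg (hr0 _ _) (mul_nonneg (hrs0 _) (hrt0 _))))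
  have eQ : ∑ s, ∑ i, ∑ j, Q s i j ≤ 1 := by
    have h1 : ∀ s, ∑ i, ∑ j, Q s i j ≤ ∑ j, p j * (r s (b j) / rt (b j)) := by
      intro s
      simp_rw [hQ, ← Finset.mul_sum]
      rw [← Finset.sum_mul, ← hrs, Finset.mul_sum]
      refine Finset.sum_le_sum fun j _ => ?_
      rcases (hrs0 s).eq_or_lt with h | h
      · rw [← h, zero_mul]
        exact mul_nonneg (hp _) (div_nonneg (hr0 _ _) (hrt0 _))
      · apply le_of_eq
        rw [← div_div, div_right_comm]
        field_simp
    calc _ ≤ ∑ s, ∑ j, p j * (r s (b j) / rt (b j)) := Finset.sum_le_sum fun s _ => h1 s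
      _ = ∑ j, p j * (rt (b j) / rt (b j)) := by
          rw [Finset.sum_comm]
          refine Finset.sum_congr rfl fun j _ => ?_
          rw [← Finset.mul_sum, ← Finset.sum_div, ← hrt]
      _ ≤ ∑ j, p j := Finset.sum_le_sum fun j _ => mul_le_of_le_one_right (hp j) (div_self_le_one _)
      _ = 1 := hp1
  have key : ∀ s i j, w s i * κ i j *
      (Real.logb 2 (r s (b j)) - Real.logb 2 (rs s) - Real.logb 2 (rt (b j)))
      ≤ w s i * κ i j * (Real.logb 2 (κ i j) - Real.logb 2 (p j))
        + (Q s i j - w s i * κ i j) / Real.log 2 := by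
    intro s i j
    rcases (mul_nonneg (hw s i) (hκ i j)).eq_or_lt with h | h
    · rw [← h]; simp only [zero_mul, zero_add, sub_zero]
      exact div_nonneg (hQ0 _ _ _) hl2.le
    · have hw' : 0 < w s i := lt_of_le_of_ne (hw _ _) (by rintro h'; rw [← h'] at h; simp at h)
      have hκ' : 0 < κ i j := lt_of_le_of_ne (hκ _ _) (by rintro h'; rw [← h'] at h; simp at h)
      have hp' := hκp i j hκ'
      have hrs' : 0 < rs s := by
        rw [hrs]
        exact lt_of_lt_of_le hw' (Finset.single_le_sum (f := fun i => w s i)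
          (fun i _ => hw s i) (Finset.mem_univ i))
      have hr' : 0 < r s (b j) := by
        rw [hr]
        have hn : ∀ i j', 0 ≤ (if b j' = b j then w s i * κ i j' else 0) := by
          intro i j'
          split_ifs
          · exact mul_nonneg (hw _ _) (hκ _ _)
          · exact le_rfl
        calc 0 < (if b j = b j then w s i * κ i j else 0) := by simpa using h
          _ ≤ ∑ j', (if b j' = b j then w s i * κ i j' else 0) :=
            Finset.single_le_sum (f := fun j' => (if b j' = b j then w s i * κ i j' else 0))
              (fun j' _ => hn i j') (Finset.mem_univ j)
          _ ≤ _ := Finset.single_le_sum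
              (f := fun i => ∑ j', (if b j' = b j then w s i * κ i j' else 0))
              (fun i _ => Finset.sum_nonneg fun j' _ => hn i j') (Finset.mem_univ i)
      have hrt' : 0 < rt (b j) := by
        rw [hrt]
        exact lt_of_lt_of_le hr' (Finset.single_le_sum (f := fun s => r s (b j))
          (fun s _ => hr0 s _) (Finset.mem_univ s))
      have hlog := Real.log_le_sub_one_of_pos
        (show 0 < p j * (r s (b j) / (rs s * rt (b j))) / κ i j by positivity)
      rw [Real.log_div (by positivity) hκ'.ne', Real.log_mul hp'.ne' (by positivity),
        Real.log_div hr'.ne' (by positivity), Real.log_mul hrs'.ne' hrt'.ne'] at hlog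
      have h2 := mul_le_mul_of_nonneg_left hlog h.le
      have h3 : w s i * κ i j * (p j * (r s (b j) / (rs s * rt (b j))) / κ i j - 1)
          = Q s i j - w s i * κ i j := by
        simp only [hQ]; field_simp
      rw [h3] at h2
      simp only [Real.logb]
      rw [← sub_nonneg]
      have : w s i * κ i j * (Real.log (κ i j) / Real.log 2 - Real.log (p j) / Real.log 2) +
        (Q s i j - w s i * κ i j) / Real.log 2 - w s i * κ i j *
        (Real.log (r s (b j)) / Real.log 2 - Real.log (rs s) / Real.log 2
          - Real.log (rt (b j)) / Real.log 2)
        = (Q s i j - w s i * κ i j - w s i * κ i j * (Real.log (p j) + (Real.log (r s (b j)) -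
          (Real.log (rs s) + Real.log (rt (b j)))) - Real.log (κ i j))) / Real.log 2 := by ring
      rw [this]
      exact div_nonneg (by linarith) hl2.le
  have hsum := Finset.sum_le_sum fun s (_ : s ∈ Finset.univ) =>
    Finset.sum_le_sum fun i (_ : i ∈ Finset.univ) =>
      Finset.sum_le_sum fun j (_ : j ∈ Finset.univ) => key s i j
  simp only [mul_sub, Finset.sum_sub_distrib, Finset.sum_add_distrib, sub_div] at hsum
  rw [e3, e2, e1, e4]
  simp only [mul_sub, Finset.sum_sub_distrib]
  simp only [← Finset.sum_div] at hsum
  rw [eW] at hsum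
  have := div_le_div_of_nonneg_right eQ hl2.le
  linarith

lemma fin_info_eq {I J : Type*} [Fintype I] [Fintype J] 
    (q : I → J → ℝ) (hq : ∀ i j, 0 ≤ q i j) 
    (κ : I → J → ℝ) (hκ : ∀ i j, (∑ j', q i j') * κ i j = q i j) :
    ∑ i, (∑ j, q i j) * ∑ j, κ i j * (Real.logb 2 (κ i j) - Real.logb 2 (∑ i', q i' j)) =
    (-∑ i, (∑ j, q i j) * Real.logb 2 (∑ j, q i j))
      + (-∑ j, (∑ i, q i j) * Real.logb 2 (∑ i, q i j))
      - (-∑ i, ∑ j, q i j * Real.logb 2 (q i j)) := by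
  have h1 : ∑ i, (∑ j, q i j) * Real.logb 2 (∑ j, q i j) 
    = ∑ i, ∑ j, q i j * Real.logb 2 (∑ j, q i j) := by simp_rw [Finset.sum_mul]
  have h2 : ∑ j, (∑ i, q i j) * Real.logb 2 (∑ i, q i j) 
    = ∑ i, ∑ j, q i j * Real.logb 2 (∑ i, q i j) := by
    rw [Finset.sum_comm]; simp_rw [Finset.sum_mul]
  rw [h1, h2]
  have h3 : ∀ i, (∑ j, q i j) * ∑ j, κ i j * (Real.logb 2 (κ i j) - Real.logb 2 (∑ i', q i' j))
      = ∑ j, (q i j * Real.logb 2 (q i j) - q i j * Real.logb 2 (∑ j, q i j) 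
        - q i j * Real.logb 2 (∑ i', q i' j)) := by
    intro i
    rw [Finset.mul_sum]
    refine Finset.sum_congr rfl fun j _ => ?_
    rw [← mul_assoc, hκ]
    rcases (hq i j).eq_or_lt with h | h
    · rw [← h]; simp
    · have hs : (∑ j', q i j') ≠ 0 := fun h0 => by
        have := hκ i j; rw [h0, zero_mul] at this; exact h.ne this
      have hk : κ i j ≠ 0 := fun h0 => by
        have := hκ i j; rw [h0, mul_zero] at this; exact h.ne this
      have : Real.logb 2 (q i j) = Real.logb 2 (∑ j', q i j') + Real.logb 2 (κ i j) := by
        rw [← hκ i j, Real.logb_mul hs hk]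
      rw [this]; ring
  simp_rw [h3, Finset.sum_sub_distrib]
  ring

lemma fin_kl_nonneg {J : Type*} [Fintype J] (κ p : J → ℝ)
    (hκ : ∀ j, 0 ≤ κ j) (hκ1 : ∑ j, κ j = 1)
    (hp : ∀ j, 0 ≤ p j) (hp1 : ∑ j, p j = 1) (hκp : ∀ j, 0 < κ j → 0 < p j) :
    0 ≤ ∑ j, κ j * (Real.logb 2 (κ j) - Real.logb 2 (p j)) := by
  have := fin_info_le (S := Unit) (I := Unit) (T := Unit) (fun _ _ => 1) (fun _ => κ) p
    (fun _ => ()) (by simp) (by simp) (fun _ => hκ) (fun _ => hκ1) hp hp1 (fun _ => hκp)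
    (fun _ _ => 1) (by simp [hκ1]) (fun _ => 1) (by simp) (fun _ => 1) (by simp)
  simpa using this

end FiniteInfo

set_option linter.unusedSectionVars false

section Geometry

variable {X : Type*} [MetricSpace X] [CompactSpace X] [MeasurableSpace X] [BorelSpace X]

instance boxMeasure_finite (d : ℕ) (L : ℝ) : IsFiniteMeasure (boxMeasure d L) := by
  unfold boxMeasure
  refine ⟨?_⟩
  rw [Measure.restrict_apply_univ]
  refine lt_of_le_of_lt (measure_mono (t := Set.Icc (fun _ => 0) (fun _ => L)) ?_)
    (isCompact_Icc.measure_lt_top)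
  intro u hu
  simp only [unitBox, Set.mem_pi, Set.mem_univ, true_implies, Set.mem_Ico] at hu
  exact ⟨fun i => (hu i).1, fun i => (hu i).2.le⟩

lemma boxMeasure_real (d : ℕ) (L : ℝ) (hL : 0 < L) : (boxMeasure d L).real univ = L ^ d := by
  simp only [boxMeasure, Measure.real, Measure.restrict_apply_univ, unitBox]
  rw [Real.volume_pi_Ico]
  · simp [hL.le]

lemma dist_le_diam (x y : X) : dist x y ≤ Metric.diam (univ : Set X) :=
  Metric.dist_le_diam_of_mem isCompact_univ.isBounded (mem_univ x) (mem_univ y)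

lemma integrable_dist_aux {d : ℕ} {L : ℝ} {f g : (Fin d → ℝ) → X}
    (hf : AEStronglyMeasurable f (boxMeasure d L)) (hg : AEStronglyMeasurable g (boxMeasure d L)) :
    Integrable (fun u => dist (f u) (g u)) (boxMeasure d L) := by
  refine Integrable.of_bound (hf.dist hg) (Metric.diam (univ : Set X)) (Eventually.of_forall ?_)
  intro u
  rw [Real.norm_of_nonneg dist_nonneg]
  exact dist_le_diam _ _

lemma orbit_cont {d : ℕ} {T : (Fin d → ℝ) → X → X} (hT : IsContAction d T) (x : X) :
    Continuous (fun u => T u x) :=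
  hT.1.comp (by fun_prop : Continuous (fun u : Fin d → ℝ => (u, x)))

lemma orbit_meas {d : ℕ} {T : (Fin d → ℝ) → X → X} (hT : IsContAction d T) (L : ℝ) (x : X) :
    AEStronglyMeasurable (fun u => T u x) (boxMeasure d L) :=
  (orbit_cont hT x).aestronglyMeasurable

/-- Normalised distance between the orbit of `x` and a map `g`. -/
noncomputable def Dst {d : ℕ} (T : (Fin d → ℝ) → X → X) (L : ℝ) (x : X) (g : (Fin d → ℝ) → X) : ℝ :=
  (L ^ d)⁻¹ * ∫ u, dist (T u x) (g u) ∂(boxMeasure d L)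

lemma Dst_nonneg {d : ℕ} (T : (Fin d → ℝ) → X → X) (L : ℝ) (hL : 0 < L) (x : X)
    (g : (Fin d → ℝ) → X) : 0 ≤ Dst T L x g :=
  mul_nonneg (by positivity) (integral_nonneg fun _ => dist_nonneg)

lemma Dst_le {d : ℕ} {T : (Fin d → ℝ) → X → X} (hT : IsContAction d T) (L : ℝ) (hL : 0 < L)
    (x : X) (g : (Fin d → ℝ) → X) (hg : AEStronglyMeasurable g (boxMeasure d L)) :
    Dst T L x g ≤ Metric.diam (univ : Set X) := by
  unfold Dst
  rw [inv_mul_le_iff₀ (by positivity)]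
  calc _ ≤ ∫ u, Metric.diam (univ : Set X) ∂(boxMeasure d L) :=
        integral_mono (integrable_dist_aux (orbit_meas hT L x) hg) (integrable_const _)
          (fun u => dist_le_diam _ _)
    _ = _ := by rw [integral_const, smul_eq_mul, boxMeasure_real d L hL]

lemma Dst_triangle_left {d : ℕ} {T : (Fin d → ℝ) → X → X} (hT : IsContAction d T) (L : ℝ)
    (hL : 0 < L) (x z : X) (g : (Fin d → ℝ) → X) (hg : AEStronglyMeasurable g (boxMeasure d L)) :
    Dst T L x g ≤ Dst T L x (fun u => T u z) + Dst T L z g := by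
  unfold Dst
  rw [← mul_add]
  refine mul_le_mul_of_nonneg_left ?_ (by positivity)
  rw [← integral_add (integrable_dist_aux (orbit_meas hT L x) (orbit_meas hT L z))
    (integrable_dist_aux (orbit_meas hT L z) hg)]
  exact integral_mono (integrable_dist_aux (orbit_meas hT L x) hg)
    ((integrable_dist_aux (orbit_meas hT L x) (orbit_meas hT L z)).add
    (integrable_dist_aux (orbit_meas hT L z) hg)) (fun u => dist_triangle _ _ _)

lemma Dst_symm {d : ℕ} (T : (Fin d → ℝ) → X → X) (L : ℝ) (x z : X) :
    Dst T L x (fun u => T u z) = Dst T L z (fun u => T u x) := by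
  simp only [Dst, dist_comm]

lemma Dst_triangle_right {d : ℕ} {T : (Fin d → ℝ) → X → X} (hT : IsContAction d T) (L : ℝ)
    (hL : 0 < L) (x : X) (f g : L1Maps d L X) :
    Dst T L x f ≤ Dst T L x g + (L ^ d)⁻¹ * L1dist g f := by
  unfold Dst L1dist
  rw [← mul_add]
  refine mul_le_mul_of_nonneg_left ?_ (by positivity)
  have h1 := integrable_dist_aux (orbit_meas hT L x) g.aestronglyMeasurable
  have h2 := integrable_dist_aux g.aestronglyMeasurable f.aestronglyMeasurable
  rw [← integral_add h1 h2]
  exact integral_mono (integrable_dist_aux (orbit_meas hT L x) f.aestronglyMeasurable)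
    (h1.add h2) (fun u => dist_triangle _ _ _)

lemma Dst_continuous {d : ℕ} {T : (Fin d → ℝ) → X → X} (hT : IsContAction d T) (L : ℝ)
    (g : (Fin d → ℝ) → X) (hg : AEStronglyMeasurable g (boxMeasure d L)) :
    Continuous (fun x => Dst T L x g) := by
  unfold Dst
  refine continuous_const.mul ?_
  refine continuous_of_dominated (bound := fun _ => Metric.diam (univ : Set X))
    (fun x => (orbit_meas hT L x).dist hg) (fun x => Eventually.of_forall fun u => ?_)
    (integrable_const _) (Eventually.of_forall fun u => ?_)
  · rw [Real.norm_of_nonneg dist_nonneg]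
    exact dist_le_diam _ _
  · exact (hT.1.comp (by fun_prop : Continuous (fun x : X => (u, x)))).dist continuous_const

lemma measurable_L1dist {d : ℕ} {L : ℝ} (f : L1Maps d L X) :
    Measurable (fun g : L1Maps d L X => L1dist f g) := by
  refine measurable_of_Iio fun r => ?_
  exact MeasurableSpace.measurableSet_generateFrom ⟨f, r, rfl⟩

lemma Dst_measurable {d : ℕ} {T : (Fin d → ℝ) → X → X} (hT : IsContAction d T) (L : ℝ) (x : X) :
    Measurable (fun g : L1Maps d L X => Dst T L x g) := by
  have : (fun g : L1Maps d L X => Dst T L x g)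
      = fun g => (L ^ d)⁻¹ * L1dist (AEEqFun.mk (fun u => T u x) (orbit_meas hT L x)) g := by
    funext g
    unfold Dst L1dist
    congr 1
    refine integral_congr_ae ?_
    filter_upwards [AEEqFun.coeFn_mk (fun u => T u x) (orbit_meas hT L x)] with u hu
    rw [hu]
  rw [this]
  exact (measurable_L1dist _).const_mul _

lemma Dst_measurable_joint {d : ℕ} {T : (Fin d → ℝ) → X → X} (hT : IsContAction d T) (L : ℝ) :
    Measurable (fun q : X × L1Maps d L X => Dst T L q.1 q.2) := 
  measurable_uncurry_of_continuous_of_measurable (u := fun x (g : L1Maps d L X) => Dst T L x g)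
    (fun g => Dst_continuous hT L g g.aestronglyMeasurable) (fun x => Dst_measurable hT L x)

lemma exists_dense_L1 (d : ℕ) (L : ℝ) [Nonempty X] :
    ∃ f : ℕ → L1Maps d L X, ∀ (g : L1Maps d L X) (η : ℝ), 0 < η → ∃ k, L1dist (f k) g < η := by
  let e : X → C(X, ℝ) := fun x => ⟨fun y => dist x y, by fun_prop⟩
  have he : Isometry e := by
    refine Isometry.of_dist_eq fun x y => ?_
    apply le_antisymm
    · rw [ContinuousMap.dist_le dist_nonneg]
      intro z
      exact abs_dist_sub_le x y z
    · have := ContinuousMap.dist_apply_le_dist (f := e x) (g := e y) y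
      simpa [e, Real.dist_eq] using this
  have hmem : ∀ g : L1Maps d L X, MemLp (fun u => e (g u)) 1 (boxMeasure d L) := by
    intro g
    obtain ⟨C, hC⟩ := (isCompact_range he.continuous).isBounded.exists_norm_le
    exact MemLp.of_bound (he.continuous.comp_aestronglyMeasurable g.aestronglyMeasurable) C
      (Eventually.of_forall fun u => hC _ (mem_range_self _))
  let E : L1Maps d L X → Lp C(X, ℝ) 1 (boxMeasure d L) := fun g => (hmem g).toLp _
  have hE : ∀ f g, dist (E f) (E g) = L1dist f g := by
    intro f g
    rw [L1.dist_eq_integral_dist]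
    unfold L1dist
    refine integral_congr_ae ?_
    filter_upwards [(hmem f).coeFn_toLp, (hmem g).coeFn_toLp] with u h1 h2
    rw [h1, h2, he.dist_eq]
  have : Fact ((1:ℝ≥0∞) ≠ ⊤) := ⟨by simp⟩
  have : Nonempty (L1Maps d L X) := ⟨AEEqFun.const _ (Classical.arbitrary X)⟩
  have : Nonempty (range E) := ⟨⟨E (Classical.arbitrary _), mem_range_self _⟩⟩
  have hdense := TopologicalSpace.denseRange_denseSeq (range E)
  choose f hf using fun k => (TopologicalSpace.denseSeq (range E) k).2
  refine ⟨f, fun g η hη => ?_⟩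
  obtain ⟨k, hk⟩ := hdense.exists_dist_lt (⟨E g, mem_range_self g⟩ : range E) hη
  refine ⟨k, ?_⟩
  rw [← hE, hf, dist_comm]
  exact hk

end Geometry

lemma quant_aux {Y : Type*} [MeasurableSpace Y] (A : ℕ → Set Y) (hA : ∀ k, MeasurableSet (A k))
    (m : ℕ) : ∃ β : Y → Fin (m + 1), Measurable β ∧
      ∀ y, (∃ k < m, y ∈ A k) → y ∈ A (β y) := by
  classical
  have hp : ∀ y, ∃ k, y ∈ A k ∨ m ≤ k := fun y => ⟨m, Or.inr le_rfl⟩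
  have hle : ∀ y, Nat.find (hp y) < m + 1 := fun y =>
    Nat.lt_succ_of_le (Nat.find_min' (hp y) (Or.inr le_rfl))
  have hm : Measurable fun y => Nat.find (hp y) := by
    refine measurable_find hp fun k => ?_
    exact (hA k).union (MeasurableSet.const _)
  refine ⟨fun y => ⟨Nat.find (hp y), hle y⟩, ?_, ?_⟩
  · refine measurable_to_countable' fun i => ?_
    convert hm (measurableSet_singleton (i : ℕ)) using 1
    ext y
    simp [Fin.ext_iff]
  · rintro y ⟨k, hk, hy⟩
    have h1 : Nat.find (hp y) ≤ k := Nat.find_min' (hp y) (Or.inl hy)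
    exact (Nat.find_spec (hp y)).resolve_right (by omega)

lemma sum_restrict_fiber {X : Type*} [MeasurableSpace X] {n : ℕ} (ν : Measure X)
    (α : X → Fin n) (hα : Measurable α) : ∑ i, ν.restrict (α ⁻¹' {i}) = ν := by
  ext A hA
  rw [Measure.finsetSum_apply]
  have : ∀ i, ν.restrict (α ⁻¹' {i}) A = ν.restrict A (α ⁻¹' {i}) := by
    intro i
    rw [Measure.restrict_apply hA, Measure.restrict_apply (hα (measurableSet_singleton i)),
      inter_comm]
  simp_rw [this]
  rw [sum_measure_preimage_singleton _ (fun i _ => hα (measurableSet_singleton i))]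
  simp

lemma lintegral_fiber {X : Type*} [MeasurableSpace X] {n : ℕ} (ν : Measure X)
    (α : X → Fin n) (hα : Measurable α) (f : Fin n → ℝ≥0∞) :
    ∫⁻ x, f (α x) ∂ν = ∑ i, f i * ν (α ⁻¹' {i}) := by
  rw [← lintegral_map (f := f) (by fun_prop) hα, lintegral_fintype]
  refine Finset.sum_congr rfl fun i _ => ?_
  rw [Measure.map_apply hα (measurableSet_singleton i)]

lemma RL_le_of_channel {X : Type*} [MetricSpace X] [CompactSpace X] [MeasurableSpace X]
    [BorelSpace X] (d : ℕ) (T : (Fin d → ℝ) → X → X) (hT : IsContAction d T) (L : ℝ) (hL : 0 < L)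
    {n m : ℕ} (α : X → Fin n) (hα : Measurable α) (κ : Fin n → Fin m → ℝ) (p : Fin m → ℝ)
    (hκ : ∀ i j, 0 ≤ κ i j) (hκ1 : ∀ i, ∑ j, κ i j = 1)
    (hp : ∀ j, 0 ≤ p j) (hp1 : ∑ j, p j = 1) (hκp : ∀ i j, 0 < κ i j → 0 < p j)
    (y : Fin m → L1Maps d L X) (c : Fin n → ℝ)
    (hc : ∀ x, ∑ j, κ (α x) j * Dst T L x (y j) ≤ c (α x))
    (ν : Measure X) [IsProbabilityMeasure ν] (ε' : ℝ)
    (hε' : ∫⁻ x, ENNReal.ofReal (c (α x)) ∂ν < ENNReal.ofReal ε') :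
    RL d T ν L ε' ≤ ∫⁻ x, ENNReal.ofReal
      (∑ j, κ (α x) j * (Real.logb 2 (κ (α x) j) - Real.logb 2 (p j))) ∂ν := by
  have : Nonempty X := by
    by_contra h
    rw [not_nonempty_iff] at h
    have h1 : ν univ = 1 := measure_univ
    rw [univ_eq_empty_iff.2 h] at h1
    simp at h1
  obtain ⟨e, he⟩ := exists_measurableEmbedding_real X
  have hinv : ∀ x, he.invFun (e x) = x := he.leftInverse_invFun
  set P : Measure (ℝ × Fin m) := ∑ i, ∑ j, ENNReal.ofReal (κ i j) •
    (ν.restrict (α ⁻¹' {i})).map (fun x => (e x, j)) with hP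
  have hej : ∀ j : Fin m, Measurable (fun x => (e x, j)) := fun j => he.measurable.prodMk measurable_const
  have hPa : ∀ S, MeasurableSet S → P S = ∑ i, ∑ j, ENNReal.ofReal (κ i j) *
      ν ((fun x => (e x, j)) ⁻¹' S ∩ α ⁻¹' {i}) := by
    intro S hS
    simp only [hP, Measure.finsetSum_apply, Measure.smul_apply, smul_eq_mul]
    refine Finset.sum_congr rfl fun i _ => Finset.sum_congr rfl fun j _ => ?_
    rw [Measure.map_apply (hej j) hS, Measure.restrict_apply (hej j hS)]
  set Xv : ℝ × Fin m → X := fun ω => he.invFun ω.1 with hXv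
  set Yv : ℝ × Fin m → L1Maps d L X := fun ω => y ω.2 with hYv
  have hXm : Measurable Xv := he.measurable_invFun.comp measurable_fst
  have hYm : Measurable Yv := (measurable_from_top (f := y)).comp measurable_snd
  have hκE : ∀ i, ∑ j, ENNReal.ofReal (κ i j) = 1 := by
    intro i
    rw [← ENNReal.ofReal_sum_of_nonneg (fun j _ => hκ i j), hκ1, ENNReal.ofReal_one]
  have hmarg : ∀ A, MeasurableSet A → P (Xv ⁻¹' A) = ν A := by
    intro A hA
    rw [hPa _ (hXm hA)]
    have h1 : ∀ j : Fin m, (fun x => (e x, j)) ⁻¹' (Xv ⁻¹' A) = A := by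
      intro j; ext x; simp [hXv, hinv]
    simp_rw [h1, ← Finset.sum_mul, hκE, one_mul]
    conv_rhs => rw [← sum_restrict_fiber ν α hα]
    rw [Measure.finsetSum_apply]
    refine Finset.sum_congr rfl fun i _ => ?_
    rw [Measure.restrict_apply hA]
  have hPprob : IsProbabilityMeasure P := ⟨by
    have := hmarg univ MeasurableSet.univ
    simpa using this⟩
  have hmap : Measure.map Xv P = ν := by
    ext A hA
    rw [Measure.map_apply hXm hA, hmarg A hA]
  have hdist : distortion d T L P Xv Yv < ε' := by
    have h0 : distortion d T L P Xv Yv = ∫ ω, Dst T L (Xv ω) (Yv ω) ∂P := rfl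
    have hmD : Measurable (fun ω => Dst T L (Xv ω) (Yv ω)) :=
      (Dst_measurable_joint hT L).comp (hXm.prodMk hYm)
    rw [h0, integral_eq_lintegral_of_nonneg_ae (Eventually.of_forall fun ω => Dst_nonneg T L hL _ _)
      hmD.aestronglyMeasurable]
    apply ENNReal.toReal_lt_of_lt_ofReal
    refine lt_of_le_of_lt ?_ hε'
    conv_rhs => rw [← sum_restrict_fiber ν α hα]
    simp only [hP, lintegral_finsetSum_measure, lintegral_smul_measure, smul_eq_mul]
    refine Finset.sum_le_sum fun i _ => ?_
    have h1 : ∀ j, ∫⁻ ω, ENNReal.ofReal (Dst T L (Xv ω) (Yv ω))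
        ∂((ν.restrict (α ⁻¹' {i})).map (fun x => (e x, j)))
        = ∫⁻ x in α ⁻¹' {i}, ENNReal.ofReal (Dst T L x (y j)) ∂ν := by
      intro j
      rw [lintegral_map hmD.ennreal_ofReal (hej j)]
      simp only [hXv, hYv, hinv]
    simp_rw [h1]
    have hm1 : ∀ j, Measurable (fun x => ENNReal.ofReal (Dst T L x (y j))) := fun j =>
      (Dst_continuous hT L (y j) (y j).aestronglyMeasurable).measurable.ennreal_ofReal
    simp_rw [← fun j => lintegral_const_mul (μ := ν.restrict (α ⁻¹' {i}))
      (ENNReal.ofReal (κ i j)) (hm1 j)]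
    rw [← lintegral_finsetSum _ (fun j _ => (hm1 j).const_mul _)]
    refine setLIntegral_mono_ae (by fun_prop) (Eventually.of_forall fun x hx => ?_)
    have hxi : α x = i := hx
    simp_rw [← ENNReal.ofReal_mul (hκ _ _)]
    rw [← ENNReal.ofReal_sum_of_nonneg
      (fun j _ => mul_nonneg (hκ _ _) (Dst_nonneg T L hL _ _)), ← hxi]
    exact ENNReal.ofReal_le_ofReal (hc x)
  have hRL : RL d T ν L ε' ≤ mutualInfo P Xv Yv := by
    unfold RL
    exact iInf_le_of_le (ℝ × Fin m) <| iInf_le_of_le inferInstance <| iInf_le_of_le P <|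
      iInf_le_of_le hPprob <| iInf_le_of_le Xv <| iInf_le_of_le Yv <| iInf_le_of_le hXm <|
      iInf_le_of_le hYm <| iInf_le_of_le hmap <| iInf_le_of_le hdist le_rfl
  refine hRL.trans ?_
  unfold mutualInfo
  refine iSup_le fun n' => iSup_le fun m' => iSup_le fun a => iSup_le fun ha => iSup_le fun b =>
    iSup_le fun hb => ?_
  have hkl : ∀ i, 0 ≤ ∑ j, κ i j * (Real.logb 2 (κ i j) - Real.logb 2 (p j)) := fun i =>
    fin_kl_nonneg (κ i) p (hκ i) (hκ1 i) hp hp1 (hκp i)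
  rw [lintegral_fiber ν α hα (fun i => ENNReal.ofReal
    (∑ j, κ i j * (Real.logb 2 (κ i j) - Real.logb 2 (p j))))]
  have hrw : ∑ i, ENNReal.ofReal (∑ j, κ i j * (Real.logb 2 (κ i j) - Real.logb 2 (p j)))
      * ν (α ⁻¹' {i}) = ENNReal.ofReal (∑ i, ν.real (α ⁻¹' {i}) *
        ∑ j, κ i j * (Real.logb 2 (κ i j) - Real.logb 2 (p j))) := by
    rw [ENNReal.ofReal_sum_of_nonneg (fun i _ => mul_nonneg measureReal_nonneg (hkl i))]
    refine Finset.sum_congr rfl fun i _ => ?_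
    rw [ENNReal.ofReal_mul measureReal_nonneg, ofReal_measureReal, mul_comm]
  rw [hrw]
  apply ENNReal.ofReal_le_ofReal
  set w : Fin n' → Fin n → ℝ := fun s i => ν.real (a ⁻¹' {s} ∩ α ⁻¹' {i}) with hw
  have hwsum : ∀ i, ∑ s, w s i = ν.real (α ⁻¹' {i}) := by
    intro i
    have h1 := sum_measureReal_preimage_singleton (μ := ν.restrict (α ⁻¹' {i})) Finset.univ
      (f := a) (fun s _ => ha (measurableSet_singleton s))
    simp only [Finset.coe_univ, preimage_univ, measureReal_restrict_apply_univ] at h1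
    rw [← h1]
    refine Finset.sum_congr rfl fun s _ => ?_
    rw [measureReal_restrict_apply (ha (measurableSet_singleton s))]
  have hwsum' : ∀ s, ∑ i, w s i = ν.real (a ⁻¹' {s}) := by
    intro s
    have h1 := sum_measureReal_preimage_singleton (μ := ν.restrict (a ⁻¹' {s})) Finset.univ
      (f := α) (fun s _ => hα (measurableSet_singleton s))
    simp only [Finset.coe_univ, preimage_univ, measureReal_restrict_apply_univ] at h1
    rw [← h1]
    refine Finset.sum_congr rfl fun i _ => ?_
    rw [measureReal_restrict_apply (hα (measurableSet_singleton i)), inter_comm]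
  have hw1 : ∑ s, ∑ i, w s i = 1 := by
    simp_rw [hwsum']
    rw [sum_measureReal_preimage_singleton _ (fun s _ => ha (measurableSet_singleton s))]
    simp
  set r : Fin n' → Fin m' → ℝ := fun s t => P.real ((fun ω => (a (Xv ω), b (Yv ω))) ⁻¹' {(s, t)})
    with hr
  have haX : Measurable (fun ω => a (Xv ω)) := ha.comp hXm
  have hbY : Measurable (fun ω => b (Yv ω)) := hb.comp hYm
  have hr' : ∀ s t, r s t = ∑ i, ∑ j, if b (y j) = t then w s i * κ i j else 0 := by
    intro s t
    simp only [hr, measureReal_def]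
    rw [hPa _ ((haX.prodMk hbY) (measurableSet_singleton _)), ENNReal.toReal_sum]
    · refine Finset.sum_congr rfl fun i _ => ?_
      rw [ENNReal.toReal_sum]
      · refine Finset.sum_congr rfl fun j _ => ?_
        rw [ENNReal.toReal_mul, ENNReal.toReal_ofReal (hκ i j)]
        split_ifs with h
        · have : (fun x => (e x, j)) ⁻¹' ((fun ω => (a (Xv ω), b (Yv ω))) ⁻¹' {(s, t)})
              = a ⁻¹' {s} := by
            ext x; simp [hXv, hYv, hinv, h]
          rw [this, mul_comm]
          rfl
        · have : (fun x => (e x, j)) ⁻¹' ((fun ω => (a (Xv ω), b (Yv ω))) ⁻¹' {(s, t)}) = ∅ := by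
            ext x; simp [hYv, h]
          rw [this]; simp
      · intro j _; exact ENNReal.mul_ne_top ENNReal.ofReal_ne_top (measure_ne_top _ _)
    · intro i _
      refine ENNReal.sum_ne_top.2 fun j _ => ?_
      exact ENNReal.mul_ne_top ENNReal.ofReal_ne_top (measure_ne_top _ _)
  have hmain := fin_info_le w κ p (fun j => b (y j)) (fun _ _ => measureReal_nonneg) hw1 hκ hκ1 hp
    hp1 hκp r hr' (fun s => P.real ((fun ω => a (Xv ω)) ⁻¹' {s})) (by
      intro s
      rw [hwsum']
      simp only [measureReal_def]
      rw [← hmarg _ (ha (measurableSet_singleton s))]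
      rfl) (fun t => P.real ((fun ω => b (Yv ω)) ⁻¹' {t})) (by
      intro t
      have h1 := sum_measureReal_preimage_singleton
        (μ := P.restrict ((fun ω => b (Yv ω)) ⁻¹' {t})) Finset.univ
        (f := fun ω => a (Xv ω)) (fun s _ => haX (measurableSet_singleton s))
      simp only [Finset.coe_univ, preimage_univ, measureReal_restrict_apply_univ] at h1
      rw [← h1]
      refine Finset.sum_congr rfl fun s _ => ?_
      rw [measureReal_restrict_apply (haX (measurableSet_singleton s))]
      simp only [hr]
      congr 1
      ext ω
      simp)
  simp_rw [hwsum] at hmain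
  unfold shannonEntropy
  rw [Fintype.sum_prod_type]
  exact hmain

lemma RL_test {X : Type*} [MetricSpace X] [CompactSpace X] [MeasurableSpace X] [BorelSpace X]
    (d : ℕ) (T : (Fin d → ℝ) → X → X) (hT : IsContAction d T) (L : ℝ) (hL : 0 < L)
    (μ : Measure X) [IsProbabilityMeasure μ] (ε : ℝ) (C : ℝ≥0∞) (hC : RL d T μ L ε < C) :
    ∃ c G : X → ℝ≥0∞, Measurable c ∧ Measurable G ∧ ∫⁻ x, c x ∂μ < ENNReal.ofReal ε ∧
      ∫⁻ x, G x ∂μ < C ∧ ∀ (ν : Measure X) (_ : IsProbabilityMeasure ν) (ε' : ℝ),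
        ∫⁻ x, c x ∂ν < ENNReal.ofReal ε' → RL d T ν L ε' ≤ ∫⁻ x, G x ∂ν := by
  have : Nonempty X := by
    by_contra h
    rw [not_nonempty_iff] at h
    have h1 : μ univ = 1 := measure_univ
    rw [univ_eq_empty_iff.2 h] at h1
    simp at h1
  unfold RL at hC
  simp only [iInf_lt_iff] at hC
  obtain ⟨Ω, mΩ, P, hP, Xv, Yv, hX, hY, hmap, hdist, hI⟩ := hC
  have hLd : 0 < L ^ d := pow_pos hL d
  set M := Metric.diam (univ : Set X) with hM
  have hM0 : 0 ≤ M := Metric.diam_nonneg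
  have h0 : distortion d T L P Xv Yv = ∫ ω, Dst T L (Xv ω) (Yv ω) ∂P := rfl
  rw [h0] at hdist
  have hmD : Measurable (fun ω => Dst T L (Xv ω) (Yv ω)) :=
    (Dst_measurable_joint hT L).comp (hX.prodMk hY)
  have hiD : Integrable (fun ω => Dst T L (Xv ω) (Yv ω)) P := by
    refine Integrable.of_bound hmD.aestronglyMeasurable M (Eventually.of_forall fun ω => ?_)
    rw [Real.norm_of_nonneg (Dst_nonneg T L hL _ _)]
    exact Dst_le hT L hL _ _ (Yv ω).aestronglyMeasurable
  set E0 := ∫ ω, Dst T L (Xv ω) (Yv ω) ∂P with hE0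
  have hE00 : 0 ≤ E0 := integral_nonneg fun ω => Dst_nonneg T L hL _ _
  obtain ⟨η, hη, hηε⟩ : ∃ η : ℝ, 0 < η ∧ E0 + 4 * η < ε := ⟨(ε - E0) / 5, by linarith, by linarith⟩
  -- quantisation of X
  set z : ℕ → X := TopologicalSpace.denseSeq X with hz
  have hcontz : ∀ x, Continuous (fun x' => Dst T L x' (fun u => T u x)) := fun x =>
    Dst_continuous hT L _ (orbit_meas hT L x)
  obtain ⟨n, α, hα, hαz⟩ : ∃ (n : ℕ) (α : X → Fin n), Measurable α ∧
      ∀ x, Dst T L x (fun u => T u (z (α x))) < η := by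
    set U : ℕ → Set X := fun k => {x | Dst T L x (fun u => T u (z k)) < η} with hU
    have hUo : ∀ k, IsOpen (U k) := fun k => isOpen_lt (hcontz _) continuous_const
    have hcov : (univ : Set X) ⊆ ⋃ k, U k := by
      intro x _
      have hV : IsOpen {x' | Dst T L x' (fun u => T u x) < η} :=
        isOpen_lt (hcontz _) continuous_const
      obtain ⟨k, hk⟩ := (TopologicalSpace.denseRange_denseSeq X).exists_mem_open hV
        ⟨x, by simp [Dst, hη]⟩
      refine mem_iUnion.2 ⟨k, ?_⟩
      simp only [hU, mem_setOf_eq]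
      rw [Dst_symm]
      exact hk
    obtain ⟨t, ht⟩ := isCompact_univ.elim_finite_subcover U hUo hcov
    obtain ⟨α, hα, hα'⟩ := quant_aux U (fun k => (hUo k).measurableSet) (t.sup id + 1)
    refine ⟨_, α, hα, fun x => hα' x ?_⟩
    have hx := ht (mem_univ x)
    simp only [mem_iUnion, exists_prop] at hx
    obtain ⟨k, hkt, hk⟩ := hx
    exact ⟨k, Nat.lt_succ_of_le (Finset.le_sup (f := id) hkt), hk⟩
  -- quantisation of Y
  obtain ⟨f, hf⟩ := exists_dense_L1 (X := X) d L
  set A : ℕ → Set (L1Maps d L X) := fun k => {g | (L ^ d)⁻¹ * L1dist (f k) g < η} with hA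
  have hAm : ∀ k, MeasurableSet (A k) := fun k =>
    measurableSet_lt ((measurable_L1dist (f k)).const_mul _) measurable_const
  set B : ℕ → Set Ω := fun m => {ω | ∀ k < m, Yv ω ∉ A k} with hB
  have hBm : ∀ m, MeasurableSet (B m) := by
    intro m
    have : B m = ⋂ k, ⋂ (_ : k < m), Yv ⁻¹' (A k)ᶜ := by ext ω; simp [hB]
    rw [this]
    exact MeasurableSet.iInter fun k => MeasurableSet.iInter fun _ => hY (hAm k).compl
  obtain ⟨m0, hm0⟩ : ∃ m, M * P.real (B m) < η := by
    have hanti : Antitone B := fun m m' h ω hω k hk => hω k (hk.trans_le h)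
    have hempty : ⋂ m, B m = ∅ := by
      rw [eq_empty_iff_forall_notMem]
      intro ω hω
      obtain ⟨k, hk⟩ := hf (Yv ω) (L ^ d * η) (by positivity)
      have := mem_iInter.1 hω (k + 1) k (Nat.lt_succ_self k)
      apply this
      simp only [hA, mem_setOf_eq]
      rwa [inv_mul_lt_iff₀ hLd]
    have hlim := tendsto_measure_iInter_atTop (μ := P) (fun m => (hBm m).nullMeasurableSet) hanti
      ⟨0, measure_ne_top _ _⟩
    rw [hempty, measure_empty] at hlim
    have hlim' : Tendsto (fun m => M * P.real (B m)) atTop (𝓝 (M * 0)) := by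
      refine tendsto_const_nhds.mul ?_
      have := (ENNReal.tendsto_toReal (ENNReal.zero_ne_top)).comp hlim
      simpa [measureReal_def, Function.comp_def] using this
    rw [mul_zero] at hlim'
    exact (hlim'.eventually (gt_mem_nhds hη)).exists
  obtain ⟨β, hβ, hβA⟩ := quant_aux A hAm m0
  set y : Fin (m0 + 1) → L1Maps d L X := fun j => f j with hy
  have hαX : Measurable (fun ω => α (Xv ω)) := hα.comp hX
  have hβY : Measurable (fun ω => β (Yv ω)) := hβ.comp hY
  -- joint law
  set q : Fin n → Fin (m0 + 1) → ℝ := fun i j =>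
    P.real ((fun ω => (α (Xv ω), β (Yv ω))) ⁻¹' {(i, j)}) with hq
  have hq0 : ∀ i j, 0 ≤ q i j := fun i j => measureReal_nonneg
  have hqi : ∀ i, ∑ j, q i j = P.real ((fun ω => α (Xv ω)) ⁻¹' {i}) := by
    intro i
    have h1 := sum_measureReal_preimage_singleton
      (μ := P.restrict ((fun ω => α (Xv ω)) ⁻¹' {i})) Finset.univ
      (f := fun ω => β (Yv ω)) (fun s _ => hβY (measurableSet_singleton s))
    simp only [Finset.coe_univ, preimage_univ, measureReal_restrict_apply_univ] at h1
    rw [← h1]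
    refine Finset.sum_congr rfl fun s _ => ?_
    rw [measureReal_restrict_apply (hβY (measurableSet_singleton s))]
    simp only [hq]
    congr 1
    ext ω
    simp [and_comm]
  have hqj : ∀ j, ∑ i, q i j = P.real ((fun ω => β (Yv ω)) ⁻¹' {j}) := by
    intro j
    have h1 := sum_measureReal_preimage_singleton
      (μ := P.restrict ((fun ω => β (Yv ω)) ⁻¹' {j})) Finset.univ
      (f := fun ω => α (Xv ω)) (fun s _ => hαX (measurableSet_singleton s))
    simp only [Finset.coe_univ, preimage_univ, measureReal_restrict_apply_univ] at h1
    rw [← h1]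
    refine Finset.sum_congr rfl fun s _ => ?_
    rw [measureReal_restrict_apply (hαX (measurableSet_singleton s))]
    simp only [hq]
    congr 1
    ext ω
    simp
  have hμi : ∀ i, μ.real (α ⁻¹' {i}) = ∑ j, q i j := by
    intro i
    rw [hqi, ← hmap, map_measureReal_apply hX (hα (measurableSet_singleton i))]
    rfl
  have hp1 : ∑ j, ∑ i, q i j = 1 := by
    simp_rw [hqj]
    rw [sum_measureReal_preimage_singleton _ (fun s _ => hβY (measurableSet_singleton s))]
    simp
  have hq1 : ∑ i, ∑ j, q i j = 1 := by rw [Finset.sum_comm]; exact hp1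
  have hp0 : ∀ j, 0 ≤ ∑ i, q i j := fun j => Finset.sum_nonneg fun i _ => hq0 i j
  have hs0 : ∀ i, 0 ≤ ∑ j, q i j := fun i => Finset.sum_nonneg fun j _ => hq0 i j
  set κ : Fin n → Fin (m0 + 1) → ℝ := fun i j =>
    if ∑ j', q i j' = 0 then ∑ i', q i' j else q i j / ∑ j', q i j' with hκ
  have hκ0 : ∀ i j, 0 ≤ κ i j := by
    intro i j
    simp only [hκ]
    split_ifs
    · exact hp0 j
    · exact div_nonneg (hq0 i j) (hs0 i)
  have hκ1 : ∀ i, ∑ j, κ i j = 1 := by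
    intro i
    simp only [hκ]
    split_ifs with h
    · exact hp1
    · rw [← Finset.sum_div, div_self h]
  have hκp : ∀ i j, 0 < κ i j → 0 < ∑ i', q i' j := by
    intro i j h
    simp only [hκ] at h
    split_ifs at h with h'
    · exact h
    · have : 0 < q i j := by
        refine lt_of_le_of_ne (hq0 i j) fun h'' => ?_
        rw [← h'', zero_div] at h
        exact lt_irrefl _ h
      exact lt_of_lt_of_le this
        (Finset.single_le_sum (f := fun i' => q i' j) (fun i' _ => hq0 i' j) (Finset.mem_univ i))
  have hκq : ∀ i j, (∑ j', q i j') * κ i j = q i j := by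
    intro i j
    simp only [hκ]
    split_ifs with h
    · rw [h, zero_mul]
      exact ((Finset.sum_eq_zero_iff_of_nonneg (fun j _ => hq0 i j)).1 h j (Finset.mem_univ j)).symm
    · rw [mul_div_cancel₀ _ h]
  set c : Fin n → ℝ := fun i => ∑ j, κ i j * Dst T L (z i) (y j) + η with hcdef
  have hc0 : ∀ i, 0 ≤ c i := fun i => add_nonneg (Finset.sum_nonneg fun j _ =>
    mul_nonneg (hκ0 i j) (Dst_nonneg T L hL _ _)) hη.le
  have hc : ∀ x, ∑ j, κ (α x) j * Dst T L x (y j) ≤ c (α x) := by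
    intro x
    calc ∑ j, κ (α x) j * Dst T L x (y j)
        ≤ ∑ j, κ (α x) j * (η + Dst T L (z (α x)) (y j)) := by
          refine Finset.sum_le_sum fun j _ => mul_le_mul_of_nonneg_left ?_ (hκ0 _ _)
          refine (Dst_triangle_left hT L hL x (z (α x)) (y j) (y j).aestronglyMeasurable).trans ?_
          have := (hαz x).le
          linarith
      _ = c (α x) := by
          simp only [mul_add, Finset.sum_add_distrib, ← Finset.sum_mul, hκ1, one_mul, hcdef]
          ring
  -- expected cost
  have hcost : ∑ i, ∑ j, q i j * Dst T L (z i) (y j) ≤ E0 + 3 * η := by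
    have h1 : ∑ i, ∑ j, q i j * Dst T L (z i) (y j)
        = ∫ ω, Dst T L (z (α (Xv ω))) (y (β (Yv ω))) ∂P := by
      have hpair : Measurable (fun ω => (α (Xv ω), β (Yv ω))) := hαX.prodMk hβY
      have h2 := integral_map (μ := P) hpair.aemeasurable
        (f := fun ij : Fin n × Fin (m0 + 1) => Dst T L (z ij.1) (y ij.2))
        (measurable_of_finite _).aestronglyMeasurable
      rw [← h2, integral_fintype Integrable.of_finite, Fintype.sum_prod_type]
      refine Finset.sum_congr rfl fun i _ => Finset.sum_congr rfl fun j _ => ?_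
      rw [map_measureReal_apply hpair (measurableSet_singleton _), smul_eq_mul]
    rw [h1]
    have hbound : ∀ ω, Dst T L (z (α (Xv ω))) (y (β (Yv ω)))
        ≤ Dst T L (Xv ω) (Yv ω) + 2 * η + (B m0).indicator (fun _ => M) ω := by
      intro ω
      by_cases hω : ω ∈ B m0
      · rw [indicator_of_mem hω]
        have h3 := Dst_le hT L hL (z (α (Xv ω))) (y (β (Yv ω))) (y (β (Yv ω))).aestronglyMeasurable
        have h4 := Dst_nonneg T L hL (Xv ω) (Yv ω)
        linarith
      · rw [indicator_of_notMem hω]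
        simp only [hB, mem_setOf_eq, not_forall, not_not] at hω
        obtain ⟨k, hk, hkA⟩ := hω
        have h3 : (L ^ d)⁻¹ * L1dist (f (β (Yv ω))) (Yv ω) < η := hβA _ ⟨k, hk, hkA⟩
        have h4 := Dst_triangle_left hT L hL (z (α (Xv ω))) (Xv ω) (y (β (Yv ω)))
          (y (β (Yv ω))).aestronglyMeasurable
        rw [Dst_symm] at h4
        have h5 := hαz (Xv ω)
        have h6 := Dst_triangle_right hT L hL (Xv ω) (y (β (Yv ω))) (Yv ω)
        have h7 : L1dist (Yv ω) (y (β (Yv ω))) = L1dist (f (β (Yv ω))) (Yv ω) := by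
          simp only [L1dist, hy, dist_comm]
        rw [h7] at h6
        linarith
    have hi2 : Integrable (fun ω => Dst T L (Xv ω) (Yv ω) + 2 * η) P :=
      hiD.add (integrable_const _)
    have hi3 : Integrable ((B m0).indicator (fun _ => M)) P :=
      (integrable_const M).indicator (hBm m0)
    calc _ ≤ ∫ ω, (Dst T L (Xv ω) (Yv ω) + 2 * η + (B m0).indicator (fun _ => M) ω) ∂P := by
          refine integral_mono_of_nonneg (Eventually.of_forall fun ω => Dst_nonneg T L hL _ _)
            (hi2.add hi3) (Eventually.of_forall hbound)
      _ = E0 + 2 * η + M * P.real (B m0) := by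
          rw [integral_add hi2 hi3, integral_add hiD (integrable_const _), integral_const,
            integral_indicator_const _ (hBm m0)]
          simp [hE0, mul_comm]
      _ ≤ _ := by linarith
  refine ⟨fun x => ENNReal.ofReal (c (α x)), fun x => ENNReal.ofReal
      (∑ j, κ (α x) j * (Real.logb 2 (κ (α x) j) - Real.logb 2 (∑ i', q i' j))),
    (measurable_of_finite (fun i => ENNReal.ofReal (c i))).comp hα,
    (measurable_of_finite (fun i => ENNReal.ofReal
      (∑ j, κ i j * (Real.logb 2 (κ i j) - Real.logb 2 (∑ i', q i' j))))).comp hα, ?_, ?_, ?_⟩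
  · rw [lintegral_fiber μ α hα (fun i => ENNReal.ofReal (c i))]
    have h1 : ∑ i, ENNReal.ofReal (c i) * μ (α ⁻¹' {i})
        = ENNReal.ofReal (∑ i, (∑ j, q i j) * c i) := by
      rw [ENNReal.ofReal_sum_of_nonneg (fun i _ => mul_nonneg (hs0 i) (hc0 i))]
      refine Finset.sum_congr rfl fun i _ => ?_
      rw [ENNReal.ofReal_mul (hs0 i), ← hμi, ofReal_measureReal, mul_comm]
    rw [h1]
    apply (ENNReal.ofReal_lt_ofReal_iff (by linarith)).2
    have h2 : ∑ i, (∑ j, q i j) * c i = ∑ i, ∑ j, q i j * Dst T L (z i) (y j) + η := by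
      simp only [hcdef, mul_add, Finset.sum_add_distrib]
      rw [← Finset.sum_mul, hq1, one_mul]
      congr 1
      refine Finset.sum_congr rfl fun i _ => ?_
      rw [Finset.mul_sum]
      refine Finset.sum_congr rfl fun j _ => ?_
      rw [← mul_assoc, hκq]
    rw [h2]
    linarith
  · refine lt_of_le_of_lt ?_ hI
    rw [lintegral_fiber μ α hα (fun i => ENNReal.ofReal
      (∑ j, κ i j * (Real.logb 2 (κ i j) - Real.logb 2 (∑ i', q i' j))))]
    have hkl : ∀ i, 0 ≤ ∑ j, κ i j * (Real.logb 2 (κ i j) - Real.logb 2 (∑ i', q i' j)) :=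
      fun i => fin_kl_nonneg (κ i) _ (hκ0 i) (hκ1 i) hp0 hp1 (hκp i)
    have h1 : ∑ i, ENNReal.ofReal
        (∑ j, κ i j * (Real.logb 2 (κ i j) - Real.logb 2 (∑ i', q i' j))) * μ (α ⁻¹' {i})
        = ENNReal.ofReal (∑ i, (∑ j, q i j) *
          ∑ j, κ i j * (Real.logb 2 (κ i j) - Real.logb 2 (∑ i', q i' j))) := by
      rw [ENNReal.ofReal_sum_of_nonneg (fun i _ => mul_nonneg (hs0 i) (hkl i))]
      refine Finset.sum_congr rfl fun i _ => ?_
      rw [ENNReal.ofReal_mul (hs0 i), ← hμi, ofReal_measureReal, mul_comm]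
    rw [h1, fin_info_eq q hq0 κ hκq]
    unfold mutualInfo
    refine le_iSup_of_le n <| le_iSup_of_le (m0 + 1) <| le_iSup_of_le α <| le_iSup_of_le hα <|
      le_iSup_of_le β <| le_iSup_of_le hβ ?_
    apply ENNReal.ofReal_le_ofReal
    apply le_of_eq
    unfold shannonEntropy
    rw [Fintype.sum_prod_type]
    simp only [hqi, hqj]
    rfl
  · intro ν hν ε' hε'
    exact RL_le_of_channel d T hT L hL α hα κ _ hκ0 hκ1 hp0 hp1 hκp y c hc ν ε' hε'

lemma RD_test {X : Type*} [MetricSpace X] [CompactSpace X] [MeasurableSpace X] [BorelSpace X]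
    (d : ℕ) (T : (Fin d → ℝ) → X → X) (hT : IsContAction d T)
    (μ : Measure X) [IsProbabilityMeasure μ] (ε : ℝ) (C : ℝ≥0∞) (hC : RD d T μ ε < C) :
    ∃ c G : X → ℝ≥0∞, Measurable c ∧ Measurable G ∧ ∫⁻ x, c x ∂μ < ENNReal.ofReal ε ∧
      ∫⁻ x, G x ∂μ < C ∧ ∀ (ν : Measure X) (_ : IsProbabilityMeasure ν) (ε' : ℝ),
        ∫⁻ x, c x ∂ν < ENNReal.ofReal ε' → RD d T ν ε' ≤ ∫⁻ x, G x ∂ν := by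
  unfold RD at hC
  simp only [iInf_lt_iff] at hC
  obtain ⟨L, hL, hC⟩ := hC
  have hLd : 0 < L ^ d := pow_pos hL d
  have h0 : ENNReal.ofReal (L ^ d) ≠ 0 := by simpa using hLd
  have h1 : ENNReal.ofReal (L ^ d) ≠ ⊤ := ENNReal.ofReal_ne_top
  rw [ENNReal.div_lt_iff (Or.inl h0) (Or.inl h1)] at hC
  obtain ⟨c, G, hc, hG, hcμ, hGμ, h⟩ := RL_test d T hT L hL μ ε _ hC
  refine ⟨c, fun x => G x / ENNReal.ofReal (L ^ d), hc, hG.div_const _, hcμ, ?_, ?_⟩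
  · simp only [div_eq_mul_inv]
    rw [lintegral_mul_const _ hG, ← div_eq_mul_inv,
      ENNReal.div_lt_iff (Or.inl h0) (Or.inl h1)]
    exact hGμ
  · intro ν hν ε' hε'
    simp only [div_eq_mul_inv]
    rw [lintegral_mul_const _ hG, ← div_eq_mul_inv]
    refine (iInf₂_le L hL).trans ?_
    gcongr
    exact h ν hν ε' hε'

lemma liminf_aux {f : ℝ → ℝ≥0∞} {u : ℕ → ℝ} (hu : Tendsto u atTop (𝓝[>] 0)) :
    liminf f (𝓝[>] 0) ≤ liminf (fun n => f (u n)) atTop := by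
  exact liminf_le_liminf_of_le hu

lemma lintegral_div_aux {α : Type*} [MeasurableSpace α] {m : Measure α} (f : α → ℝ≥0∞) (K : ℝ≥0∞)
    (hf : Measurable f) : ∫⁻ a, f a / K ∂m = (∫⁻ a, f a ∂m) / K := by
  simp only [div_eq_mul_inv]
  rw [lintegral_mul_const _ hf]

/-- Theorem 1.2: concavity of the lower rate distortion dimension under convex combination
(barycenter) of invariant measures. -/
theorem lintegral_le_lrdim_of_barycenter
    {X : Type*} [MetricSpace X] [CompactSpace X] [MeasurableSpace X] [BorelSpace X]
    (d : ℕ) (hd : 0 < d) (T : (Fin d → ℝ) → X → X) (hT : IsContAction d T)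
    (lam : Measure (InvM X d T)) [IsProbabilityMeasure lam]
    (μ : Measure X) [IsProbabilityMeasure μ] (hμinv : MeasInvariant d T μ)
    (hbar : ∀ A : Set X, MeasurableSet A → μ A = ∫⁻ ν, (ν.1 : Measure X) A ∂lam) :
    (∫⁻ ν, lrdim d T (ν.1 : Measure X) ∂lam) ≤ lrdim d T μ := by
  -- barycenter as a bind
  have hmeas : Measurable (fun ν : InvM X d T => (ν.1 : Measure X)) :=
    measurable_subtype_coe.comp measurable_subtype_coe
  have hbind : μ = lam.bind (fun ν : InvM X d T => (ν.1 : Measure X)) := by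
    ext A hA
    rw [hbar A hA, Measure.bind_apply hA hmeas.aemeasurable]
  have hlint : ∀ f : X → ℝ≥0∞, Measurable f →
      ∫⁻ x, f x ∂μ = ∫⁻ ν, ∫⁻ x, f x ∂(ν.1 : Measure X) ∂lam := by
    intro f hf
    conv_lhs => rw [hbind]
    exact Measure.lintegral_bind hmeas.aemeasurable hf.aemeasurable
  have hintm : ∀ f : X → ℝ≥0∞, Measurable f →
      Measurable (fun ν : InvM X d T => ∫⁻ x, f x ∂(ν.1 : Measure X)) := fun f hf =>
    (Measure.measurable_lintegral hf).comp hmeas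
  rcases eq_or_ne (lrdim d T μ) ⊤ with htop | htop
  · rw [htop]; exact le_top
  set ell := lrdim d T μ with hell
  -- choice of scales
  have hex : ∀ n : ℕ, ∃ ε : ℝ, 0 < ε ∧ ε < (2:ℝ)⁻¹ ^ ((n + 2) ^ 2) ∧
      RD d T μ ε < (ell + (n + 1 : ℝ≥0∞)⁻¹) * ENNReal.ofReal (Real.logb 2 (1 / ε)) := by
    intro n
    have hlt : ell < ell + (n + 1 : ℝ≥0∞)⁻¹ :=
      ENNReal.lt_add_right htop (by simp)
    have hfr := frequently_lt_of_liminf_lt (f := 𝓝[>] (0:ℝ)) (by isBoundedDefault) hlt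
    have hev : ∀ᶠ ε : ℝ in 𝓝[>] 0, ε ∈ Ioo (0:ℝ) ((2:ℝ)⁻¹ ^ ((n + 2) ^ 2)) :=
      Ioo_mem_nhdsGT (by positivity)
    obtain ⟨ε, h1, h2⟩ := (hfr.and_eventually hev).exists
    refine ⟨ε, h2.1, h2.2, ?_⟩
    have hlog : 0 < Real.logb 2 (1 / ε) := by
      apply Real.logb_pos (by norm_num)
      rw [lt_div_iff₀ h2.1, one_mul]
      exact h2.2.trans_le (pow_le_one₀ (by norm_num) (by norm_num))
    rwa [ENNReal.div_lt_iff (Or.inl (by simpa using hlog)) (Or.inl ENNReal.ofReal_ne_top)] at h1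
  choose ε hε0 hεlt hε using hex
  have htest := fun n => RD_test d T hT μ (ε n) _ (hε n)
  choose c G hc hG hcμ hGμ hcG using htest
  set ε' : ℕ → ℝ := fun n => 2 ^ n * ε n with hε'
  have hε'0 : ∀ n, 0 < ε' n := fun n => by have := hε0 n; positivity
  -- logs
  have hlog1 : ∀ n : ℕ, ((n:ℝ) + 2) ^ 2 ≤ Real.logb 2 (1 / ε n) := by
    intro n
    have h1 : (2:ℝ) ^ (((n + 2) ^ 2 : ℕ) : ℝ) ≤ 1 / ε n := by
      rw [le_div_iff₀ (hε0 n), Real.rpow_natCast]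
      calc _ ≤ (2:ℝ) ^ ((n + 2) ^ 2) * (2:ℝ)⁻¹ ^ ((n + 2) ^ 2) := by
            gcongr; exact (hεlt n).le
        _ = 1 := by rw [← mul_pow]; norm_num
    have := (Real.le_logb_iff_rpow_le (by norm_num : (1:ℝ) < 2)
      (by have := hε0 n; positivity)).2 h1
    push_cast at this
    exact this
  have hlog2 : ∀ n, Real.logb 2 (1 / ε' n) = Real.logb 2 (1 / ε n) - n := by
    intro n
    have : 1 / ε' n = (1 / ε n) / (2:ℝ) ^ (n:ℝ) := by
      rw [Real.rpow_natCast]; simp only [hε']; rw [div_div, mul_comm]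
    rw [this, Real.logb_div (by have := hε0 n; positivity) (by positivity),
      Real.logb_rpow (by norm_num) (by norm_num)]
  have hε'lim : Tendsto ε' atTop (𝓝[>] 0) := by
    refine tendsto_nhdsWithin_iff.2 ⟨?_, Eventually.of_forall hε'0⟩
    refine squeeze_zero (g := fun n : ℕ => (2:ℝ)⁻¹ ^ n) (fun n => (hε'0 n).le) (fun n => ?_)
      (tendsto_pow_atTop_nhds_zero_of_lt_one (by norm_num) (by norm_num))
    calc ε' n ≤ 2 ^ n * (2:ℝ)⁻¹ ^ ((n + 2) ^ 2) := by
          simp only [hε']; gcongr; exact (hεlt n).le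
      _ ≤ 2 ^ n * (2:ℝ)⁻¹ ^ (n + n) := by
          gcongr 2 ^ n * ?_
          exact pow_le_pow_of_le_one (by norm_num) (by norm_num) (by nlinarith)
      _ = (2:ℝ)⁻¹ ^ n := by
          rw [pow_add, ← mul_assoc, ← mul_pow]; norm_num
  -- Borel-Cantelli
  have hBC : ∀ᵐ ν ∂lam, ∀ᶠ n in atTop,
      ∫⁻ x, c n x ∂(ν.1 : Measure X) < ENNReal.ofReal (ε' n) := by
    have hb : ∀ n, lam {ν | ENNReal.ofReal (ε' n) ≤ ∫⁻ x, c n x ∂(ν.1 : Measure X)}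
        ≤ (2:ℝ≥0∞)⁻¹ ^ n := by
      intro n
      have h1 := mul_meas_ge_le_lintegral₀ (μ := lam) (hintm _ (hc n)).aemeasurable
        (ENNReal.ofReal (ε' n))
      rw [← hlint _ (hc n)] at h1
      have h2 := h1.trans (hcμ n).le
      have h3 : ENNReal.ofReal (ε' n) = 2 ^ n * ENNReal.ofReal (ε n) := by
        simp only [hε']
        rw [ENNReal.ofReal_mul (by positivity), ENNReal.ofReal_pow (by norm_num)]
        simp
      set A := lam {ν | ENNReal.ofReal (ε' n) ≤ ∫⁻ x, c n x ∂(ν.1 : Measure X)}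
      rw [h3] at h2
      have hne : ENNReal.ofReal (ε n) ≠ 0 := by simpa using hε0 n
      rw [mul_comm (2 ^ n) _, mul_assoc] at h2
      have h4 : ENNReal.ofReal (ε n) * (2 ^ n * A) ≤ ENNReal.ofReal (ε n) * 1 := by
        rw [mul_one]; exact h2
      rw [ENNReal.mul_le_mul_iff_right hne ENNReal.ofReal_ne_top] at h4
      rw [← ENNReal.inv_pow, ← one_div]
      rw [ENNReal.le_div_iff_mul_le (Or.inl (by simp)) (Or.inl (by simp)), mul_comm]
      exact h4
    have hs : ∑' n, lam {ν | ENNReal.ofReal (ε' n) ≤ ∫⁻ x, c n x ∂(ν.1 : Measure X)} ≠ ⊤ := by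
      refine ne_top_of_le_ne_top ?_ (ENNReal.tsum_le_tsum hb)
      rw [ENNReal.tsum_geometric]
      simp
    filter_upwards [ae_eventually_notMem hs] with ν hν
    filter_upwards [hν] with n hn
    simpa using hn
  -- Fatou
  have hae : ∀ᵐ ν ∂lam, lrdim d T (ν.1 : Measure X) ≤
      liminf (fun n => (∫⁻ x, G n x ∂(ν.1 : Measure X))
        / ENNReal.ofReal (Real.logb 2 (1 / ε' n))) atTop := by
    filter_upwards [hBC] with ν hν
    refine (liminf_aux hε'lim).trans ?_
    refine liminf_le_liminf ?_
    filter_upwards [hν] with n hn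
    gcongr
    exact hcG n _ inferInstance _ hn
  refine (lintegral_mono_ae hae).trans ?_
  refine (lintegral_liminf_le fun n => (hintm _ (hG n)).div_const _).trans ?_
  have hbound : ∀ n, ∫⁻ ν, (∫⁻ x, G n x ∂(ν.1 : Measure X))
        / ENNReal.ofReal (Real.logb 2 (1 / ε' n)) ∂lam
      ≤ (ell + (n + 1 : ℝ≥0∞)⁻¹) * (1 + (n + 1 : ℝ≥0∞)⁻¹) := by
    intro n
    rw [lintegral_div_aux _ _ (hintm _ (hG n)), ← hlint _ (hG n)]
    have hpos : 0 < Real.logb 2 (1 / ε' n) := by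
      rw [hlog2]; nlinarith [hlog1 n, (Nat.cast_nonneg n : (0:ℝ) ≤ n)]
    refine ENNReal.div_le_of_le_mul ((hGμ n).le.trans ?_)
    rw [mul_assoc]
    gcongr
    have hn1 : (1 + (n + 1 : ℝ≥0∞)⁻¹) = ENNReal.ofReal (1 + ((n:ℝ) + 1)⁻¹) := by
      rw [ENNReal.ofReal_add (by norm_num) (by positivity), ENNReal.ofReal_inv_of_pos (by positivity),
        ENNReal.ofReal_add (by positivity) (by norm_num)]
      simp
    rw [hn1, ← ENNReal.ofReal_mul (by positivity)]
    apply ENNReal.ofReal_le_ofReal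
    rw [hlog2]
    have h5 := hlog1 n
    have hn0 : (0:ℝ) ≤ n := Nat.cast_nonneg n
    have h6 : (n:ℝ) ≤ ((n:ℝ) + 1)⁻¹ * (Real.logb 2 (1 / ε n) - n) := by
      rw [inv_mul_eq_div, le_div_iff₀ (by positivity)]
      nlinarith
    linarith
  refine (liminf_le_liminf (Eventually.of_forall hbound)).trans ?_
  apply le_of_eq
  apply Tendsto.liminf_eq
  have hinv : Tendsto (fun n : ℕ => (n + 1 : ℝ≥0∞)⁻¹) atTop (𝓝 0) := by
    have := (tendsto_add_atTop_iff_nat 1).2 ENNReal.tendsto_inv_nat_nhds_zero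
    simpa using this
  have h1 : Tendsto (fun n : ℕ => ell + (n + 1 : ℝ≥0∞)⁻¹) atTop (𝓝 (ell + 0)) :=
    tendsto_const_nhds.add hinv
  have h2 : Tendsto (fun n : ℕ => 1 + (n + 1 : ℝ≥0∞)⁻¹) atTop (𝓝 (1 + 0)) :=
    tendsto_const_nhds.add hinv
  have := ENNReal.Tendsto.mul h1 (Or.inr (by simp)) h2 (Or.inr (by simpa using htop))
  simpa using this
end
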